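/- Let n = 2m be even and 0 ≤ k ≤ m−1. For every j ≥ 0 there is an isomorphism H^j_{{0}}(⟨Pf^{−2k}⟩_D) ≅ E^{⊕ c_j}, where c_j is the coefficient of q^j in the polynomial q^{m(2m−1)−k(2k+3)−4(m−k−1)k}·binom(m−1, m−k−1)_{q⁴}. -/

import Mathlib

/-!
Common setup: the polynomial ring `S = ℂ[x_{i,j}]` of the space
`X = ⋀² (ℂⁿ)*` of `n × n` complex skew-symmetric matrices, Pfaffians, the
`GL_n(ℂ)`-action, invariant ideals, Pfaffian varieties and their (radical)
vanishing ideals, local cohomology (Mathlib's `localCohomology`), the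
localization `S_Pf`, 𝒟-module spans in `S_Pf` (via the partial derivatives,
extended to `S_Pf` as derivations), Gaussian binomial coefficients, and
injective-hull data for `E = E(ℂ)`.
-/

open scoped BigOperators

noncomputable section

namespace SkewLC

/-- Indices `(i,j)` with `i < j`, labelling the variables `x_{i,j}`. -/
abbrev SkewIdx (n : ℕ) := {p : Fin n × Fin n // p.1 < p.2}

/-- `S = Sym(⋀² ℂ^n) ≅ ℂ[x_{i,j} : 1 ≤ i < j ≤ n]`. -/
abbrev PS (n : ℕ) := MvPolynomial (SkewIdx n) ℂ

/-- The `(i,j)` entry of the generic skew-symmetric matrix `(x_{i,j})`. -/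
def genEntry (n : ℕ) (i j : Fin n) : PS n :=
  if h : i < j then MvPolynomial.X ⟨(i, j), h⟩
  else if h' : j < i then - MvPolynomial.X ⟨(j, i), h'⟩
  else 0

/-- The Pfaffian of the principal `2r × 2r` block of the generic skew-symmetric
matrix (zero by convention if `2r > n`):
`Pf_r = (1/(2^r r!)) ∑_σ sign(σ) ∏_i x_{σ(2i-1) σ(2i)}`. -/
def pfBlock (n r : ℕ) : PS n :=
  if h : 2 * r ≤ n then
    (((2 ^ r * r.factorial : ℕ) : ℂ))⁻¹ •
      ∑ σ : Equiv.Perm (Fin (2 * r)),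
        (Equiv.Perm.sign σ : ℤ) •
          ∏ i : Fin r,
            genEntry n (Fin.castLE h (σ ⟨2 * i.1, by have := i.isLt; omega⟩))
              (Fin.castLE h (σ ⟨2 * i.1 + 1, by have := i.isLt; omega⟩))
  else 0

/-- The full `n × n` Pfaffian `Pf` (for `n` even). -/
def pfaffian (n : ℕ) : PS n := pfBlock n (n / 2)

/-- The action of an `n × n` matrix `g` on `S`, sending the generic
skew-symmetric matrix `X` to `g X gᵀ` (on variables,
`x_{ij} ↦ ∑_{a,b} g_{ia} g_{jb} x_{ab}`).  Restricted to invertible `g` this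
is the natural action of `GL_n(ℂ)` on `S`. -/
def glMap (n : ℕ) (g : Matrix (Fin n) (Fin n) ℂ) : PS n →ₐ[ℂ] PS n :=
  MvPolynomial.aeval fun p : SkewIdx n =>
    ∑ a : Fin n, ∑ b : Fin n, (g p.1.1 a * g p.1.2 b) • genEntry n a b

/-- `z : ℕ → ℕ` is a partition with at most `m` nonzero parts, recorded as the
(0-indexed) weakly decreasing sequence `z 0 ≥ z 1 ≥ ⋯`; so `z i` is the
`(i+1)`-st part `z_{i+1}` of the partition. -/
def IsPartition (m : ℕ) (z : ℕ → ℕ) : Prop :=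
  (∀ i j, i ≤ j → z j ≤ z i) ∧ ∀ i, m ≤ i → z i = 0

/-- The rectangular partition `a × b` (`a` parts equal to `b`). -/
def rect (a b : ℕ) : ℕ → ℕ := fun i => if i < a then b else 0

/-- The highest weight vector of the irreducible summand
`𝕊_{z^{(2)}} W ⊆ S`: the product `∏_i Pf_i^{z_i - z_{i+1}}` of powers of the
principal `2i × 2i` Pfaffians. -/
def hwVector (n : ℕ) (z : ℕ → ℕ) : PS n :=
  ∏ i ∈ Finset.range (n / 2), pfBlock n (i + 1) ^ (z i - z (i + 1))

/-- The `GL_n(ℂ)`-invariant ideal `I_z ⊆ S` generated by the irreducible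
subrepresentation `𝕊_{z^{(2)}} W` of `S`; since that irreducible is spanned by
the `GL`-orbit of its highest weight vector, `I_z` is the ideal generated by
the `GL_n(ℂ)`-orbit of `hwVector n z`. -/
def invIdeal (n : ℕ) (z : ℕ → ℕ) : Ideal (PS n) :=
  Ideal.span {f | ∃ g : Matrix.GeneralLinearGroup (Fin n) ℂ,
    f = glMap n g.val (hwVector n z)}

/-- The Pfaffian variety `O̅_k`: skew-symmetric `n × n` matrices of rank `≤ 2k`. -/
def rankVariety (n k : ℕ) : Set (Matrix (Fin n) (Fin n) ℂ) :=
  {A | A.transpose = -A ∧ A.rank ≤ 2 * k}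

/-- Evaluation of a polynomial in `S` at a matrix. -/
def evalMat (n : ℕ) (A : Matrix (Fin n) (Fin n) ℂ) : PS n →+* ℂ :=
  (MvPolynomial.aeval fun p : SkewIdx n => A p.1.1 p.1.2).toRingHom

/-- The (radical) vanishing ideal of the Pfaffian variety `O̅_k`; local
cohomology with support in `O̅_k` is local cohomology at this ideal. -/
def varIdeal (n k : ℕ) : Ideal (PS n) :=
  ⨅ A ∈ rankVariety n k, RingHom.ker (evalMat n A)

/-- The homogeneous maximal ideal `𝔪 ⊆ S` (the vanishing ideal of the origin);
`H^j_{{0}}(-) = H^j_𝔪(-)`. -/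
def mIdeal (n : ℕ) : Ideal (PS n) :=
  RingHom.ker (evalMat n 0)

/-- The Gaussian binomial coefficient evaluated at `q^e`,
`binom(a,b)_{q^e} ∈ ℤ[q] ⊆ ℚ[q]`, where
`binom(a,b)_q = ∏_{i=1}^{b} (1 - q^{a-b+i})/(1 - q^i)`.
(The polynomial division below is exact.) -/
def gaussBinom (a b e : ℕ) : Polynomial ℚ :=
  (∏ i ∈ Finset.range b, (1 - Polynomial.X ^ (e * (a - b + i + 1)))) /
    (∏ i ∈ Finset.range b, (1 - Polynomial.X ^ (e * (i + 1))))

/-- Data exhibiting `E` as the injective hull of `ℂ = S/𝔪` over `S`: an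
injective `S`-module together with an essential embedding of `S/𝔪`. -/
structure InjHullData (n : ℕ) where
  /-- the underlying module -/
  E : Type
  [addCommGroup : AddCommGroup E]
  [module : Module (PS n) E]
  injective : Module.Injective (PS n) E
  emb : (PS n ⧸ mIdeal n) →ₗ[PS n] E
  emb_injective : Function.Injective emb
  essential : ∀ N : Submodule (PS n) E, N ≠ ⊥ → N ⊓ LinearMap.range emb ≠ ⊥

attribute [instance] InjHullData.addCommGroup InjHullData.module

/-- `S_Pf`, the localization of `S` at the Pfaffian. -/
abbrev SPf (n : ℕ) : Type := Localization.Away (pfaffian n)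

/-- `Pf⁻¹ ∈ S_Pf`. -/
def pfInv (n : ℕ) : SPf n := IsLocalization.Away.invSelf (S := SPf n) (pfaffian n)

/-- An `S`-submodule of `S_Pf` is a `𝒟_X`-submodule iff it is stable under the
partial derivatives `∂/∂x_{ij}` (extended to `S_Pf`, as the family `δ`). -/
def DStable (n : ℕ) (δ : SkewIdx n → Derivation ℂ (SPf n) (SPf n))
    (N : Submodule (PS n) (SPf n)) : Prop :=
  ∀ p : SkewIdx n, ∀ x ∈ N, δ p x ∈ N

/-- `⟨v⟩_𝒟 ⊆ S_Pf`, the `𝒟_X`-submodule of `S_Pf` generated by `v`: the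
smallest `S`-submodule containing `v` and stable under all partial
derivatives. -/
def dSpan (n : ℕ) (δ : SkewIdx n → Derivation ℂ (SPf n) (SPf n)) (v : SPf n) :
    Submodule (PS n) (SPf n) :=
  sInf {N : Submodule (PS n) (SPf n) | v ∈ N ∧ DStable n δ N}

/-- The statement that `δ` is the family of partial derivatives `∂/∂x_{ij}` of
`S` extended to derivations of `S_Pf` (such an extension exists and is
unique). -/
def IsDerivExtension (n : ℕ) (δ : SkewIdx n → Derivation ℂ (SPf n) (SPf n)) : Prop :=
  ∀ (p : SkewIdx n) (f : PS n),
    δ p (algebraMap (PS n) (SPf n) f) = algebraMap (PS n) (SPf n) (MvPolynomial.pderiv p f)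

/-- For `n = 2m` and `0 ≤ p ≤ m - 1`, the indecomposable equivariant
`𝒟_X`-module `Q_p = S_Pf / ⟨Pf^{2(p-m+1)}⟩_𝒟 = S_Pf / ⟨Pf^{-2(m-1-p)}⟩_𝒟`. -/
abbrev QMod (n : ℕ) (δ : SkewIdx n → Derivation ℂ (SPf n) (SPf n)) (p : ℕ) :=
  SPf n ⧸ dSpan n δ (pfInv n ^ (2 * (n / 2 - 1 - p)))

/-- The `S`-submodule `𝒩_{k,e} = I_{(m-k) × e} ⊗_S 𝒫_{-e-2k} ⊆ S_Pf`
(`m = n/2`), i.e. the image of the invariant ideal `I_{(m-k) × e}` under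
multiplication by `Pf^{-e-2k}`. -/
def NMod (n k e : ℕ) : Submodule (PS n) (SPf n) :=
  Submodule.map
    ((LinearMap.mulLeft (PS n) (pfInv n ^ (e + 2 * k))).comp
      (Algebra.linearMap (PS n) (SPf n)))
    (invIdeal n (rect (n / 2 - k) e))

/-- The set `succ(z, l, m)` of partitions obtained from `z` by adding boxes in
row `l + 1` or higher (rows recorded 0-indexed: `y i > z i` for some
`l ≤ i < m`). -/
def succSet (m : ℕ) (z : ℕ → ℕ) (l : ℕ) : Set (ℕ → ℕ) :=
  {y | IsPartition m y ∧ (∀ i, z i ≤ y i) ∧ ∃ i, l ≤ i ∧ i < m ∧ z i < y i}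

/-- The ideal `I_{succ(z,l,m)} = ∑_{y ∈ succ(z,l,m)} I_y`. -/
def succIdeal (n : ℕ) (z : ℕ → ℕ) (l : ℕ) : Ideal (PS n) :=
  ⨆ y ∈ succSet (n / 2) z l, invIdeal n y

/-- The subquotient `J_{z,l} = I_z / I_{succ(z,l,m)}` of `S` (`m = n/2`). -/
abbrev JMod (n : ℕ) (z : ℕ → ℕ) (l : ℕ) :=
  ↥(invIdeal n z) ⧸
    Submodule.comap (invIdeal n z : Submodule (PS n) (PS n)).subtype
      (succIdeal n z l : Submodule (PS n) (PS n))

end SkewLC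

alias mAp := Module.End.mul_apply
alias qz := Submodule.Quotient.mk_eq_zero
alias ngA := LinearMap.neg_apply
alias cmA := LinearMap.comp_apply
alias sbA := LinearMap.sub_apply
alias adA := LinearMap.add_apply
alias smA := LinearMap.smul_apply
alias mkS := Submodule.mkQ_surjective
alias srS := Finset.sum_range_succ
alias inj0 := injective_iff_map_eq_zero
alias onA := Module.End.one_apply
notation "ω" => (by omega)
section
open CategoryTheory CategoryTheory.Limits
set_option linter.unusedSectionVars false
namespace SkewLC
universe v u v' u'
section gen
variable {C : Type u} [Category.{v} C] [Abelian C] [EnoughProjectives C]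
  {D : Type u'} [Category.{v'} D] [Abelian D]
def sesCx {F1 F2 F3 : C ⥤ D} [F1.Additive] [F2.Additive] [F3.Additive]
    (f : F1 ⟶ F2) (g : F2 ⟶ F3) (h0 : f ≫ g = 0) (K : ChainComplex C ℕ) :
    ShortComplex (ChainComplex D ℕ) where
  f := (NatTrans.mapHomologicalComplex f (ComplexShape.down ℕ)).app K
  g := (NatTrans.mapHomologicalComplex g (ComplexShape.down ℕ)).app K
  zero := by
    ext i
    have := NatTrans.congr_app h0 (K.X i)
    exact this
def sesCxMap {F1 F2 F3 : C ⥤ D} [F1.Additive] [F2.Additive] [F3.Additive]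
    (f : F1 ⟶ F2) (g : F2 ⟶ F3) (h0 : f ≫ g = 0) {K K' : ChainComplex C ℕ} (φ : K ⟶ K') :
    sesCx f g h0 K ⟶ sesCx f g h0 K' where
  τ₁ := (F1.mapHomologicalComplex _).map φ
  τ₂ := (F2.mapHomologicalComplex _).map φ
  τ₃ := (F3.mapHomologicalComplex _).map φ
  comm₁₂ := ((NatTrans.mapHomologicalComplex f (ComplexShape.down ℕ)).naturality φ)
  comm₂₃ := ((NatTrans.mapHomologicalComplex g (ComplexShape.down ℕ)).naturality φ)
lemma sesCx_shortExact {F1 F2 F3 : C ⥤ D} [F1.Additive] [F2.Additive] [F3.Additive]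
    (f : F1 ⟶ F2) (g : F2 ⟶ F3) (h0 : f ≫ g = 0)
    (hP : ∀ (P : C) [Projective P],
      (ShortComplex.mk (f.app P) (g.app P) (by rw [← NatTrans.comp_app, h0]; rfl)).ShortExact)
    {X : C} (P : ProjectiveResolution X) : (sesCx f g h0 P.complex).ShortExact := by
  apply HomologicalComplex.shortExact_of_degreewise_shortExact
  intro i
  exact hP (P.complex.X i)
lemma sq_aux {X1 X2 Y1 Y2 Z1 Z2 W1 W2 : D} (p : X1 ⟶ X2) (i1 : X1 ⟶ Y1) (i2 : X2 ⟶ Y2)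
    (h : Y1 ⟶ Y2) (d1 : Y1 ⟶ Z1) (d2 : Y2 ⟶ Z2) (k : Z1 ⟶ Z2) (j1 : Z1 ⟶ W1) (j2 : Z2 ⟶ W2)
    (q : W1 ⟶ W2) (e1 : p ≫ i2 = i1 ≫ h) (e3 : h ≫ d2 = d1 ≫ k) (e2 : j1 ≫ q = k ≫ j2) :
    p ≫ i2 ≫ d2 ≫ j2 = (i1 ≫ d1 ≫ j1) ≫ q := by
  rw [reassoc_of% e1, reassoc_of% e3, Category.assoc, Category.assoc, e2]
lemma dimShift {F1 F2 F3 : C ⥤ D} [F1.Additive] [F2.Additive] [F3.Additive]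
    (f : F1 ⟶ F2) (g : F2 ⟶ F3) (h0 : f ≫ g = 0)
    (hP : ∀ (P : C) [Projective P],
      (ShortComplex.mk (f.app P) (g.app P) (by rw [← NatTrans.comp_app, h0]; rfl)).ShortExact)
    {J : Type} [Category.{0} J] (a : J ⥤ C) (n : ℕ)
    (h1 : ∀ t, IsZero ((F2.leftDerived (n+1)).obj (a.obj t)))
    (h2 : ∀ t, IsZero ((F2.leftDerived n).obj (a.obj t))) :
    Nonempty (a ⋙ F3.leftDerived (n+1) ≅ a ⋙ F1.leftDerived n) := by
  have key : ∀ t, ∃ z : (F3.leftDerived (n+1)).obj (a.obj t) ≅ (F1.leftDerived n).obj (a.obj t),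
     z = ((projectiveResolution (a.obj t)).isoLeftDerivedObj F3 (n+1)) ≪≫
      ((sesCx_shortExact f g h0 hP (projectiveResolution (a.obj t))).δIso (n+1) n rfl
        ((h1 t).of_iso ((projectiveResolution (a.obj t)).isoLeftDerivedObj F2 (n+1)).symm)
        ((h2 t).of_iso ((projectiveResolution (a.obj t)).isoLeftDerivedObj F2 n).symm))
       ≪≫ ((projectiveResolution (a.obj t)).isoLeftDerivedObj F1 n).symm := fun t => ⟨_, rfl⟩
  choose z hz using key
  refine ⟨NatIso.ofComponents z ?_⟩
  intro s t w
  rw [hz, hz]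
  let φ := ProjectiveResolution.lift (a.map w) (projectiveResolution (a.obj s))
    (projectiveResolution (a.obj t))
  have hφ : φ.f 0 ≫ (projectiveResolution (a.obj t)).π.f 0 =
     (projectiveResolution (a.obj s)).π.f 0 ≫ a.map w := by
    have := ProjectiveResolution.lift_commutes (a.map w) (projectiveResolution (a.obj s))
     (projectiveResolution (a.obj t))
    have := HomologicalComplex.congr_hom this 0
    simpa [φ] using ProjectiveResolution.lift_commutes_zero (a.map w) (projectiveResolution (a.obj s))
     (projectiveResolution (a.obj t))
  have e1 := ProjectiveResolution.isoLeftDerivedObj_hom_naturality (a.map w) _ _ φ hφ F3 (n+1)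
  have e2 := ProjectiveResolution.isoLeftDerivedObj_inv_naturality (a.map w) _ _ φ hφ F1 n
  have e3 := HomologicalComplex.HomologySequence.δ_naturality (sesCxMap f g h0 φ)
    (sesCx_shortExact f g h0 hP (projectiveResolution (a.obj s)))
    (sesCx_shortExact f g h0 hP (projectiveResolution (a.obj t))) (n+1) n rfl
  exact sq_aux _ _ _ _ _ _ _ _ _ _ e1 e3.symm e2
lemma zeroShift {F1 F2 F3 : C ⥤ D} [F1.Additive] [F2.Additive] [F3.Additive]
    (f : F1 ⟶ F2) (g : F2 ⟶ F3) (h0 : f ≫ g = 0)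
    (hP : ∀ (P : C) [Projective P],
      (ShortComplex.mk (f.app P) (g.app P) (by rw [← NatTrans.comp_app, h0]; rfl)).ShortExact)
    (A : C) (n : ℕ)
    (h1 : IsZero ((F2.leftDerived (n+1)).obj A))
    (h2 : IsZero ((F1.leftDerived n).obj A)) :
    IsZero ((F3.leftDerived (n+1)).obj A) := by
  have h := (sesCx_shortExact f g h0 hP (projectiveResolution A))
  have := h.homology_exact₃ (n+1) n rfl
  refine IsZero.of_iso ?_ ((projectiveResolution A).isoLeftDerivedObj F3 (n+1))
  exact ShortComplex.Exact.isZero_of_both_zeros this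
   (((h1).of_iso ((projectiveResolution A).isoLeftDerivedObj F2 (n+1)).symm).eq_of_src _ _)
   (((h2).of_iso ((projectiveResolution A).isoLeftDerivedObj F1 n).symm).eq_of_tgt _ _)
end gen
section md
variable {R : Type} [CommRing R]
abbrev FY (Y : ModuleCat.{0} R) : ModuleCat.{0} R ⥤ (ModuleCat.{0} R)ᵒᵖ :=
  ((linearYoneda R (ModuleCat.{0} R)).obj Y).rightOp
end md
end SkewLC
end

section
open CategoryTheory CategoryTheory.Limits
namespace SkewLC
section md
variable {R : Type} [CommRing R]
instance presFC (Y : ModuleCat.{0} R) : PreservesFiniteColimits (FY Y) := by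
  have : PreservesLimitsOfSize.{0,0} ((linearYoneda R (ModuleCat.{0} R)).obj Y) := by
    have : PreservesLimitsOfSize.{0,0} ((linearYoneda R (ModuleCat.{0} R)).obj Y ⋙ forget (ModuleCat R)) :=
      inferInstanceAs (PreservesLimitsOfSize.{0,0} (yoneda.obj Y))
    exact preservesLimits_of_reflects_of_preserves _ (forget (ModuleCat R))
  have := preservesColimitsOfSize_rightOp ((linearYoneda R (ModuleCat.{0} R)).obj Y)
  exact PreservesColimitsOfSize.preservesFiniteColimits (FY Y)
lemma ext_inj_zero (I : ModuleCat.{0} R) [Injective I] (A : ModuleCat.{0} R) (n : ℕ) :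
    IsZero (((FY I).leftDerived (n+1)).obj A) := by
  suffices h : IsZero (((Ext R (ModuleCat.{0} R) (n+1)).obj (Opposite.op A)).obj I) from h.op
  let P := projectiveResolution A
  refine IsZero.of_iso ?_ (P.isoExt (n+1) I)
  rw [← HomologicalComplex.exactAt_iff_isZero_homology]
  rw [HomologicalComplex.exactAt_iff' _ n (n+1) (n+2) (by simp) (by simp)]
  rw [ShortComplex.moduleCat_exact_iff]
  intro x hx
  have hex := P.complex_exactAt_succ n
  rw [HomologicalComplex.exactAt_iff' _ (n+2) (n+1) n (by simp) (by simp)] at hex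
  exact ⟨hex.descToInjective x hx, hex.comp_descToInjective x hx⟩
lemma hom_proj_exact (S : ShortComplex (ModuleCat.{0} R)) (hS : S.ShortExact)
    (P : ModuleCat.{0} R) [Projective P]
    (hz : (NatTrans.rightOp ((linearYoneda R (ModuleCat.{0} R)).map S.g)).app P ≫
      (NatTrans.rightOp ((linearYoneda R (ModuleCat.{0} R)).map S.f)).app P = 0) :
    (ShortComplex.mk
      ((NatTrans.rightOp ((linearYoneda R (ModuleCat.{0} R)).map S.g)).app P)
      ((NatTrans.rightOp ((linearYoneda R (ModuleCat.{0} R)).map S.f)).app P) hz).ShortExact := by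
  have := hS.mono_f
  have := hS.epi_g
  let T : ShortComplex (ModuleCat.{0} R) := ShortComplex.mk
    (((linearYoneda R (ModuleCat.{0} R)).map S.f).app (Opposite.op P))
    (((linearYoneda R (ModuleCat.{0} R)).map S.g).app (Opposite.op P)) (by
      rw [← NatTrans.comp_app, ← Functor.map_comp, S.zero]; ext; simp)
  have hT : T.ShortExact := by
    refine ShortComplex.ShortExact.mk' ?_ ?_ ?_
    · rw [ShortComplex.moduleCat_exact_iff]
      intro x hx
      exact ⟨hS.exact.lift x hx, hS.exact.lift_f x hx⟩
    · rw [ModuleCat.mono_iff_injective]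
      intro x y hxy
      exact (cancel_mono S.f).1 hxy
    · rw [ModuleCat.epi_iff_surjective]
      intro x
      exact ⟨Projective.factorThru x S.g, Projective.factorThru_comp x S.g⟩
  exact hT.op
lemma rightOp_zero (S : ShortComplex (ModuleCat.{0} R)) :
    NatTrans.rightOp ((linearYoneda R (ModuleCat.{0} R)).map S.g) ≫
      NatTrans.rightOp ((linearYoneda R (ModuleCat.{0} R)).map S.f) = 0 := by
  rw [← NatTrans.rightOp_comp, ← Functor.map_comp, S.zero, Functor.map_zero]; rfl
lemma extShift (S : ShortComplex (ModuleCat.{0} R)) (hS : S.ShortExact) [Injective S.X₂]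
    {J : Type} [Category.{0} J] (a : J ⥤ ModuleCat.{0} R) (n : ℕ)
    (h2 : ∀ t, IsZero (((FY S.X₂).leftDerived n).obj (a.obj t))) :
    Nonempty (a ⋙ (FY S.X₁).leftDerived (n+1) ≅ a ⋙ (FY S.X₃).leftDerived n) :=
  dimShift _ _ (rightOp_zero S) (fun P _ => hom_proj_exact S hS P _) a n
    (fun _ => ext_inj_zero _ _ _) h2
lemma extZero (S : ShortComplex (ModuleCat.{0} R)) (hS : S.ShortExact) [Injective S.X₂]
    (A : ModuleCat.{0} R) (n : ℕ)
    (h2 : IsZero (((FY S.X₃).leftDerived n).obj A)) :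
    IsZero (((FY S.X₁).leftDerived (n+1)).obj A) :=
  zeroShift _ _ (rightOp_zero S) (fun P _ => hom_proj_exact S hS P _) A n
    (ext_inj_zero _ _ _) h2
def extZeroIso (Y : ModuleCat.{0} R) : (FY Y).leftDerived 0 ≅ FY Y := (FY Y).leftDerivedZeroIsoSelf
end md
end SkewLC
end

section
open CategoryTheory CategoryTheory.Limits
namespace SkewLC
section md
variable {R : Type} [CommRing R]
abbrev aJ (J : Ideal R) : ℕᵒᵖ ⥤ ModuleCat.{0} R :=
  localCohomology.ringModIdeals (localCohomology.idealPowersDiagram J)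
def leftOpIso {J : Type} [Category.{0} J] (a : J ⥤ ModuleCat.{0} R)
   (F G : ModuleCat.{0} R ⥤ (ModuleCat.{0} R)ᵒᵖ) (α : a ⋙ F ≅ a ⋙ G) :
   a.op ⋙ F.leftOp ≅ a.op ⋙ G.leftOp :=
  NatIso.ofComponents (fun t => (α.app t.unop).unop.symm) (by
    intro s t f
    apply Quiver.Hom.op_inj
    have := α.inv.naturality f.unop
    simpa using this.symm)
def torCocone (J : Ideal R) (Q : ModuleCat.{0} R) : Cocone ((aJ J).op ⋙ (FY Q).leftOp) where
  pt := Q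
  ι := { app := fun t => ModuleCat.ofHom
          { toFun := fun f => f.hom (Ideal.Quotient.mk _ 1)
            map_add' := by intro x y; rfl
            map_smul' := by intro r x; rfl }
         naturality := by
          intro s t f
          rfl }
def torIsColimit (J : Ideal R) (Q : ModuleCat.{0} R)
    (hQ : ∀ q : Q, ∃ t : ℕ, ∀ r ∈ J ^ t, r • q = 0) : IsColimit (torCocone J Q) := by
  apply isColimitOfReflects (forget (ModuleCat R))
  have hs : ∀ q : Q, ∃ (i : (ℕᵒᵖ)ᵒᵖ) (xi : ((aJ J).op ⋙ (FY Q).leftOp).obj i),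
      q = ((torCocone J Q).ι.app i).hom xi := by
    intro q
    obtain ⟨t, ht⟩ := hQ q
    refine ⟨Opposite.op (Opposite.op t), ModuleCat.ofHom (Submodule.liftQ (J ^ t)
      (LinearMap.toSpanSingleton R Q q) (fun r hr => ?_)), ?_⟩
    · exact ht r hr
    · exact (one_smul R q).symm
  have hi : ∀ (i : (ℕᵒᵖ)ᵒᵖ) (x y : ((aJ J).op ⋙ (FY Q).leftOp).obj i),
      ((torCocone J Q).ι.app i).hom x = ((torCocone J Q).ι.app i).hom y → x = y := by
    intro i x y h
    apply ModuleCat.hom_ext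
    apply Submodule.linearMap_qext
    apply LinearMap.ext_ring
    exact h
  apply Types.FilteredColimit.isColimitOf'
  · exact hs
  · intro i x y h
    exact ⟨i, 𝟙 i, by rw [hi i x y h]⟩
theorem lc_iso (J : Ideal R) (M Q : ModuleCat.{0} R) (j : ℕ)
    (hQ : ∀ q : Q, ∃ t : ℕ, ∀ r ∈ J ^ t, r • q = 0)
    (h : Nonempty (aJ J ⋙ (FY M).leftDerived j ≅ aJ J ⋙ FY Q)) :
    Nonempty ((localCohomology J j).obj M ≅ Q) := by
  obtain ⟨α⟩ := h
  have e1 : (localCohomology J j).obj M ≅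
     colimit (localCohomology.diagram (localCohomology.idealPowersDiagram J) j ⋙ (evaluation _ _).obj M) :=
    colimitObjIsoColimitCompEvaluation _ _
  have e2 : localCohomology.diagram (localCohomology.idealPowersDiagram J) j ⋙ (evaluation _ _).obj M ≅
     (aJ J).op ⋙ ((FY M).leftDerived j).leftOp := NatIso.ofComponents (fun t => Iso.refl _) (by
       intro s t f
       erw [Category.comp_id])
  have e3 := HasColimit.isoOfNatIso (e2 ≪≫ leftOpIso _ _ _ α)
  exact ⟨e1 ≪≫ e3 ≪≫ (colimit.isColimit _).coconePointUniqueUpToIso (torIsColimit J Q hQ)⟩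
end md
end SkewLC
end

section
namespace SkewLC
structure Cx where
  V : Type
  [acg : AddCommGroup V]
  [mod : Module ℂ V]
  d : V →ₗ[ℂ] V
  gr : ℤ → Submodule ℂ V
  d_gr : ∀ j, ∀ a ∈ gr j, d a ∈ gr (j+1)
  d_d : ∀ j, ∀ a ∈ gr j, d (d a) = 0
attribute [instance] Cx.acg Cx.mod
def Cx.Z (C : Cx) (j : ℤ) : Submodule ℂ C.V := C.gr j ⊓ LinearMap.ker C.d
def Cx.B (C : Cx) (j : ℤ) : Submodule ℂ C.V := (C.gr (j-1)).map C.d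
abbrev Cx.H (C : Cx) (j : ℤ) : Type := ↥(C.Z j) ⧸ (C.B j).submoduleOf (C.Z j)
variable {C C1 C2 C3 C4 : Cx}
lemma Cx.B_le (j : ℤ) : C.B j ≤ C.Z j := by
  rintro _ ⟨b, hb, rfl⟩
  refine ⟨?_, C.d_d _ _ hb⟩
  have := C.d_gr _ _ hb
  rwa [sub_add_cancel] at this
def Cx.mk' (C : Cx) (j : ℤ) : C.Z j →ₗ[ℂ] C.H j := Submodule.mkQ _
lemma Cx.mk_surj (j : ℤ) : Function.Surjective (C.mk' j) := mkS _
lemma Cx.mk_eq_zero {j : ℤ} (a : C.Z j) : C.mk' j a = 0 ↔ (a : C.V) ∈ C.B j :=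
  qz _
def Hm {j i : ℤ} (F : C1.V →ₗ[ℂ] C2.V) (hZ : ∀ a ∈ C1.Z j, F a ∈ C2.Z i)
    (hB : ∀ a ∈ C1.B j, F a ∈ C2.B i) : C1.H j →ₗ[ℂ] C2.H i :=
  Submodule.mapQ _ _ (F.restrict hZ) (fun a ha => hB a ha)
@[simp] lemma Hm_mk {j i : ℤ} (F : C1.V →ₗ[ℂ] C2.V) (hZ : ∀ a ∈ C1.Z j, F a ∈ C2.Z i)
    (hB : ∀ a ∈ C1.B j, F a ∈ C2.B i) (a : C1.Z j) :
    Hm F hZ hB (C1.mk' j a) = C2.mk' i ⟨F a, hZ a a.2⟩ := rfl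
lemma Hm_inj {j i : ℤ} (F : C1.V →ₗ[ℂ] C2.V) (hZ : ∀ a ∈ C1.Z j, F a ∈ C2.Z i)
    (hB : ∀ a ∈ C1.B j, F a ∈ C2.B i) (h : ∀ a ∈ C1.Z j, F a ∈ C2.B i → a ∈ C1.B j) :
    Function.Injective (Hm F hZ hB) := by
  rw [inj0]
  intro x hx
  obtain ⟨a, rfl⟩ := Cx.mk_surj j x
  rw [Hm_mk, Cx.mk_eq_zero] at hx
  rw [Cx.mk_eq_zero]
  exact h a a.2 hx
lemma Hm_surj {j i : ℤ} (F : C1.V →ₗ[ℂ] C2.V) (hZ : ∀ a ∈ C1.Z j, F a ∈ C2.Z i)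
    (hB : ∀ a ∈ C1.B j, F a ∈ C2.B i) (h : ∀ b ∈ C2.Z i, ∃ a ∈ C1.Z j, F a - b ∈ C2.B i) :
    Function.Surjective (Hm F hZ hB) := by
  intro x
  obtain ⟨b, rfl⟩ := Cx.mk_surj i x
  obtain ⟨a, ha, hab⟩ := h b b.2
  refine ⟨C1.mk' j ⟨a, ha⟩, ?_⟩
  rw [Hm_mk, ← sub_eq_zero, ← map_sub, Cx.mk_eq_zero]
  exact hab
structure IsCh (C1 C2 : Cx) (F : C1.V →ₗ[ℂ] C2.V) : Prop where
  gr : ∀ j, ∀ a ∈ C1.gr j, F a ∈ C2.gr j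
  d : ∀ j, ∀ a ∈ C1.gr j, F (C1.d a) = C2.d (F a)
lemma IsCh.Z {F : C1.V →ₗ[ℂ] C2.V} (h : IsCh C1 C2 F) (j : ℤ) : ∀ a ∈ C1.Z j, F a ∈ C2.Z j := by
  rintro a ⟨h1, h2⟩
  refine ⟨h.gr _ _ h1, ?_⟩
  have h2 : C1.d a = 0 := h2
  show C2.d (F a) = 0
  rw [← h.d _ _ h1, h2, map_zero]
lemma IsCh.B {F : C1.V →ₗ[ℂ] C2.V} (h : IsCh C1 C2 F) (j : ℤ) : ∀ a ∈ C1.B j, F a ∈ C2.B j := by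
  rintro _ ⟨b, hb, rfl⟩
  exact ⟨F b, h.gr _ _ hb, (h.d _ _ hb).symm⟩
def IsCh.H {F : C1.V →ₗ[ℂ] C2.V} (h : IsCh C1 C2 F) (j : ℤ) : C1.H j →ₗ[ℂ] C2.H j :=
  Hm F (h.Z j) (h.B j)
lemma IsCh.H_mk {F : C1.V →ₗ[ℂ] C2.V} (h : IsCh C1 C2 F) (j : ℤ) (a : C1.Z j) :
    h.H j (C1.mk' j a) = C2.mk' j ⟨F a, h.Z j a a.2⟩ := rfl
structure SES (C1 C2 C3 : Cx) where
  i : C1.V →ₗ[ℂ] C2.V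
  p : C2.V →ₗ[ℂ] C3.V
  s : C3.V →ₗ[ℂ] C2.V
  r : C2.V →ₗ[ℂ] C1.V
  hi : IsCh C1 C2 i
  hp : IsCh C2 C3 p
  hs : ∀ j, ∀ a ∈ C3.gr j, s a ∈ C2.gr j
  hr : ∀ j, ∀ a ∈ C2.gr j, r a ∈ C1.gr j
  ri : ∀ j, ∀ a ∈ C1.gr j, r (i a) = a
  ps : ∀ j, ∀ a ∈ C3.gr j, p (s a) = a
  pi : ∀ j, ∀ a ∈ C1.gr j, p (i a) = 0
  ir : ∀ j, ∀ a ∈ C2.gr j, i (r a) + s (p a) = a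
namespace SES
variable (S : SES C1 C2 C3)
def dl : C3.V →ₗ[ℂ] C1.V := S.r ∘ₗ C2.d ∘ₗ S.s
lemma i_inj {j : ℤ} {a : C1.V} (ha : a ∈ C1.gr j) (h : S.i a = 0) : a = 0 := by
  rw [← S.ri j a ha, h, map_zero]
lemma i_r {j : ℤ} {a : C2.V} (ha : a ∈ C2.gr j) (h : S.p a = 0) : S.i (S.r a) = a := by
  have := S.ir j a ha
  rwa [h, map_zero, add_zero] at this
lemma i_dl {j : ℤ} {a : C3.V} (ha : a ∈ C3.gr j) (h : C3.d a = 0) :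
    S.i (S.dl a) = C2.d (S.s a) := by
  apply S.i_r (j := j+1) (C2.d_gr _ _ (S.hs _ _ ha))
  rw [S.hp.d _ _ (S.hs _ _ ha), S.ps _ _ ha, h]
lemma dl_Z (j : ℤ) : ∀ a ∈ C3.Z j, S.dl a ∈ C1.Z (j+1) := by
  rintro a ⟨h1, h2⟩
  have hg : S.dl a ∈ C1.gr (j+1) := S.hr _ _ (C2.d_gr _ _ (S.hs _ _ h1))
  refine ⟨hg, ?_⟩
  apply S.i_inj (C1.d_gr _ _ hg)
  rw [S.hi.d _ _ hg, S.i_dl h1 h2, C2.d_d _ _ (S.hs _ _ h1)]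
lemma dl_B (j : ℤ) : ∀ a ∈ C3.B j, S.dl a ∈ C1.B (j+1) := by
  intro a ha
  have hZ := C3.B_le j ha
  obtain ⟨b, hb, rfl⟩ := ha
  have e : S.dl (C3.d b) = - C1.d (S.dl b) := by
    have h1 := S.ir _ _ (C2.d_gr _ _ (S.hs _ _ hb))
    rw [S.hp.d _ _ (S.hs _ _ hb), S.ps _ _ hb] at h1
    have hg : S.dl b ∈ C1.gr (j - 1 + 1) := S.hr _ _ (C2.d_gr _ _ (S.hs _ _ hb))
    have h2 : S.s (C3.d b) = C2.d (S.s b) - S.i (S.dl b) := by rw [← h1]; simp [dl]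
    show S.r (C2.d (S.s (C3.d b))) = _
    rw [h2, map_sub, C2.d_d _ _ (S.hs _ _ hb), zero_sub, map_neg, ← S.hi.d _ _ hg,
      S.ri _ _ (C1.d_gr _ _ hg)]
  rw [e]
  refine ⟨- S.dl b, ?_, map_neg _ _⟩
  have hg : S.dl b ∈ C1.gr (j - 1 + 1) := S.hr _ _ (C2.d_gr _ _ (S.hs _ _ hb))
  have : j - 1 + 1 = j + 1 - 1 := by ring
  rw [this] at hg
  exact neg_mem hg
def Hδ (j : ℤ) : C3.H j →ₗ[ℂ] C1.H (j+1) := Hm S.dl (S.dl_Z j) (S.dl_B j)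
lemma exact_ip (j : ℤ) : Function.Exact (S.hi.H j) (S.hp.H j) := by
  intro x
  obtain ⟨⟨a, ha⟩, rfl⟩ := Cx.mk_surj j x
  constructor
  · intro h
    rw [IsCh.H_mk, Cx.mk_eq_zero] at h
    obtain ⟨b, hb, hb2⟩ := h
    simp only at hb2
    have hsb := S.hs _ _ hb
    have hdsb : C2.d (S.s b) ∈ C2.gr j := by
      have := C2.d_gr _ _ hsb; rwa [sub_add_cancel] at this
    have hc : a - C2.d (S.s b) ∈ C2.gr j := sub_mem ha.1 hdsb
    have hpc : S.p (a - C2.d (S.s b)) = 0 := by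
      rw [map_sub, S.hp.d _ _ hsb, S.ps _ _ hb, hb2, sub_self]
    have hic := S.i_r hc hpc
    have hrg := S.hr _ _ hc
    refine ⟨C1.mk' j ⟨S.r (a - C2.d (S.s b)), hrg, ?_⟩, ?_⟩
    · apply S.i_inj (C1.d_gr _ _ hrg)
      rw [S.hi.d _ _ hrg, hic, map_sub, C2.d_d _ _ hsb, show C2.d a = 0 from ha.2, sub_zero]
    · rw [IsCh.H_mk, ← sub_eq_zero, ← map_sub, Cx.mk_eq_zero]
      simp only [AddSubgroupClass.coe_sub, hic]
      exact ⟨- S.s b, neg_mem hsb, by simp⟩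
  · rintro ⟨y, hy⟩
    obtain ⟨⟨b, hb⟩, rfl⟩ := Cx.mk_surj j y
    rw [← hy, IsCh.H_mk, IsCh.H_mk, Cx.mk_eq_zero]
    simp only
    rw [S.pi _ _ hb.1]
    exact zero_mem _
lemma exact_pδ (j : ℤ) : Function.Exact (S.hp.H j) (S.Hδ j) := by
  intro x
  obtain ⟨⟨a, ha⟩, rfl⟩ := Cx.mk_surj j x
  constructor
  · intro h
    rw [Hδ, Hm_mk, Cx.mk_eq_zero] at h
    obtain ⟨b, hb, hb2⟩ := h
    simp only at hb2
    rw [add_sub_cancel_right] at hb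
    have hc : S.s a - S.i b ∈ C2.gr j := sub_mem (S.hs _ _ ha.1) (S.hi.gr _ _ hb)
    refine ⟨C2.mk' j ⟨S.s a - S.i b, hc, ?_⟩, ?_⟩
    · show C2.d _ = 0
      rw [map_sub, ← S.hi.d _ _ hb, hb2, S.i_dl ha.1 ha.2, sub_self]
    · rw [IsCh.H_mk]
      congr 2
      rw [map_sub, S.ps _ _ ha.1, S.pi _ _ hb, sub_zero]
  · rintro ⟨y, hy⟩
    obtain ⟨⟨b, hb⟩, rfl⟩ := Cx.mk_surj j y
    rw [← hy, IsCh.H_mk, Hδ, Hm_mk, Cx.mk_eq_zero]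
    simp only
    have h1 := S.ir _ _ hb.1
    have h2 : S.s (S.p b) = b - S.i (S.r b) := by
      rw [eq_sub_iff_add_eq, add_comm]; exact h1
    have hg := S.hr _ _ hb.1
    refine ⟨- S.r b, ?_, ?_⟩
    · rw [add_sub_cancel_right]; exact neg_mem hg
    · show _ = S.r (C2.d (S.s (S.p b)))
      rw [h2, map_sub, show C2.d b = 0 from hb.2, zero_sub, map_neg, map_neg, ← S.hi.d _ _ hg,
        S.ri _ _ (C1.d_gr _ _ hg)]
lemma exact_δi (j : ℤ) : Function.Exact (S.Hδ j) (S.hi.H (j+1)) := by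
  intro x
  obtain ⟨⟨a, ha⟩, rfl⟩ := Cx.mk_surj _ x
  constructor
  · intro h
    rw [IsCh.H_mk, Cx.mk_eq_zero] at h
    obtain ⟨b, hb, hb2⟩ := h
    simp only at hb2
    rw [add_sub_cancel_right] at hb
    have hpb := S.hp.gr _ _ hb
    have hz : C3.d (S.p b) = 0 := by rw [← S.hp.d _ _ hb, hb2, S.pi _ _ ha.1]
    refine ⟨C3.mk' j ⟨S.p b, hpb, hz⟩, ?_⟩
    rw [Hδ, Hm_mk, ← sub_eq_zero, ← map_sub, Cx.mk_eq_zero]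
    have h1 := S.ir _ _ hb
    have h2 : S.s (S.p b) = b - S.i (S.r b) := by
      rw [eq_sub_iff_add_eq, add_comm]; exact h1
    have hg := S.hr _ _ hb
    refine ⟨- S.r b, ?_, ?_⟩
    · rw [add_sub_cancel_right]; exact neg_mem hg
    · show _ = S.r (C2.d (S.s (S.p b))) - a
      rw [h2, map_sub, map_sub, hb2, ← S.hi.d _ _ hg, S.ri _ _ (C1.d_gr _ _ hg), S.ri _ _ ha.1]
      simp
  · rintro ⟨y, hy⟩
    obtain ⟨⟨b, hb⟩, rfl⟩ := Cx.mk_surj j y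
    rw [← hy, Hδ, Hm_mk, IsCh.H_mk, Cx.mk_eq_zero]
    refine ⟨S.s b, ?_, ?_⟩
    · rw [add_sub_cancel_right]; exact S.hs _ _ hb.1
    · exact (S.i_dl hb.1 hb.2).symm
end SES
end SkewLC
end

section
namespace SkewLC
open MvPolynomial
abbrev PP (τ : Type) := MvPolynomial τ ℂ
abbrev VV (M : Type) := List Bool → M
abbrev Rp (τ M : Type) [AddCommGroup M] [Module ℂ M] := PP τ →ₐ[ℂ] Module.End ℂ M
section kz
variable {τ : Type} {M N Q : Type} [AddCommGroup M] [Module ℂ M] [AddCommGroup N] [Module ℂ N]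
  [AddCommGroup Q] [Module ℂ Q]
lemma rp_comm (Φ : Rp τ M) (f g : PP τ) (a : M) : Φ f (Φ g a) = Φ g (Φ f a) := by
  rw [← mAp, ← mAp, ← map_mul, ← map_mul, mul_comm]
def pp (b : Bool) : VV M →ₗ[ℂ] VV M := LinearMap.funLeft ℂ M (fun w => b :: w)
def pair : VV M → VV M → VV M := fun a c w =>
  match w with
  | [] => 0
  | false :: w => a w
  | true :: w => c w
def pairL : (VV M × VV M) →ₗ[ℂ] VV M where
  toFun x := pair x.1 x.2
  map_add' x y := by funext w; rcases w with _ | ⟨_ | _, w⟩ <;> simp [pair]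
  map_smul' x y := by funext w; rcases w with _ | ⟨_ | _, w⟩ <;> simp [pair]
@[simp] lemma pp_pairL0 (x : VV M × VV M) : pp false (pairL x) = x.1 := rfl
@[simp] lemma pp_pairL1 (x : VV M × VV M) : pp true (pairL x) = x.2 := rfl
@[simp] lemma pairL_nil (x : VV M × VV M) : pairL x [] = 0 := rfl
lemma VV_ext {a b : VV M} (h : a [] = b []) (h0 : pp false a = pp false b)
    (h1 : pp true a = pp true b) : a = b := by
  funext w
  rcases w with _ | ⟨_ | _, w⟩
  · exact h
  · exact congrFun h0 w
  · exact congrFun h1 w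
def mapV (f : M →ₗ[ℂ] N) : VV M →ₗ[ℂ] VV N := f.compLeft (List Bool)
@[simp] lemma mapV_apply (f : M →ₗ[ℂ] N) (a : VV M) (w) : mapV f a w = f (a w) := rfl
@[simp] lemma pp_mapV (f : M →ₗ[ℂ] N) (a : VV M) (b) : pp b (mapV f a) = mapV f (pp b a) := rfl
def dK (Φ : Rp τ M) : List τ → VV M →ₗ[ℂ] VV M
  | [] => 0
  | t :: L => pairL ∘ₗ (LinearMap.prod (dK Φ L ∘ₗ pp false)
      (mapV (Φ (X t)) ∘ₗ pp false - dK Φ L ∘ₗ pp true))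
@[simp] lemma dK_nil (Φ : Rp τ M) : dK Φ [] = 0 := rfl
@[simp] lemma dK_cons0 (Φ : Rp τ M) (t L) (a : VV M) :
    pp false (dK Φ (t :: L) a) = dK Φ L (pp false a) := rfl
@[simp] lemma dK_cons1 (Φ : Rp τ M) (t L) (a : VV M) :
    pp true (dK Φ (t :: L) a) = mapV (Φ (X t)) (pp false a) - dK Φ L (pp true a) := rfl
@[simp] lemma dK_nil' (Φ : Rp τ M) (t L) (a : VV M) : dK Φ (t :: L) a [] = 0 := rfl
def grV (M : Type) [AddCommGroup M] [Module ℂ M] : List τ → ℤ → Submodule ℂ (VV M)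
  | [], j => { carrier := {a | (∀ w, w ≠ [] → a w = 0) ∧ (j ≠ 0 → a [] = 0)}
               add_mem' := by
                rintro a b ⟨h1, h2⟩ ⟨h3, h4⟩
                exact ⟨fun w hw => by simp [h1 w hw, h3 w hw], fun hj => by simp [h2 hj, h4 hj]⟩
               zero_mem' := by simp
               smul_mem' := by
                rintro c a ⟨h1, h2⟩
                exact ⟨fun w hw => by simp [h1 w hw], fun hj => by simp [h2 hj]⟩ }
  | _ :: L, j => LinearMap.ker (LinearMap.proj (R := ℂ) (φ := fun _ : List Bool => M) []) ⊓
      ((grV M L j).comap (pp false) ⊓ (grV M L (j-1)).comap (pp true))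
lemma mem_grV_nil {j : ℤ} {a : VV M} : a ∈ grV (τ := τ) M [] j ↔
  (∀ w, w ≠ [] → a w = 0) ∧ (j ≠ 0 → a [] = 0) := Iff.rfl
lemma grV_mapV (f : M →ₗ[ℂ] N) (L : List τ) : ∀ (j : ℤ) (a : VV M), a ∈ grV M L j →
    mapV f a ∈ grV N L j := by
  induction L with
  | nil =>
    rintro j a ⟨h1, h2⟩
    exact ⟨fun w hw => by simp [h1 w hw], fun hj => by simp [h2 hj]⟩
  | cons t L ih =>
    rintro j a ⟨h1, h2, h3⟩
    have h1 : a [] = 0 := h1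
    exact ⟨by simp [h1], ih _ _ h2, ih _ _ h3⟩
def Cm (Φ : Rp τ M) (Ψ : Rp τ N) (L : List τ) (f : M →ₗ[ℂ] N) : Prop :=
  ∀ t ∈ L, ∀ a, f (Φ (X t) a) = Ψ (X t) (f a)
lemma Cm.cons_iff {Φ : Rp τ M} {Ψ : Rp τ N} {t L} {f : M →ₗ[ℂ] N} :
  Cm Φ Ψ (t :: L) f ↔ (∀ a, f (Φ (X t) a) = Ψ (X t) (f a)) ∧ Cm Φ Ψ L f := by simp [Cm]
lemma Cm.rho (Φ : Rp τ M) (L) (f : PP τ) : Cm Φ Φ L (Φ f) := fun _ _ _ => rp_comm _ _ _ _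
lemma mapV_sub (f : M →ₗ[ℂ] N) (a b) : mapV f (a - b) = mapV f a - mapV f b := map_sub _ _ _
lemma dK_mapV (Φ : Rp τ M) (Ψ : Rp τ N) (L : List τ) (f : M →ₗ[ℂ] N) (hf : Cm Φ Ψ L f) (a : VV M) :
    mapV f (dK Φ L a) = dK Ψ L (mapV f a) := by
  induction L generalizing a with
  | nil => simp
  | cons t L ih =>
    rw [Cm.cons_iff] at hf
    apply VV_ext
    · simp
    · simp [ih hf.2]
    · simp only [pp_mapV, dK_cons1, mapV_sub, ih hf.2]
      congr 1
      funext w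
      simp [hf.1]
lemma dK_gr (Φ : Rp τ M) (L : List τ) : ∀ (j : ℤ), ∀ a ∈ grV M L j, dK Φ L a ∈ grV M L (j+1) := by
  induction L with
  | nil => intro j a _; simp
  | cons t L ih =>
    rintro j a ⟨h1, h2, h3⟩
    refine ⟨rfl, ih _ _ h2, ?_⟩
    show mapV (Φ (X t)) (pp false a) - dK Φ L (pp true a) ∈ grV M L (j+1-1)
    rw [add_sub_cancel_right]
    refine sub_mem (grV_mapV _ _ _ _ h2) ?_
    have := ih _ _ h3
    rwa [sub_add_cancel] at this
lemma dK_dK (Φ : Rp τ M) (L : List τ) (a : VV M) : dK Φ L (dK Φ L a) = 0 := by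
  induction L generalizing a with
  | nil => simp
  | cons t L ih =>
    apply VV_ext
    · simp
    · simp [ih]
    · simp [ih, dK_mapV Φ Φ L _ (Cm.rho Φ L (X t))]
abbrev Kz (Φ : Rp τ M) (L : List τ) : Cx where
  V := VV M
  d := dK Φ L
  gr := grV M L
  d_gr := dK_gr Φ L
  d_d := fun _ _ _ => dK_dK Φ L _
abbrev KH (Φ : Rp τ M) (L : List τ) (j : ℤ) : Type := (Kz Φ L).H j
def kmk (Φ : Rp τ M) (L : List τ) (j : ℤ) (a : VV M) (h1 : a ∈ grV M L j) (h2 : dK Φ L a = 0) :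
    KH Φ L j := (Kz Φ L).mk' j ⟨a, h1, h2⟩
lemma k_ind {Φ : Rp τ M} {L : List τ} {j : ℤ} (x : KH Φ L j) : ∃ a h1 h2, x = kmk Φ L j a h1 h2 := by
  obtain ⟨⟨a, h1, h2⟩, rfl⟩ := Cx.mk_surj j x
  exact ⟨a, h1, h2, rfl⟩
lemma kmk_zero_iff {Φ : Rp τ M} {L : List τ} {i j : ℤ} (h : i + 1 = j) (a h1 h2) :
    kmk Φ L j a h1 h2 = 0 ↔ ∃ b ∈ grV M L i, dK Φ L b = a := by
  have : i = j - 1 := by omega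
  subst this
  exact Cx.mk_eq_zero _
lemma kmk_sub {Φ : Rp τ M} {L : List τ} {j : ℤ} (a h1 h2 b h3 h4) :
    kmk Φ L j a h1 h2 - kmk Φ L j b h3 h4 = kmk Φ L j (a - b) (sub_mem h1 h3)
      (by rw [map_sub, h2, h4, sub_zero]) := rfl
lemma kmk_add {Φ : Rp τ M} {L : List τ} {j : ℤ} (a h1 h2 b h3 h4) :
    kmk Φ L j a h1 h2 + kmk Φ L j b h3 h4 = kmk Φ L j (a + b) (add_mem h1 h3)
      (by rw [map_add, h2, h4, add_zero]) := rfl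
lemma kmk_smul {Φ : Rp τ M} {L : List τ} {j : ℤ} (c : ℂ) (a h1 h2) :
    c • kmk Φ L j a h1 h2 = kmk Φ L j (c • a) (Submodule.smul_mem _ c h1)
      (by rw [map_smul, h2, smul_zero]) := rfl
lemma kmk_congr {Φ : Rp τ M} {L : List τ} {j : ℤ} {a b : VV M} (h : a = b) (h1 h2) (h3 h4) :
    kmk Φ L j a h1 h2 = kmk Φ L j b h3 h4 := by subst h; rfl
lemma isCh_mapV (Φ : Rp τ M) (Ψ : Rp τ N) {L : List τ} {f : M →ₗ[ℂ] N} (hf : Cm Φ Ψ L f) :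
    IsCh (Kz Φ L) (Kz Ψ L) (mapV f) :=
  ⟨grV_mapV f L, fun _ _ _ => dK_mapV Φ Ψ L f hf _⟩
def Hf (Φ : Rp τ M) (Ψ : Rp τ N) {L : List τ} {f : M →ₗ[ℂ] N} (hf : Cm Φ Ψ L f) (j : ℤ) :
    KH Φ L j →ₗ[ℂ] KH Ψ L j := (isCh_mapV Φ Ψ hf).H j
lemma Hf_mk (Φ : Rp τ M) (Ψ : Rp τ N) {L : List τ} {f : M →ₗ[ℂ] N} (hf : Cm Φ Ψ L f) (j : ℤ)
    (a h1 h2) : Hf Φ Ψ hf j (kmk Φ L j a h1 h2) = kmk Ψ L j (mapV f a) (grV_mapV f L _ _ h1)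
      (by rw [← dK_mapV Φ Ψ L f hf, h2, map_zero]) := rfl
lemma Hf_comp (Φ : Rp τ M) (Ψ : Rp τ N) (Χ : Rp τ Q) {L : List τ} {f : M →ₗ[ℂ] N} {g : N →ₗ[ℂ] Q}
    {h : M →ₗ[ℂ] Q} (hf : Cm Φ Ψ L f) (hg : Cm Ψ Χ L g) (hh : Cm Φ Χ L h) (e : ∀ a, h a = g (f a))
    (j : ℤ) (x) : Hf Φ Χ hh j x = Hf Ψ Χ hg j (Hf Φ Ψ hf j x) := by
  obtain ⟨a, h1, h2, rfl⟩ := k_ind x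
  rw [Hf_mk, Hf_mk, Hf_mk]
  apply kmk_congr
  funext w
  exact e _
lemma Hf_lin (Φ : Rp τ M) (Ψ : Rp τ N) {L : List τ} {f g h : M →ₗ[ℂ] N} (hf : Cm Φ Ψ L f)
    (hg : Cm Φ Ψ L g) (hh : Cm Φ Ψ L h) (e : ∀ a, h a = f a + g a)
    (j : ℤ) (x) : Hf Φ Ψ hh j x = Hf Φ Ψ hf j x + Hf Φ Ψ hg j x := by
  obtain ⟨a, h1, h2, rfl⟩ := k_ind x
  rw [Hf_mk, Hf_mk, Hf_mk, kmk_add]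
  apply kmk_congr
  funext w
  exact e _
lemma Hf_smul (Φ : Rp τ M) (Ψ : Rp τ N) {L : List τ} {f h : M →ₗ[ℂ] N} (hf : Cm Φ Ψ L f) (c : ℂ)
    (hh : Cm Φ Ψ L h) (e : ∀ a, h a = c • f a)
    (j : ℤ) (x) : Hf Φ Ψ hh j x = c • Hf Φ Ψ hf j x := by
  obtain ⟨a, h1, h2, rfl⟩ := k_ind x
  rw [Hf_mk, Hf_mk, kmk_smul]
  apply kmk_congr
  funext w
  exact e _
lemma Hf_id (Φ : Rp τ M) {L : List τ} {h : M →ₗ[ℂ] M} (hh : Cm Φ Φ L h) (e : ∀ a, h a = a)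
    (j : ℤ) (x) : Hf Φ Φ hh j x = x := by
  obtain ⟨a, h1, h2, rfl⟩ := k_ind x
  rw [Hf_mk]
  apply kmk_congr
  funext w
  exact e _
def sesK (Φ : Rp τ M) (Ψ : Rp τ N) (Χ : Rp τ Q) {L : List τ} {f : M →ₗ[ℂ] N} {g : N →ₗ[ℂ] Q}
    (hf : Cm Φ Ψ L f) (hg : Cm Ψ Χ L g) (s : Q →ₗ[ℂ] N) (r : N →ₗ[ℂ] M)
    (h1 : ∀ a, r (f a) = a) (h2 : ∀ a, g (s a) = a) (h3 : ∀ a, g (f a) = 0)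
    (h4 : ∀ a, f (r a) + s (g a) = a) : SES (Kz Φ L) (Kz Ψ L) (Kz Χ L) where
  i := mapV f
  p := mapV g
  s := mapV s
  r := mapV r
  hi := isCh_mapV _ _ hf
  hp := isCh_mapV _ _ hg
  hs := grV_mapV s L
  hr := grV_mapV r L
  ri := fun _ _ _ => funext fun _ => h1 _
  ps := fun _ _ _ => funext fun _ => h2 _
  pi := fun _ _ _ => funext fun _ => h3 _
  ir := fun _ _ _ => funext fun _ => h4 _
lemma coefLES (Φ : Rp τ M) (Ψ : Rp τ N) (Χ : Rp τ Q) {L : List τ} {f : M →ₗ[ℂ] N} {g : N →ₗ[ℂ] Q}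
    (hf : Cm Φ Ψ L f) (hg : Cm Ψ Χ L g) (fi : Function.Injective f) (gs : Function.Surjective g)
    (ex : Function.Exact f g) : ∃ δ : ∀ j, KH Χ L j →ₗ[ℂ] KH Φ L (j+1),
      (∀ j, Function.Exact (Hf Φ Ψ hf j) (Hf Ψ Χ hg j)) ∧
      (∀ j, Function.Exact (Hf Ψ Χ hg j) (δ j)) ∧
      (∀ j, Function.Exact (δ j) (Hf Φ Ψ hf (j+1))) := by
  obtain ⟨r, hr⟩ := f.exists_leftInverse_of_injective (LinearMap.ker_eq_bot.2 fi)
  obtain ⟨s0, hs0⟩ := g.exists_rightInverse_of_surjective (LinearMap.range_eq_top.2 gs)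
  have hr' : ∀ a, r (f a) = a := fun a => LinearMap.congr_fun hr a
  have hs' : ∀ a, g (s0 a) = a := fun a => LinearMap.congr_fun hs0 a
  have h3 : ∀ a, g (f a) = 0 := fun a => (ex _).2 ⟨a, rfl⟩
  let S := sesK Φ Ψ Χ hf hg (s0 - f ∘ₗ r ∘ₗ s0) r hr' (fun a => by simp [hs', h3]) h3 (by
    intro a
    have : g (a - f (r a) - (s0 (g a) - f (r (s0 (g a))))) = 0 := by simp [hs', h3]
    obtain ⟨c, hc⟩ := (ex _).1 this
    have h5 := congrArg r hc
    simp only [map_sub, hr'] at h5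
    simp only [sub_self] at h5
    rw [h5, map_zero] at hc
    simp only [sbA, cmA]
    rw [← sub_eq_zero, ← neg_eq_zero, hc]
    abel)
  exact ⟨fun j => S.Hδ j, S.exact_ip, S.exact_pδ, S.exact_δi⟩
lemma pair_gr {t : τ} {L : List τ} {i j : ℤ} (h : i + 1 = j) {a c : VV M} (ha : a ∈ grV M L j)
    (hc : c ∈ grV M L i) : pairL (a, c) ∈ grV M (t :: L) j := by
  have : i = j - 1 := by omega
  subst this
  exact ⟨rfl, ha, hc⟩
lemma gr_pp1 {t : τ} {L : List τ} {i j : ℤ} (h : i + 1 = j) {a : VV M} (ha : a ∈ grV M (t :: L) j) :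
    pp true a ∈ grV M L i := by
  have : i = j - 1 := by omega
  subst this
  exact ha.2.2
def cι (Φ : Rp τ M) (t : τ) (L : List τ) {i j : ℤ} (h : i + 1 = j) : KH Φ L i →ₗ[ℂ] KH Φ (t :: L) j :=
  Hm (C1 := Kz Φ L) (C2 := Kz Φ (t :: L)) (pairL ∘ₗ LinearMap.inr ℂ (VV M) (VV M)) (by
    rintro a ⟨h1, h2⟩
    have h2 : dK Φ L a = 0 := h2
    refine ⟨pair_gr (t := t) h (zero_mem (grV M L j)) h1, ?_⟩
    show dK Φ (t :: L) (pairL (0, a)) = 0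
    apply VV_ext <;> simp [h2]) (by
    have : i = j - 1 := by omega
    subst this
    rintro _ ⟨b, hb, rfl⟩
    refine ⟨pairL (0, -b), pair_gr (t := t) (sub_add_cancel _ 1) (zero_mem (grV M L _)) (neg_mem hb), ?_⟩
    show dK Φ (t :: L) (pairL (0, -b)) = pairL (0, dK Φ L b)
    apply VV_ext <;> simp)
lemma cι_mk (Φ : Rp τ M) (t : τ) (L : List τ) {i j : ℤ} (h : i + 1 = j) (a h1 h2) :
    cι Φ t L h (kmk Φ L i a h1 h2) = kmk Φ (t :: L) j (pairL (0, a)) (pair_gr h (zero_mem _) h1)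
     (by apply VV_ext <;> simp [h2]) := rfl
lemma isCh_pp (Φ : Rp τ M) (t : τ) (L : List τ) : IsCh (Kz Φ (t :: L)) (Kz Φ L) (pp false) :=
  ⟨fun _ _ h => h.2.1, fun _ _ _ => rfl⟩
def cπ (Φ : Rp τ M) (t : τ) (L : List τ) (j : ℤ) : KH Φ (t :: L) j →ₗ[ℂ] KH Φ L j :=
  (isCh_pp Φ t L).H j
lemma cπ_mk (Φ : Rp τ M) (t : τ) (L : List τ) (j : ℤ) (a h1 h2) :
    cπ Φ t L j (kmk Φ (t :: L) j a h1 h2) = kmk Φ L j (pp false a) h1.2.1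
     (by rw [← dK_cons0 Φ t, h2, map_zero]) := rfl
lemma dK_c1 {Φ : Rp τ M} {t : τ} {L : List τ} {a : VV M} (h : dK Φ (t :: L) a = 0) :
    dK Φ L (pp true a) = mapV (Φ (X t)) (pp false a) := by
  have := congrArg (pp true) h
  rw [dK_cons1, map_zero, sub_eq_zero] at this
  exact this.symm
lemma cone_exact1 (Φ : Rp τ M) (t : τ) (L : List τ) {i j : ℤ} (h : i + 1 = j) :
    Function.Exact (cι Φ t L h) (cπ Φ t L j) := by
  intro x
  obtain ⟨a, h1, h2, rfl⟩ := k_ind x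
  constructor
  · intro h'
    rw [cπ_mk, kmk_zero_iff h] at h'
    obtain ⟨b, hb, hb2⟩ := h'
    refine ⟨kmk Φ L _ (pp true a - mapV (Φ (X t)) b) (sub_mem (gr_pp1 h h1) (grV_mapV _ _ _ _ hb))
      ?_, ?_⟩
    · rw [map_sub, dK_c1 h2, ← dK_mapV Φ Φ L _ (Cm.rho Φ L (X t)), hb2, sub_self]
    · rw [cι_mk, ← sub_eq_zero, kmk_sub, kmk_zero_iff h]
      refine ⟨pairL (-b, 0), pair_gr (sub_add_cancel i 1) (neg_mem hb) (zero_mem _), ?_⟩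
      have h0 : a [] = 0 := h1.1
      apply VV_ext
      · simp [h0]
      · simp [hb2]
      · simp
  · rintro ⟨y, hy⟩
    obtain ⟨b, hb, hb2, rfl⟩ := k_ind y
    rw [← hy, cι_mk, cπ_mk, kmk_zero_iff h]
    exact ⟨0, zero_mem _, by simp⟩
lemma cone_exact2 (Φ : Rp τ M) (t : τ) (L : List τ) (j : ℤ) :
    Function.Exact (cπ Φ t L j) (Hf Φ Φ (Cm.rho Φ L (X t)) j) := by
  intro x
  obtain ⟨a, h1, h2, rfl⟩ := k_ind x
  constructor
  · intro h'
    rw [Hf_mk, kmk_zero_iff (sub_add_cancel j 1)] at h'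
    obtain ⟨b, hb, hb2⟩ := h'
    exact ⟨kmk Φ (t :: L) _ (pairL (a, b)) (pair_gr (sub_add_cancel j 1) h1 hb)
      (by apply VV_ext <;> simp [hb2, h2]), rfl⟩
  · rintro ⟨y, hy⟩
    obtain ⟨b, hb, hb2, rfl⟩ := k_ind y
    rw [← hy, cπ_mk, Hf_mk, kmk_zero_iff (sub_add_cancel j 1)]
    exact ⟨pp true b, gr_pp1 (sub_add_cancel j 1) hb, dK_c1 hb2⟩
lemma cone_exact3 (Φ : Rp τ M) (t : τ) (L : List τ) {i j : ℤ} (h : i + 1 = j) :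
    Function.Exact (Hf Φ Φ (Cm.rho Φ L (X t)) i) (cι Φ t L h) := by
  intro x
  obtain ⟨a, h1, h2, rfl⟩ := k_ind x
  constructor
  · intro h'
    rw [cι_mk, kmk_zero_iff h] at h'
    obtain ⟨b, hb, hb2⟩ := h'
    have e0 := congrArg (pp false) hb2
    have e1 := congrArg (pp true) hb2
    rw [dK_cons0, pp_pairL0] at e0
    rw [dK_cons1, pp_pairL1] at e1
    refine ⟨kmk Φ L _ (pp false b) hb.2.1 e0, ?_⟩
    rw [Hf_mk, ← sub_eq_zero, kmk_sub, kmk_zero_iff (sub_add_cancel i 1)]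
    refine ⟨pp true b, hb.2.2, ?_⟩
    simp only at e1
    rw [← e1]; abel
  · rintro ⟨y, hy⟩
    obtain ⟨b, hb, hb2, rfl⟩ := k_ind y
    rw [← hy, Hf_mk, cι_mk, kmk_zero_iff h]
    refine ⟨pairL (b, 0), pair_gr (sub_add_cancel i 1) hb (zero_mem _), ?_⟩
    apply VV_ext <;> simp [hb2]
lemma cι_nat (Φ : Rp τ M) (Ψ : Rp τ N) {t : τ} {L : List τ} {f : M →ₗ[ℂ] N}
    (hf : Cm Φ Ψ (t :: L) f) {i j : ℤ} (h : i + 1 = j) (x) :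
    Hf Φ Ψ hf j (cι Φ t L h x) = cι Ψ t L h (Hf Φ Ψ (Cm.cons_iff.1 hf).2 i x) := by
  obtain ⟨a, h1, h2, rfl⟩ := k_ind x
  rw [cι_mk, Hf_mk, Hf_mk, cι_mk]
  apply kmk_congr
  apply VV_ext <;> simp
lemma cπ_nat (Φ : Rp τ M) (Ψ : Rp τ N) {t : τ} {L : List τ} {f : M →ₗ[ℂ] N}
    (hf : Cm Φ Ψ (t :: L) f) (j : ℤ) (x) :
    cπ Ψ t L j (Hf Φ Ψ hf j x) = Hf Φ Ψ (Cm.cons_iff.1 hf).2 j (cπ Φ t L j x) := by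
  obtain ⟨a, h1, h2, rfl⟩ := k_ind x
  rfl
end kz
end SkewLC
end

section
namespace SkewLC
open MvPolynomial
def LNil {H : Type*} [AddCommGroup H] [Module ℂ H] (E : Module.End ℂ H) : Prop := ∀ u, ∃ k : ℕ, (E ^ k) u = 0
section weyl0
variable {H : Type*} [AddCommGroup H] [Module ℂ H]
lemma weyl_pow (D E : Module.End ℂ H) (h : ∀ u, D (E u) = E (D u) + u) (k : ℕ) (u : H) :
    D ((E ^ (k+1)) u) = (E ^ (k+1)) (D u) + ((k:ℂ)+1) • (E ^ k) u := by
  induction k generalizing u with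
  | zero => simp [h]
  | succ k ih =>
    have e : ∀ (i : ℕ) w, (E ^ (i+1)) w = (E ^ i) (E w) := fun i w => by
      rw [pow_succ, mAp]
    rw [e (k+1), ih, h, map_add, ← e (k+1), ← e k]
    push_cast
    module
lemma weyl_pow' (D E : Module.End ℂ H) (h : ∀ u, D (E u) = E (D u) + u) (k : ℕ) (u : H) :
    (D ^ (k+1)) (E u) = E ((D ^ (k+1)) u) + ((k:ℂ)+1) • (D ^ k) u := by
  have := weyl_pow (-E) D (fun u => by simp [h]) k u
  simp only [ngA, map_neg] at this
  have h2 : (D ^ (k+1)) (E u) = E ((D ^ (k+1)) u) + (- E ((D ^ (k+1)) u) - - (D ^ (k+1)) (E u)) := by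
    abel
  rw [h2, this]; abel_nf
lemma surj_of_weyl (D E : Module.End ℂ H) (h : ∀ u, D (E u) = E (D u) + u) (hE : LNil E) :
    Function.Surjective E := by
  have key : ∀ (k : ℕ) (u : H), (E ^ k) u = 0 → ∃ w, E w = u := by
    intro k
    induction k with
    | zero => intro u hu; exact ⟨0, by simpa using hu.symm⟩
    | succ k ih =>
      intro u hu
      have h1 := weyl_pow D E h k u
      rw [hu, map_zero] at h1
      have h2 : (E ^ k) (E (D u) + ((k:ℂ)+1) • u) = 0 := by
        rw [map_add, map_smul, ← mAp, ← pow_succ, ← h1]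
      obtain ⟨w, hw⟩ := ih _ h2
      have hk : ((k:ℂ)+1) ≠ 0 := by exact_mod_cast Nat.succ_ne_zero k
      refine ⟨((k:ℂ)+1)⁻¹ • (w - D u), ?_⟩
      rw [map_smul, map_sub, hw, add_sub_cancel_left, smul_smul, inv_mul_cancel₀ hk, one_smul]
  intro u
  obtain ⟨k, hk⟩ := hE u
  exact key k u hk
lemma inj_of_weyl (D E : Module.End ℂ H) (h : ∀ u, D (E u) = E (D u) + u) (hD : LNil D) :
    Function.Injective E := by
  rw [inj0]
  intro u hu
  have key : ∀ (k : ℕ), (D ^ k) u = 0 → u = 0 := by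
    intro k
    induction k with
    | zero => intro h; simpa using h
    | succ k ih =>
      intro h1
      apply ih
      have h2 := weyl_pow' D E h k u
      rw [hu, map_zero, h1, map_zero, zero_add] at h2
      have hk : ((k:ℂ)+1) ≠ 0 := by exact_mod_cast Nat.succ_ne_zero k
      exact (smul_eq_zero.1 h2.symm).resolve_left hk
  obtain ⟨k, hk⟩ := hD u
  exact key k hk
end weyl0
section kz3
variable {τ : Type} {M N Q : Type} [AddCommGroup M] [Module ℂ M] [AddCommGroup N] [Module ℂ N]
  [AddCommGroup Q] [Module ℂ Q]
lemma cone_quot (Φ : Rp τ M) (Ψ : Rp τ Q) (t : τ) (L : List τ) (q : M →ₗ[ℂ] Q) (hq : Cm Φ Ψ L q)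
    (hi : Function.Injective (Φ (X t))) (hs : Function.Surjective q)
    (ex : Function.Exact (Φ (X t)) q) {i j : ℤ} (h : i + 1 = j) :
    Nonempty (KH Φ (t :: L) j ≃ₗ[ℂ] KH Ψ L i) := by
  obtain ⟨r, hr⟩ := (Φ (X t)).exists_leftInverse_of_injective (LinearMap.ker_eq_bot.2 hi)
  obtain ⟨s, hs0⟩ := q.exists_rightInverse_of_surjective (LinearMap.range_eq_top.2 hs)
  have hs' : ∀ a, q (s a) = a := fun a => LinearMap.congr_fun hs0 a
  have hr' : ∀ a, q a = 0 → Φ (X t) (r a) = a := by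
    intro a ha
    obtain ⟨b, rfl⟩ := (ex a).1 ha
    exact congrArg _ (LinearMap.congr_fun hr b)
  have qρ : ∀ a, q (Φ (X t) a) = 0 := fun a => (ex _).2 ⟨a, rfl⟩
  have dd := fun a => dK_mapV Φ Ψ L q hq a
  have dρ := fun a => dK_mapV Φ Φ L _ (Cm.rho Φ L (X t)) a
  have ρV : ∀ a b : VV M, mapV (Φ (X t)) a = mapV (Φ (X t)) b → a = b :=
    fun a b e => funext fun w => hi (congrFun e w)
  have rV : ∀ a : VV M, mapV q a = 0 → mapV (Φ (X t)) (mapV r a) = a :=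
    fun a e => funext fun w => hr' _ (congrFun e w)
  have sV : ∀ a : VV Q, mapV q (mapV s a) = a := fun a => funext fun w => hs' _
  have qρV : ∀ a : VV M, mapV q (mapV (Φ (X t)) a) = 0 := fun a => funext fun w => qρ _
  have hj : i = j - 1 := by omega
  subst hj
  let F := Hm (C1 := Kz Φ (t :: L)) (C2 := Kz Ψ L) (j := j) (i := j - 1) (mapV q ∘ₗ pp true) (by
      rintro a ⟨h1, h2⟩
      refine ⟨grV_mapV _ _ _ _ h1.2.2, ?_⟩
      show dK Ψ L (mapV q (pp true a)) = 0
      rw [← dd, dK_c1 h2, qρV]) (by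
      rintro _ ⟨b, hb, rfl⟩
      refine ⟨- mapV q (pp true b), neg_mem (grV_mapV _ _ _ _ hb.2.2), ?_⟩
      show dK Ψ L (- mapV q (pp true b)) = mapV q (pp true (dK Φ (t :: L) b))
      rw [dK_cons1, mapV_sub, qρV, dd, map_neg, zero_sub])
  refine ⟨LinearEquiv.ofBijective F ⟨Hm_inj _ _ _ ?_, Hm_surj _ _ _ ?_⟩⟩
  · rintro a ⟨h1, h2⟩ ⟨e, he, he2⟩
    have he2 : dK Ψ L e = mapV q (pp true a) := he2
    have h0 : a [] = 0 := h1.1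
    have k1 : mapV q (pp true a - dK Φ L (mapV s e)) = 0 := by
      rw [mapV_sub, dd, sV, he2, sub_self]
    have k2 := rV _ k1
    set c := mapV r (pp true a - dK Φ L (mapV s e)) with hc
    have hse := grV_mapV s L _ _ he
    have hcg : c ∈ grV M L (j-1) := by
      apply grV_mapV
      refine sub_mem h1.2.2 ?_
      have := dK_gr Φ L _ _ hse
      rwa [sub_add_cancel] at this
    refine ⟨pairL (c, - mapV s e), pair_gr (t := t) (sub_add_cancel _ _) hcg (neg_mem hse), ?_⟩
    show dK Φ (t :: L) (pairL (c, - mapV s e)) = a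
    apply VV_ext
    · simp [h0]
    · rw [dK_cons0, pp_pairL0]
      apply ρV
      rw [dρ, k2, map_sub, dK_dK, sub_zero, dK_c1 h2]
    · rw [dK_cons1, pp_pairL0, pp_pairL1]
      simp only [k2, map_neg]; abel
  · rintro b ⟨h1, h2⟩
    have h2 : dK Ψ L b = 0 := h2
    have hsg := grV_mapV s L _ _ h1
    have k1 : mapV q (dK Φ L (mapV s b)) = 0 := by rw [dd, sV, h2]
    have k2 := rV _ k1
    have hcg : mapV r (dK Φ L (mapV s b)) ∈ grV M L j := by
      apply grV_mapV
      have := dK_gr Φ L _ _ hsg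
      rwa [sub_add_cancel] at this
    refine ⟨pairL (mapV r (dK Φ L (mapV s b)), mapV s b), ⟨pair_gr (t := t) (sub_add_cancel _ _) hcg hsg, ?_⟩, ?_⟩
    · show dK Φ (t :: L) (pairL (mapV r (dK Φ L (mapV s b)), mapV s b)) = 0
      apply VV_ext
      · simp
      · rw [dK_cons0, pp_pairL0, map_zero]
        apply ρV
        rw [dρ, k2, dK_dK, map_zero]
      · rw [dK_cons1, pp_pairL0, pp_pairL1]
        simp only [k2, sub_self, map_zero]
    · have : (mapV q ∘ₗ pp true) (pairL (mapV r (dK Φ L (mapV s b)), mapV s b)) - b = 0 := by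
        show mapV q (mapV s b) - b = 0
        rw [sV, sub_self]
      rw [this]
      exact zero_mem _
lemma hom_ex (Φ : Rp τ M) (t : τ) (L : List τ) (ht : t ∈ L) : ∃ h : VV M →ₗ[ℂ] VV M,
    (∀ j, ∀ a ∈ grV M L j, h a ∈ grV M L (j-1)) ∧
    (∀ j, ∀ a ∈ grV M L j, dK Φ L (h a) + h (dK Φ L a) = mapV (Φ (X t)) a) ∧
    (∀ (f : M →ₗ[ℂ] M) a, h (mapV f a) = mapV f (h a)) := by
  induction L with
  | nil => simp at ht
  | cons s L ih =>
    by_cases hts : t = s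
    · subst hts
      refine ⟨pairL ∘ₗ LinearMap.inl ℂ (VV M) (VV M) ∘ₗ pp true, ?_, ?_, ?_⟩
      · rintro j a h
        exact pair_gr (t := t) (sub_add_cancel _ _) h.2.2 (zero_mem (grV M L _))
      · rintro j a ⟨h0, h1, h2⟩
        have h0 : a [] = 0 := h0
        apply VV_ext <;> simp [h0]
      · intro f a
        apply VV_ext <;> simp
    · obtain ⟨h, hg, hd, hc⟩ := ih (by simpa [hts] using ht)
      refine ⟨pairL ∘ₗ LinearMap.prodMap h (-h) ∘ₗ LinearMap.prod (pp false) (pp true), ?_, ?_, ?_⟩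
      · rintro j a ⟨h0, h1, h2⟩
        exact pair_gr (t := s) (sub_add_cancel _ _) (hg _ _ h1) (neg_mem (hg _ _ h2))
      · rintro j a ⟨h0, h1, h2⟩
        have h0 : a [] = 0 := h0
        have e1 := hd _ _ h1
        have e2 := hd _ _ h2
        apply VV_ext
        · simp [h0]
        · simp [e1]
        · simp [hc, ← e2]
          abel
      · intro f a
        apply VV_ext <;> simp [hc]
lemma hom_zero (Φ : Rp τ M) (t : τ) (L : List τ) (ht : t ∈ L) (j : ℤ) (x) :
    Hf Φ Φ (Cm.rho Φ L (X t)) j x = 0 := by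
  obtain ⟨h, hg, hd, hc⟩ := hom_ex Φ t L ht
  obtain ⟨a, h1, h2, rfl⟩ := k_ind x
  rw [Hf_mk, kmk_zero_iff (sub_add_cancel j 1)]
  refine ⟨h a, hg _ _ h1, ?_⟩
  rw [← hd _ _ h1, h2, map_zero, add_zero]
lemma cone_surj (Φ : Rp τ M) (t : τ) (L : List τ)
    (hs : ∀ j, Function.Surjective (Hf Φ Φ (Cm.rho Φ L (X t)) j)) (j : ℤ) :
    Function.Injective (cπ Φ t L j) := by
  rw [inj0]
  intro x hx
  obtain ⟨y, rfl⟩ := (cone_exact1 Φ t L (sub_add_cancel j 1) x).1 hx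
  obtain ⟨z, rfl⟩ := hs _ y
  exact (cone_exact3 Φ t L (sub_add_cancel j 1) _).2 ⟨z, rfl⟩
lemma LNil_inj {H K : Type*} [AddCommGroup H] [Module ℂ H] [AddCommGroup K] [Module ℂ K]
    (F : H →ₗ[ℂ] K) (hF : Function.Injective F) (E : Module.End ℂ H) (E' : Module.End ℂ K)
    (h : ∀ x, F (E x) = E' (F x)) (hE : LNil E') : LNil E := by
  intro u
  obtain ⟨k, hk⟩ := hE (F u)
  refine ⟨k, hF ?_⟩
  have : ∀ k u, F ((E ^ k) u) = (E' ^ k) (F u) := by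
    intro k
    induction k with
    | zero => simp
    | succ k ih => intro u; rw [pow_succ, pow_succ, mAp, ih, h]; rfl
  rw [this, hk, map_zero]
lemma LNil_surj {H K : Type*} [AddCommGroup H] [Module ℂ H] [AddCommGroup K] [Module ℂ K]
    (F : H →ₗ[ℂ] K) (hF : Function.Surjective F) (E : Module.End ℂ H) (E' : Module.End ℂ K)
    (h : ∀ x, F (E x) = E' (F x)) (hE : LNil E) : LNil E' := by
  intro u
  obtain ⟨u, rfl⟩ := hF u
  obtain ⟨k, hk⟩ := hE u
  refine ⟨k, ?_⟩
  have : ∀ k u, F ((E ^ k) u) = (E' ^ k) (F u) := by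
    intro k
    induction k with
    | zero => simp
    | succ k ih => intro u; rw [pow_succ, pow_succ, mAp, ih, h]; rfl
  rw [← this, hk, map_zero]
lemma Hf_weyl (Φ : Rp τ M) {L : List τ} {D E : Module.End ℂ M} (hD : Cm Φ Φ L D) (hE : Cm Φ Φ L E)
    (h : ∀ u, D (E u) = E (D u) + u) (j : ℤ) (x) :
    Hf Φ Φ hD j (Hf Φ Φ hE j x) = Hf Φ Φ hE j (Hf Φ Φ hD j x) + x := by
  have c1 : Cm Φ Φ L (D ∘ₗ E) := fun t ht a => by simp [hE t ht, hD t ht]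
  have c2 : Cm Φ Φ L (E ∘ₗ D) := fun t ht a => by simp [hE t ht, hD t ht]
  have c3 : Cm Φ Φ L (LinearMap.id : M →ₗ[ℂ] M) := fun t ht a => rfl
  rw [← Hf_comp Φ Φ Φ hE hD c1 (fun _ => rfl), ← Hf_comp Φ Φ Φ hD hE c2 (fun _ => rfl),
    Hf_lin Φ Φ c2 c3 c1 h, Hf_id Φ c3 (fun _ => rfl)]
lemma lemP (Φ : Rp τ M) (L0 : List τ) (D : τ → Module.End ℂ M) (bs : List τ) (nd : bs.Nodup)
    (hD : ∀ t ∈ bs, ∀ s ∈ bs ++ L0, s ≠ t → ∀ u, D t (Φ (X s) u) = Φ (X s) (D t u))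
    (hW : ∀ t ∈ bs, ∀ u, D t (Φ (X t) u) = Φ (X t) (D t u) + u)
    (hdis : ∀ t ∈ bs, t ∉ L0)
    (nil : ∀ t ∈ bs, ∀ j, LNil (Hf Φ Φ (Cm.rho Φ L0 (X t)) j)) :
    ∀ j, ∃ F : KH Φ (bs ++ L0) j →ₗ[ℂ] KH Φ L0 j, Function.Injective F ∧
      (∀ y, (∃ x, F x = y) ↔ ∀ t ∈ bs, Hf Φ Φ (Cm.rho Φ L0 (X t)) j y = 0) ∧
      ∀ f x, F (Hf Φ Φ (Cm.rho Φ (bs ++ L0) f) j x) = Hf Φ Φ (Cm.rho Φ L0 f) j (F x) := by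
  induction bs with
  | nil => exact fun j => ⟨LinearMap.id, fun _ _ h => h, by simp, fun _ _ => rfl⟩
  | cons t bs ih =>
    rw [List.nodup_cons] at nd
    have ih := ih nd.2 (fun t' ht s hs => hD t' (by simp [ht]) s (by simp at hs ⊢; tauto))
      (fun t' ht => hW t' (by simp [ht])) (fun t' ht => hdis t' (by simp [ht]))
      (fun t' ht => nil t' (by simp [ht]))
    have hDL : Cm Φ Φ (bs ++ L0) (D t) := by
      intro s hs u
      refine hD t (by simp) s (by simp at hs ⊢; tauto) ?_ u
      rintro rfl
      rw [List.mem_append] at hs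
      exact hs.elim nd.1 (hdis s (by simp))
    have hs : ∀ j, Function.Surjective (Hf Φ Φ (Cm.rho Φ (bs ++ L0) (X t)) j) := by
      intro j
      obtain ⟨F, hF, -, hF2⟩ := ih j
      exact surj_of_weyl _ _ (Hf_weyl Φ hDL (Cm.rho Φ (bs ++ L0) (X t)) (hW t (by simp)) j)
        (LNil_inj F hF _ _ (hF2 _) (nil t (by simp) j))
    intro j
    obtain ⟨F, hF, hF1, hF2⟩ := ih j
    refine ⟨F ∘ₗ cπ Φ t (bs ++ L0) j, hF.comp (cone_surj Φ t _ hs j), ?_, ?_⟩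
    · intro y
      constructor
      · rintro ⟨x, rfl⟩ s hsm
        rw [List.mem_cons] at hsm
        rcases hsm with rfl | hsm
        · rw [cmA, ← hF2, (cone_exact2 Φ s (bs ++ L0) j _).2 ⟨x, rfl⟩, map_zero]
        · exact (hF1 _).1 ⟨_, rfl⟩ s hsm
      · intro hy
        obtain ⟨x, rfl⟩ := (hF1 y).2 (fun s hs => hy s (by simp [hs]))
        have h1 := hy t (by simp)
        rw [← hF2] at h1
        obtain ⟨z, rfl⟩ := (cone_exact2 Φ t (bs ++ L0) j x).1 (hF (by rw [h1, map_zero]))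
        exact ⟨z, rfl⟩
    · intro f x
      rw [cmA, cmA, ← hF2]
      congr 1
      exact cπ_nat Φ Φ (Cm.rho Φ (t :: (bs ++ L0)) f) j x
end kz3
end SkewLC
end

section
namespace SkewLC
open MvPolynomial
section ops
variable {τ : Type} {M N Q : Type} [AddCommGroup M] [Module ℂ M] [AddCommGroup N] [Module ℂ N]
  [AddCommGroup Q] [Module ℂ Q]
open Classical in
def qop (U : Submodule ℂ M) (f : Module.End ℂ M) : Module.End ℂ (M ⧸ U) :=
  if h : U ≤ U.comap f then U.mapQ U f h else 0
lemma qop_mk {U : Submodule ℂ M} {f : Module.End ℂ M} (h : ∀ u ∈ U, f u ∈ U) (u : M) :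
    qop U f (U.mkQ u) = U.mkQ (f u) := by
  have h : U ≤ U.comap f := h
  rw [qop, dif_pos h]; rfl
open Classical in
def rop (U : Submodule ℂ M) (f : Module.End ℂ M) : Module.End ℂ U :=
  if h : ∀ u ∈ U, f u ∈ U then f.restrict h else 0
lemma rop_coe {U : Submodule ℂ M} {f : Module.End ℂ M} (h : ∀ u ∈ U, f u ∈ U) (u : U) :
    (rop U f u : M) = f u := by
  rw [rop, dif_pos h]; rfl
lemma rp_stable (Φ : Rp τ M) (U : Submodule ℂ M) (h : ∀ s, ∀ u ∈ U, Φ (X s) u ∈ U) (f : PP τ) :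
    ∀ u ∈ U, Φ f u ∈ U := by
  induction f using MvPolynomial.induction_on with
  | C a =>
    intro u hu
    have : Φ (C a) u = a • u := by
      rw [← MvPolynomial.algebraMap_eq, AlgHom.commutes]; rfl
    rw [this]; exact U.smul_mem _ hu
  | add p q hp hq => intro u hu; rw [map_add]; exact add_mem (hp u hu) (hq u hu)
  | mul_X p s hp => intro u hu; rw [map_mul]; exact hp _ (h s u hu)
def rpQ (Φ : Rp τ M) (U : Submodule ℂ M) (h : ∀ s, ∀ u ∈ U, Φ (X s) u ∈ U) : Rp τ (M ⧸ U) :=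
  AlgHom.ofLinearMap
   { toFun := fun f => U.mapQ U (Φ f) (rp_stable Φ U h f)
     map_add' := fun f g => by
       apply LinearMap.ext; intro u; obtain ⟨u, rfl⟩ := U.mkQ_surjective u; simp
     map_smul' := fun c g => by
       apply LinearMap.ext; intro u; obtain ⟨u, rfl⟩ := U.mkQ_surjective u; simp }
   (by apply LinearMap.ext; intro u; obtain ⟨u, rfl⟩ := U.mkQ_surjective u; simp)
   (fun f g => by apply LinearMap.ext; intro u; obtain ⟨u, rfl⟩ := U.mkQ_surjective u; simp)
@[simp] lemma rpQ_mk (Φ : Rp τ M) (U : Submodule ℂ M) (h) (f u) :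
    rpQ Φ U h f (U.mkQ u) = U.mkQ (Φ f u) := rfl
def rpS (Φ : Rp τ M) (U : Submodule ℂ M) (h : ∀ s, ∀ u ∈ U, Φ (X s) u ∈ U) : Rp τ U :=
  AlgHom.ofLinearMap
   { toFun := fun f => (Φ f).restrict (rp_stable Φ U h f)
     map_add' := fun f g => by
       apply LinearMap.ext; intro u; apply Subtype.ext; simp
     map_smul' := fun c g => by
       apply LinearMap.ext; intro u; apply Subtype.ext; simp }
   (by apply LinearMap.ext; intro u; apply Subtype.ext; simp)
   (fun f g => by apply LinearMap.ext; intro u; apply Subtype.ext; simp)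
@[simp] lemma rpS_coe (Φ : Rp τ M) (U : Submodule ℂ M) (h) (f u) :
    (rpS Φ U h f u : M) = Φ f u := rfl
lemma KH_congr (Φ Ψ : Rp τ M) (L : List τ) (h : ∀ t ∈ L, ∀ u, Φ (X t) u = Ψ (X t) u) (j : ℤ) :
    ∃ e : KH Φ L j ≃ₗ[ℂ] KH Ψ L j, ∀ (f : M →ₗ[ℂ] M) (h1 : Cm Φ Φ L f) (h2 : Cm Ψ Ψ L f) x,
      e (Hf Φ Φ h1 j x) = Hf Ψ Ψ h2 j (e x) := by
  have c1 : Cm Φ Ψ L (LinearMap.id : M →ₗ[ℂ] M) := fun t ht a => h t ht a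
  have c2 : Cm Ψ Φ L (LinearMap.id : M →ₗ[ℂ] M) := fun t ht a => (h t ht a).symm
  have c3 : Cm Φ Φ L (LinearMap.id : M →ₗ[ℂ] M) := fun t ht a => rfl
  have c4 : Cm Ψ Ψ L (LinearMap.id : M →ₗ[ℂ] M) := fun t ht a => rfl
  refine ⟨LinearEquiv.ofLinearMap (Hf Φ Ψ c1 j) (Hf Ψ Φ c2 j) ?_ ?_, ?_⟩
  · apply LinearMap.ext; intro x
    rw [cmA, ← Hf_comp Ψ Φ Ψ c2 c1 c4 (fun _ => rfl), Hf_id Ψ c4 (fun _ => rfl)]; rfl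
  · apply LinearMap.ext; intro x
    rw [cmA, ← Hf_comp Φ Ψ Φ c1 c2 c3 (fun _ => rfl), Hf_id Φ c3 (fun _ => rfl)]; rfl
  · intro f h1 h2 x
    have c5 : Cm Φ Ψ L f := fun t ht a => by rw [h1 t ht, h t ht]
    show Hf Φ Ψ c1 j _ = Hf Ψ Ψ h2 j (Hf Φ Ψ c1 j x)
    rw [← Hf_comp Φ Φ Ψ h1 c1 c5 (fun _ => rfl), ← Hf_comp Φ Ψ Ψ c1 h2 c5 (fun _ => rfl)]
lemma gr_dir {ι : Type*} (A : ι → Module.End ℂ M)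
    (hd : ∀ i1 i2, ∃ i3, ∀ u, (A i1 u = 0 ∨ A i2 u = 0) → A i3 u = 0)
    (ha : ∀ u, ∃ i, A i u = 0) (L : List τ) :
    ∀ (j : ℤ) (a : VV M), a ∈ grV M L j → ∃ i, mapV (A i) a = 0 := by
  induction L with
  | nil =>
    rintro j a ⟨h1, h2⟩
    obtain ⟨i, hi⟩ := ha (a [])
    refine ⟨i, funext fun w => ?_⟩
    by_cases hw : w = []
    · subst hw; exact hi
    · simp [h1 w hw]
  | cons t L ih =>
    rintro j a ⟨h1, h2, h3⟩
    have h1 : a [] = 0 := h1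
    obtain ⟨i1, e1⟩ := ih _ _ h2
    obtain ⟨i2, e2⟩ := ih _ _ h3
    obtain ⟨i3, e3⟩ := hd i1 i2
    refine ⟨i3, VV_ext ?_ ?_ ?_⟩
    · simp [h1]
    · funext w; exact e3 _ (Or.inl (congrFun e1 w))
    · funext w; exact e3 _ (Or.inr (congrFun e2 w))
lemma Cm.pow {Φ : Rp τ M} {L : List τ} {f : Module.End ℂ M} (h : Cm Φ Φ L f) (k : ℕ) :
    Cm Φ Φ L (f ^ k) := by
  induction k with
  | zero => intro t _ a; simp
  | succ k ih => intro t ht a; rw [pow_succ, mAp, h t ht, ih t ht]; rfl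
lemma Hf_pow {Φ : Rp τ M} {L : List τ} {f : Module.End ℂ M} (h : Cm Φ Φ L f) (k : ℕ) (j : ℤ) (x) :
    ((Hf Φ Φ h j : Module.End ℂ (KH Φ L j)) ^ k) x = Hf Φ Φ (h.pow k) j x := by
  induction k generalizing x with
  | zero => rw [Hf_id Φ _ (fun a => by simp)]; simp
  | succ k ih =>
    rw [pow_succ, mAp, ih, ← Hf_comp Φ Φ Φ h (h.pow k) (h.pow (k+1))]
    intro a; rw [pow_succ]; rfl
lemma LNil_H {Φ : Rp τ M} {L : List τ} {f : Module.End ℂ M} (h : Cm Φ Φ L f) (hn : LNil f) (j : ℤ) :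
    LNil (Hf Φ Φ h j) := by
  intro x
  obtain ⟨a, h1, h2, rfl⟩ := k_ind x
  obtain ⟨k, hk⟩ := gr_dir (fun k : ℕ => f ^ k) (fun i1 i2 => ⟨i1 + i2, fun u hu => by
    rcases hu with hu | hu
    · rw [add_comm, pow_add, mAp, hu, map_zero]
    · rw [pow_add, mAp, hu, map_zero]⟩) hn L j a h1
  refine ⟨k, ?_⟩
  rw [Hf_pow, Hf_mk, kmk_zero_iff (sub_add_cancel j 1)]
  exact ⟨0, zero_mem _, by rw [map_zero, hk]⟩
end ops
section bd
variable {H : Type*} [AddCommGroup H] [Module ℂ H]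
lemma bd_inj (D b : Module.End ℂ H) (h : ∀ u, D (b u) = b (D u) + u) (k : ℕ) :
    ∀ (c : ℕ) (u : H), (D ^ k) u = 0 → b (D u) + ((c:ℂ)+1) • u = 0 → u = 0 := by
  induction k with
  | zero => intro c u h _; simpa using h
  | succ k ih =>
    intro c u hu h2
    have h3 : D u = 0 := by
      apply ih (c+1) (D u) (by rwa [pow_succ] at hu)
      have := congrArg D h2
      rw [map_add, h, map_smul, map_zero] at this
      rw [← this]; push_cast; module
    rw [h3, map_zero, zero_add] at h2
    exact (smul_eq_zero.1 h2).resolve_left (by exact_mod_cast Nat.succ_ne_zero c)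
lemma bd_surj (D b : Module.End ℂ H) (h : ∀ u, D (b u) = b (D u) + u) (k : ℕ) :
    ∀ (c : ℕ) (y : H), (D ^ k) y = 0 → ∃ z, b (D z) + ((c:ℂ)+1) • z = y := by
  induction k with
  | zero => intro c y h; exact ⟨0, by simpa using h.symm⟩
  | succ k ih =>
    intro c y hy
    obtain ⟨z, hz⟩ := ih (c+1) (D y) (by rwa [pow_succ] at hy)
    have hc : ((c:ℂ)+1) ≠ 0 := by exact_mod_cast Nat.succ_ne_zero c
    refine ⟨((c:ℂ)+1)⁻¹ • (y - b z), ?_⟩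
    rw [map_smul, map_smul, smul_smul, mul_inv_cancel₀ hc, map_sub, map_sub, ← hz, h]
    simp only [map_add, map_smul, smul_sub]
    rw [one_smul]
    push_cast
    have e : ((c:ℂ)+1)⁻¹ * ((c:ℂ)+1+1) = 1 + ((c:ℂ)+1)⁻¹ := by field_simp
    rw [← sub_eq_zero]
    have : ∀ p q : H, ((c:ℂ)+1)⁻¹ • p + (((c:ℂ)+1)⁻¹ * ((c:ℂ)+1+1)) • q - (((c:ℂ)+1)⁻¹ • p + ((c:ℂ)+1)⁻¹ • q) + (y - q) - y = 0 := by
      intro p q; rw [e]; module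
    rw [← this (b (b (D z))) (b z)]
    simp only [smul_add, smul_smul, one_smul]
lemma bd_split (D b : Module.End ℂ H) (h : ∀ u, D (b u) = b (D u) + u) (hD : LNil D) (u : H) :
    ∃ z, D (u - b z) = 0 := by
  obtain ⟨k, hk⟩ := hD (D u)
  obtain ⟨z, hz⟩ := bd_surj D b h k 0 _ hk
  refine ⟨z, ?_⟩
  rw [map_sub, h, sub_eq_zero, ← hz]; simp
lemma bd_disj (D b : Module.End ℂ H) (h : ∀ u, D (b u) = b (D u) + u) (hD : LNil D) (u : H)
    (hu : D (b u) = 0) : b u = 0 := by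
  obtain ⟨k, hk⟩ := hD u
  rw [bd_inj D b h k 0 u hk (by rw [← hu, h]; simp), map_zero]
end bd
section lem
variable {τ : Type}
lemma lemW {Q : Type} [AddCommGroup Q] [Module ℂ Q] (Ψ : Rp τ Q) (L : List τ)
    (bs : List τ) (nd : bs.Nodup) : ∀ {M : Type} [AddCommGroup M] [Module ℂ M] (Φ : Rp τ M)
    (D : τ → Module.End ℂ M) (q : M →ₗ[ℂ] Q)
    (_ : ∀ t ∈ bs, ∀ s ∈ bs, s ≠ t → ∀ u, D t (Φ (X s) u) = Φ (X s) (D t u))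
    (_ : ∀ t ∈ bs, ∀ u, D t (Φ (X t) u) = Φ (X t) (D t u) + u)
    (_ : ∀ t ∈ bs, LNil (D t))
    (_ : ∀ t ∈ bs, ∀ s ∈ bs, ∀ u, D t (D s u) = D s (D t u))
    (_ : Function.Surjective q) (_ : ∀ t ∈ bs, ∀ u, q (Φ (X t) u) = 0)
    (_ : ∀ u, q u = 0 → u ∈ ⨆ t ∈ bs, LinearMap.range (Φ (X t)))
    (_ : Cm Φ Ψ L q),
    (∀ i j : ℤ, i + bs.length = j → Nonempty (KH Φ (bs ++ L) j ≃ₗ[ℂ] KH Ψ L i)) ∧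
    (∀ w : Q, ∃ u, q u = w ∧ ∀ t ∈ bs, D t u = 0) ∧
    (∀ u, q u = 0 → (∀ t ∈ bs, D t u = 0) → u = 0) := by
  induction bs with
  | nil =>
    intro M _ _ Φ D q h1 h2 h3 h4 h5 h6 h7 h8
    have qi : ∀ u, q u = 0 → u = 0 := fun u hu => by simpa using h7 u hu
    refine ⟨?_, fun w => ?_, fun u hu _ => qi u hu⟩
    · intro i j hij
      have hij : i = j := by simpa using hij
      subst hij
      have qb : Function.Bijective q := ⟨(inj0 q).2 qi, h5⟩
      let e := LinearEquiv.ofBijective q qb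
      have c2 : Cm Ψ Φ L (e.symm : Q →ₗ[ℂ] M) := by
        intro t ht a
        apply qb.1
        have k1 : ∀ a, q (e.symm a) = a := fun a => e.apply_symm_apply a
        rw [h8 t ht]
        show q (e.symm _) = Ψ (X t) (q (e.symm a))
        rw [k1, k1]
      have c3 : Cm Φ Φ L (LinearMap.id : M →ₗ[ℂ] M) := fun t ht a => rfl
      have c4 : Cm Ψ Ψ L (LinearMap.id : Q →ₗ[ℂ] Q) := fun t ht a => rfl
      refine ⟨LinearEquiv.ofLinearMap (Hf Φ Ψ h8 i) (Hf Ψ Φ c2 i) ?_ ?_⟩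
      · apply LinearMap.ext; intro x
        rw [cmA, ← Hf_comp Ψ Φ Ψ c2 h8 c4 (fun a => (e.apply_symm_apply a).symm),
          Hf_id Ψ c4 (fun _ => rfl)]; rfl
      · apply LinearMap.ext; intro x
        rw [cmA, ← Hf_comp Φ Ψ Φ h8 c2 c3 (fun a => (e.symm_apply_apply a).symm),
          Hf_id Φ c3 (fun _ => rfl)]; rfl
    · obtain ⟨u, hu⟩ := h5 w
      exact ⟨u, hu, by simp⟩
  | cons t bs ih =>
    intro M _ _ Φ D q h1 h2 h3 h4 h5 h6 h7 h8
    rw [List.nodup_cons] at nd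
    let U := LinearMap.range (Φ (X t))
    have hU : ∀ s, ∀ u ∈ U, Φ (X s) u ∈ U := by
      rintro s _ ⟨u, rfl⟩; exact ⟨Φ (X s) u, rp_comm _ _ _ _⟩
    have hDU : ∀ s ∈ bs, ∀ u ∈ U, D s u ∈ U := by
      rintro s hs _ ⟨u, rfl⟩
      refine ⟨D s u, (h1 s (by simp [hs]) t (by simp) ?_ u).symm⟩
      rintro rfl; exact nd.1 hs
    let Φ' := rpQ Φ U hU
    let D' : τ → Module.End ℂ (M ⧸ U) := fun s => qop U (D s)
    have hD' : ∀ s ∈ bs, ∀ u, D' s (U.mkQ u) = U.mkQ (D s u) := fun s hs u => qop_mk (hDU s hs) u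
    have hle : U ≤ LinearMap.ker q := by rintro _ ⟨u, rfl⟩; exact h6 t (by simp) u
    let q' : (M ⧸ U) →ₗ[ℂ] Q := U.liftQ q hle
    have hq' : ∀ u, q' (U.mkQ u) = q u := fun u => rfl
    have hpr : Cm Φ Φ' (bs ++ L) U.mkQ := fun s hs a => rfl
    have sj := U.mkQ_surjective
    obtain ⟨k1, k2, k3⟩ := ih nd.2 Φ' D' q'
      (by
        intro s hs r hr hrs u
        obtain ⟨u, rfl⟩ := sj u
        rw [hD' s hs]
        simp only [Φ', rpQ_mk]
        rw [hD' s hs, h1 s (by simp [hs]) r (by simp [hr]) hrs])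
      (by
        intro s hs u
        obtain ⟨u, rfl⟩ := sj u
        rw [hD' s hs]
        simp only [Φ', rpQ_mk]
        rw [hD' s hs, h2 s (by simp [hs]), map_add])
      (fun s hs => LNil_surj U.mkQ sj (D s) (D' s) (fun x => (hD' s hs x).symm) (h3 s (by simp [hs])))
      (by
        intro s hs r hr u
        obtain ⟨u, rfl⟩ := sj u
        rw [hD' s hs, hD' r hr, hD' r hr, hD' s hs, h4 s (by simp [hs]) r (by simp [hr])])
      (fun w => by obtain ⟨u, hu⟩ := h5 w; exact ⟨U.mkQ u, hu⟩)
      (by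
        intro s hs u
        obtain ⟨u, rfl⟩ := sj u
        exact h6 s (by simp [hs]) u)
      (by
        intro u hu
        obtain ⟨u, rfl⟩ := sj u
        have h9 := h7 u hu
        simp only [List.mem_cons, iSup_or, iSup_sup_eq, iSup_iSup_eq_left] at h9
        obtain ⟨a, ha, b, hb, rfl⟩ := Submodule.mem_sup.1 h9
        have e1 : U.mkQ a = 0 := (qz U).2 ha
        rw [map_add, e1, zero_add]
        have : (⨆ t ∈ bs, LinearMap.range (Φ (X t))) ≤
          (⨆ t ∈ bs, LinearMap.range (Φ' (X t))).comap U.mkQ := by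
          refine iSup₂_le fun s hs => ?_
          rintro _ ⟨u, rfl⟩
          exact Submodule.mem_iSup_of_mem s (Submodule.mem_iSup_of_mem hs ⟨U.mkQ u, rfl⟩)
        exact this hb)
      (by
        intro s hs u
        obtain ⟨u, rfl⟩ := sj u
        exact h8 s hs u)
    have ht := h2 t (by simp)
    have hn := h3 t (by simp)
    refine ⟨?_, ?_, ?_⟩
    · rintro i j rfl
      obtain ⟨e1⟩ := k1 i _ rfl
      obtain ⟨e2⟩ := cone_quot Φ Φ' t (bs ++ L) U.mkQ hpr (inj_of_weyl _ _ ht hn) sj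
        (by
          intro u
          show U.mkQ u = 0 ↔ u ∈ Set.range (Φ (X t))
          rw [Submodule.mkQ_apply, qz]; rfl)
        (i := i + bs.length) (j := i + ((t :: bs).length : ℕ)) (by simp; ring)
      exact ⟨e2.trans e1⟩
    · intro w
      obtain ⟨u, hu, hu2⟩ := k2 w
      obtain ⟨u, rfl⟩ := sj u
      obtain ⟨z, hz⟩ := bd_split _ _ ht hn u
      have e0 : U.mkQ (Φ (X t) z) = 0 := by
        rw [Submodule.mkQ_apply, qz]; exact ⟨z, rfl⟩
      have e : U.mkQ (u - Φ (X t) z) = U.mkQ u := by rw [map_sub, e0, sub_zero]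
      refine ⟨u - Φ (X t) z, ?_, ?_⟩
      · rw [← hq', e, hu]
      · intro s hs
        rw [List.mem_cons] at hs
        rcases hs with rfl | hs
        · exact hz
        · have h9 := hu2 s hs
          rw [← e, hD' s hs, Submodule.mkQ_apply, qz] at h9
          obtain ⟨y, hy⟩ := h9
          rw [← hy]
          apply bd_disj _ _ ht hn
          rw [hy, h4 t (by simp) s (by simp [hs]), hz, map_zero]
    · intro u hu hu2
      have h9 := k3 (U.mkQ u) hu (fun s hs => by rw [hD' s hs, hu2 s (by simp [hs]), map_zero])
      rw [Submodule.mkQ_apply, qz] at h9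
      obtain ⟨y, rfl⟩ := h9
      exact bd_disj _ _ ht hn _ (hu2 t (by simp))
lemma lemG {N : Type} [AddCommGroup N] [Module ℂ N] (Ψ : Rp τ N) (L : List τ)
    (bs : List τ) (nd : bs.Nodup) : ∀ {M : Type} [AddCommGroup M] [Module ℂ M] (Φ : Rp τ M)
    (E D : τ → Module.End ℂ M) (f : N →ₗ[ℂ] M)
    (_ : ∀ t ∈ bs, ∀ s ∈ bs, s ≠ t → ∀ u, D t (E s u) = E s (D t u))
    (_ : ∀ t ∈ bs, ∀ u, D t (E t u) = E t (D t u) + u)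
    (_ : ∀ t ∈ bs, LNil (E t))
    (_ : ∀ t ∈ bs, ∀ s ∈ bs, ∀ u, E t (E s u) = E s (E t u))
    (_ : Function.Injective f) (_ : ∀ u, (∃ a, f a = u) ↔ ∀ t ∈ bs, E t u = 0)
    (hE : ∀ t ∈ bs, ∀ s u, E t (Φ (X s) u) = Φ (X s) (E t u))
    (_ : ∀ t ∈ bs, Cm Φ Φ L (D t)) (hf : Cm Ψ Φ L f) (j : ℤ),
    Function.Injective (Hf Ψ Φ hf j) ∧
      ∀ y, (∃ x, Hf Ψ Φ hf j x = y) ↔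
        ∀ t (ht : t ∈ bs), Hf Φ Φ (L := L) (fun s _ => hE t ht s) j y = 0 := by
  induction bs with
  | nil =>
    intro M _ _ Φ E D f h1 h2 h3 h4 h5 h6 hE hD hf j
    have fb : Function.Bijective f := ⟨h5, fun u => (h6 u).2 (by simp)⟩
    let e := LinearEquiv.ofBijective f fb
    have c2 : Cm Φ Ψ L (e.symm : M →ₗ[ℂ] N) := by
      intro t ht a
      apply h5
      have k1 : ∀ a, f (e.symm a) = a := fun a => e.apply_symm_apply a
      rw [hf t ht]
      show f (e.symm _) = Φ (X t) (f (e.symm a))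
      rw [k1, k1]
    have c3 : Cm Φ Φ L (LinearMap.id : M →ₗ[ℂ] M) := fun t ht a => rfl
    have c4 : Cm Ψ Ψ L (LinearMap.id : N →ₗ[ℂ] N) := fun t ht a => rfl
    have k1 : ∀ x, Hf Φ Ψ c2 j (Hf Ψ Φ hf j x) = x := fun x => by
      rw [← Hf_comp Ψ Φ Ψ hf c2 c4 (fun a => (e.symm_apply_apply a).symm), Hf_id Ψ c4 (fun _ => rfl)]
    have k2 : ∀ x, Hf Ψ Φ hf j (Hf Φ Ψ c2 j x) = x := fun x => by
      rw [← Hf_comp Φ Ψ Φ c2 hf c3 (fun a => (e.apply_symm_apply a).symm), Hf_id Φ c3 (fun _ => rfl)]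
    refine ⟨fun x y h => by rw [← k1 x, h, k1], fun y => ⟨by simp, fun _ => ⟨_, k2 y⟩⟩⟩
  | cons t bs ih =>
    intro M _ _ Φ E D f h1 h2 h3 h4 h5 h6 hE hD hf j
    rw [List.nodup_cons] at nd
    let K := LinearMap.ker (E t)
    have mK : ∀ {u}, u ∈ K ↔ E t u = 0 := Iff.rfl
    have hK : ∀ s, ∀ u ∈ K, Φ (X s) u ∈ K := by
      intro s u hu
      rw [mK] at hu ⊢
      rw [hE t (by simp), hu, map_zero]
    have hEK : ∀ s ∈ bs, ∀ u ∈ K, E s u ∈ K := by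
      intro s hs u hu
      rw [mK] at hu ⊢
      rw [h4 t (by simp) s (by simp [hs]), hu, map_zero]
    have hDK : ∀ s ∈ bs, ∀ u ∈ K, D s u ∈ K := by
      intro s hs u hu
      rw [mK] at hu ⊢
      rw [← h1 s (by simp [hs]) t (by simp) (by rintro rfl; exact nd.1 hs), hu, map_zero]
    let Φ' := rpS Φ K hK
    have hE' : ∀ s ∈ bs, ∀ u, (rop K (E s) u : M) = E s u := fun s hs u => rop_coe (hEK s hs) u
    have hD' : ∀ s ∈ bs, ∀ u, (rop K (D s) u : M) = D s u := fun s hs u => rop_coe (hDK s hs) u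
    let f' : N →ₗ[ℂ] K := f.codRestrict K (fun a => (h6 _).1 ⟨a, rfl⟩ t (by simp))
    have hEs : ∀ s ∈ bs, ∀ r u, rop K (E s) (Φ' (X r) u) = Φ' (X r) (rop K (E s) u) := by
      intro s hs r u
      apply Subtype.ext
      rw [hE' s hs]
      simp only [Φ', rpS_coe]
      rw [hE' s hs, hE s (by simp [hs])]
    have hf' : Cm Ψ Φ' L f' := fun s hs a => Subtype.ext (hf s hs a)
    obtain ⟨k1, k2⟩ := ih nd.2 Φ' (fun s => rop K (E s)) (fun s => rop K (D s)) f'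
      (by
        intro s hs r hr hrs u
        apply Subtype.ext
        rw [hD' s hs, hE' r hr, hE' r hr, hD' s hs, h1 s (by simp [hs]) r (by simp [hr]) hrs])
      (by
        intro s hs u
        apply Subtype.ext
        rw [hD' s hs, hE' s hs, Submodule.coe_add, hE' s hs, hD' s hs, h2 s (by simp [hs])])
      (fun s hs => LNil_inj K.subtype K.subtype_injective _ (E s) (hE' s hs) (h3 s (by simp [hs])))
      (by
        intro s hs r hr u
        apply Subtype.ext
        rw [hE' s hs, hE' r hr, hE' r hr, hE' s hs, h4 s (by simp [hs]) r (by simp [hr])])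
      (fun a b h => h5 (congrArg Subtype.val h))
      (by
        intro u
        constructor
        · rintro ⟨a, rfl⟩ s hs
          apply Subtype.ext
          rw [hE' s hs]
          exact (h6 _).1 ⟨a, rfl⟩ s (by simp [hs])
        · intro h
          obtain ⟨a, ha⟩ := (h6 (u : M)).2 (by
            intro s hs
            rw [List.mem_cons] at hs
            rcases hs with rfl | hs
            · exact u.2
            · rw [← hE' s hs, h s hs]; rfl)
          exact ⟨a, Subtype.ext ha⟩)
      hEs
      (by
        intro s hs r hr u
        apply Subtype.ext
        rw [hD' s hs]
        simp only [Φ', rpS_coe]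
        rw [hD' s hs, hD s (by simp [hs]) r hr])
      hf' j
    have cK : Cm Φ' Φ L K.subtype := fun s hs a => rfl
    have cE : Cm Φ Φ L (E t) := fun s _ => hE t (by simp) s
    obtain ⟨δ, x1, x2, x3⟩ := coefLES Φ' Φ Φ cK cE K.subtype_injective
      (surj_of_weyl _ _ (h2 t (by simp)) (h3 t (by simp)))
      (by intro u; exact ⟨fun h => ⟨⟨u, h⟩, rfl⟩, by rintro ⟨a, rfl⟩; exact a.2⟩)
    have sur : ∀ i, Function.Surjective (Hf Φ Φ cE i) := fun i =>
      surj_of_weyl _ _ (Hf_weyl Φ (hD t (by simp)) cE (h2 t (by simp)) i) (LNil_H cE (h3 t (by simp)) i)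
    have inj : Function.Injective (Hf Φ' Φ cK j) := by
      have : ∀ i, Function.Injective (Hf Φ' Φ cK (i+1)) := by
        intro i
        rw [inj0]
        intro x hx
        obtain ⟨y, rfl⟩ := (x3 i x).1 hx
        obtain ⟨z, rfl⟩ := sur _ y
        exact (x2 i _).2 ⟨z, rfl⟩
      have := this (j-1)
      rwa [sub_add_cancel] at this
    have cp : ∀ x, Hf Ψ Φ hf j x = Hf Φ' Φ cK j (Hf Ψ Φ' hf' j x) :=
      Hf_comp Ψ Φ' Φ hf' cK hf (fun _ => rfl) j
    have nat : ∀ s (hs : s ∈ bs) x, Hf Φ' Φ cK j (Hf Φ' Φ' (L := L) (fun r _ => hEs s hs r) j x) =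
        Hf Φ Φ (L := L) (fun r _ => hE s (by simp [hs]) r) j (Hf Φ' Φ cK j x) := by
      intro s hs x
      have c5 : Cm Φ' Φ L (E s ∘ₗ K.subtype) := fun r hr a => hE s (by simp [hs]) r a
      exact (Hf_comp Φ' Φ' Φ (fun r _ => hEs s hs r) cK c5 (fun a => (hE' s hs a).symm) j x).symm.trans
        (Hf_comp Φ' Φ Φ cK (fun r _ => hE s (by simp [hs]) r) c5 (fun _ => rfl) j x)
    refine ⟨fun x y h => k1 (inj ?_), fun y => ?_⟩
    · rw [← cp, ← cp, h]
    · constructor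
      · rintro ⟨x, rfl⟩ s hs
        rw [cp]
        have hs0 := hs
        rw [List.mem_cons] at hs
        rcases hs with rfl | hs
        · exact (x1 j _).2 ⟨_, rfl⟩
        · rw [← nat s hs, (k2 _).1 ⟨x, rfl⟩ s hs, map_zero]
      · intro h
        obtain ⟨z, rfl⟩ := (x1 j y).1 (h t (by simp))
        obtain ⟨x, rfl⟩ := (k2 z).2 (fun s hs => inj (by
          rw [nat s hs, h s (by simp [hs]), map_zero]))
        exact ⟨x, cp x⟩
end lem
end SkewLC
end

section
namespace SkewLC
open MvPolynomial
section int
variable {H K : Type*} [AddCommGroup H] [Module ℂ H] [AddCommGroup K] [Module ℂ K]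
def tp (T : Module.End ℂ H) : List ℤ → Module.End ℂ H
  | [] => 1
  | a :: l => tp T l * (T - (a:ℂ) • 1)
lemma tp_cons (T : Module.End ℂ H) (a l u) : tp T (a :: l) u = tp T l (T u - (a:ℂ) • u) := rfl
lemma tp_nil (T : Module.End ℂ H) (u) : tp T [] u = u := rfl
lemma tp_append (T : Module.End ℂ H) (l l' u) : tp T (l ++ l') u = tp T l' (tp T l u) := by
  induction l generalizing u with
  | nil => rfl
  | cons a l ih => rw [List.cons_append, tp_cons, ih, tp_cons]
lemma tp_F (T : Module.End ℂ H) (T' : Module.End ℂ K) (F : H →ₗ[ℂ] K) (h : ∀ u, F (T u) = T' (F u))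
    (l u) : F (tp T l u) = tp T' l (F u) := by
  induction l generalizing u with
  | nil => rfl
  | cons a l ih => rw [tp_cons, ih, tp_cons, map_sub, map_smul, h]
lemma tp_T (T : Module.End ℂ H) (l u) : tp T l (T u) = T (tp T l u) :=
  (tp_F T T T (fun _ => rfl) l u).symm
lemma tp_comm (T : Module.End ℂ H) (l l' u) : tp T l (tp T l' u) = tp T l' (tp T l u) :=
  tp_F T T (tp T l) (tp_T T l) l' u
def IntA (T : Module.End ℂ H) : Prop := ∀ u, ∃ l, tp T l u = 0
lemma eig_surj (T : Module.End ℂ H) (a b : ℂ) (hab : b ≠ a) (k : ℕ) : ∀ s, ((T - b • 1) ^ k) s = 0 →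
    ∃ s', ((T - b • 1) ^ k) s' = 0 ∧ T s' - a • s' = s := by
  induction k with
  | zero => intro s h; exact ⟨0, by simp, by simpa using h.symm⟩
  | succ k ih =>
    intro s hs
    have e : ∀ w, ((T - b • 1) ^ (k+1)) w = ((T - b • 1) ^ k) (T w - b • w) := fun w => by
      rw [pow_succ]; rfl
    have e' : ∀ w, ((T - b • 1) ^ (k+1)) w = (T - b • 1) (((T - b • 1) ^ k) w) := fun w => by
      rw [pow_succ']; rfl
    obtain ⟨s1, h1, h2⟩ := ih (T s - b • s) (by rw [← e]; exact hs)
    have hba : b - a ≠ 0 := sub_ne_zero.2 hab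
    refine ⟨(b - a)⁻¹ • (s - s1), ?_, ?_⟩
    · rw [map_smul, map_sub, hs, e', h1, map_zero, sub_zero, smul_zero]
    · have : T s = T s1 - a • s1 + b • s := by rw [h2]; abel
      rw [map_smul, map_sub, this, smul_comm a, ← smul_sub]
      have h3 : T s1 - a • s1 + b • s - T s1 - a • (s - s1) = (b - a) • s := by module
      rw [h3, smul_smul, inv_mul_cancel₀ hba, one_smul]
lemma IntA_top (T : Module.End ℂ H) (hT : IntA T) :
    (⨆ a : ℤ, T.maxGenEigenspace (a:ℂ)) = ⊤ := by
  set S := ⨆ a : ℤ, T.maxGenEigenspace (a:ℂ) with hS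
  have hle : ∀ a : ℤ, T.maxGenEigenspace (a:ℂ) ≤ S := fun a => le_iSup (fun a : ℤ => T.maxGenEigenspace (a:ℂ)) a
  have key : ∀ a : ℤ, ∀ s ∈ S, ∃ s' ∈ S, s - (T s' - (a:ℂ) • s') ∈ T.maxGenEigenspace (a:ℂ) := by
    intro a s hs
    induction hs using Submodule.iSup_induction' with
    | mem b s hs =>
      by_cases hab : b = a
      · subst hab
        exact ⟨0, zero_mem _, by simpa using hs⟩
      · obtain ⟨k, hk⟩ := (Module.End.mem_maxGenEigenspace _ _ _).1 hs
        obtain ⟨s', h1, h2⟩ := eig_surj T a b (by exact_mod_cast hab) k s hk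
        exact ⟨s', hle b ((Module.End.mem_maxGenEigenspace _ _ _).2 ⟨k, h1⟩), by rw [h2, sub_self]; exact zero_mem _⟩
    | zero => exact ⟨0, zero_mem _, by simp⟩
    | add x y hx hy ihx ihy =>
      obtain ⟨x', h1, h2⟩ := ihx
      obtain ⟨y', h3, h4⟩ := ihy
      refine ⟨x' + y', add_mem h1 h3, ?_⟩
      have := add_mem h2 h4
      rw [map_add]
      convert this using 1
      module
  have k2 : ∀ (a : ℤ) u, T u - (a:ℂ) • u ∈ S → u ∈ S := by
    intro a u hu
    obtain ⟨s', h1, h2⟩ := key a _ hu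
    have : u - s' ∈ T.maxGenEigenspace (a:ℂ) := by
      obtain ⟨k, hk⟩ := (Module.End.mem_maxGenEigenspace _ _ _).1 h2
      refine (Module.End.mem_maxGenEigenspace _ _ _).2 ⟨k+1, ?_⟩
      rw [pow_succ, mAp]
      rw [← hk]
      congr 1
      simp only [sbA, smA, onA, map_sub]
    have := add_mem (hle a this) h1
    rwa [sub_add_cancel] at this
  rw [eq_top_iff]
  intro u _
  obtain ⟨l, hl⟩ := hT u
  have : ∀ l u, tp T l u = 0 → u ∈ S := by
    intro l
    induction l with
    | nil => intro u hu; rw [tp_nil] at hu; rw [hu]; exact zero_mem _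
    | cons a l ih => intro u hu; exact k2 a u (ih _ hu)
  exact this l u hl
structure GrOK (π : ℤ → Module.End ℂ H) : Prop where
  fin : ∀ u, ∃ s : Finset ℤ, (∀ a, a ∉ s → π a u = 0) ∧ ∑ a ∈ s, π a u = u
  orth : ∀ a b u, π a (π b u) = if a = b then π b u else 0
lemma IntA_grad (T : Module.End ℂ H) (hT : IntA T) : ∃ π : ℤ → Module.End ℂ H, GrOK π ∧
    (∀ (a : ℤ) u, ∃ k : ℕ, ((T - (a:ℂ) • 1) ^ k) (π a u) = 0) ∧
    (∀ (a b : ℤ) (k : ℕ) w, ((T - (a:ℂ) • 1) ^ k) w = 0 → π b w = if b = a then w else 0) ∧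
    (∀ (f : Module.End ℂ H) (d : ℤ), (∀ u, T (f u) = f (T u) + (d:ℂ) • f u) →
      ∀ a u, f (π a u) = π (a + d) (f u)) := by
  classical
  let W : ℤ → Submodule ℂ H := fun a => T.maxGenEigenspace (a:ℂ)
  have hi : iSupIndep W := (Module.End.independent_maxGenEigenspace T).comp (f := fun a : ℤ => (a:ℂ)) Int.cast_injective
  have hint : DirectSum.IsInternal W := by
    rw [DirectSum.isInternal_submodule_iff_iSupIndep_and_iSup_eq_top]
    exact ⟨hi, IntA_top T hT⟩
  let _ := hint.chooseDecomposition
  let π : ℤ → Module.End ℂ H := fun a => (W a).subtype ∘ₗ DirectSum.component ℂ ℤ (fun a => W a) a ∘ₗ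
    (DirectSum.decomposeLinearEquiv W).toLinearMap
  have hπ : ∀ a u, π a u = (DirectSum.decompose W u a : H) := fun a u => rfl
  have hW : ∀ (a : ℤ) w, w ∈ W a ↔ ∃ k : ℕ, ((T - (a:ℂ) • 1) ^ k) w = 0 := fun a w =>
    Module.End.mem_maxGenEigenspace _ _ _
  have p2 : ∀ (a : ℤ) u, ∃ k : ℕ, ((T - (a:ℂ) • 1) ^ k) (π a u) = 0 := fun a u =>
    (hW a _).1 (DirectSum.decompose W u a).2
  have p3 : ∀ (a b : ℤ) (k : ℕ) w, ((T - (a:ℂ) • 1) ^ k) w = 0 → π b w = if b = a then w else 0 := by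
    intro a b k w hk
    have hw : w ∈ W a := (hW a w).2 ⟨k, hk⟩
    rw [hπ]
    split_ifs with h
    · subst h; exact DirectSum.decompose_of_mem_same W hw
    · exact DirectSum.decompose_of_mem_ne W hw (Ne.symm h)
  have g : GrOK π := by
    refine ⟨fun u => ⟨(DirectSum.decompose W u).support, fun a ha => ?_, ?_⟩, fun a b u => ?_⟩
    · rw [hπ]; simpa using ha
    · exact DirectSum.sum_support_decompose W u
    · obtain ⟨k, hk⟩ := p2 b u
      exact p3 b a k _ hk
  refine ⟨π, g, p2, p3, ?_⟩
  intro f d hf a u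
  have hp : ∀ (b : ℤ) (k : ℕ) w, ((T - ((b+d : ℤ):ℂ) • 1) ^ k) (f w) = f (((T - (b:ℂ) • 1) ^ k) w) := by
    intro b k
    induction k with
    | zero => intro w; rfl
    | succ k ih =>
      intro w
      rw [pow_succ, pow_succ, mAp, mAp, ← ih]
      congr 1
      simp only [sbA, smA, onA, map_sub, map_smul, hf]
      push_cast
      module
  have q : ∀ b c w, π c (f (π b w)) = if c = b + d then f (π b w) else 0 := by
    intro b c w
    obtain ⟨k, hk⟩ := p2 b w
    exact p3 (b+d) c k _ (by rw [hp, hk, map_zero])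
  obtain ⟨s, hs1, hs2⟩ := g.fin u
  conv_rhs => rw [← hs2]
  rw [map_sum, map_sum, Finset.sum_congr rfl (fun b _ => q b (a+d) u)]
  simp only [add_left_inj]
  rw [Finset.sum_ite_eq s a]
  split_ifs with h
  · rfl
  · rw [hs1 a h, map_zero]
variable {π : ℤ → Module.End ℂ H} {f : Module.End ℂ H}
lemma gr_pow (hf : ∀ a u, f (π a u) = π (a + 1) (f u)) (k : ℕ) (a u) : (f ^ k) (π a u) = π (a + k) ((f ^ k) u) := by
  induction k generalizing a u with
  | zero => simp
  | succ k ih =>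
    rw [pow_succ, mAp, hf, ih, mAp]
    push_cast; congr 2; ring
lemma gr_bd (g : GrOK π) (u : H) : ∃ N : ℕ, ∀ a : ℤ, (N:ℤ) ≤ |a| → π a u = 0 := by
  obtain ⟨s, hs, -⟩ := g.fin u
  refine ⟨∑ b ∈ s, b.natAbs + 1, fun a ha => hs a fun h => ?_⟩
  have := Finset.single_le_sum (f := fun b : ℤ => b.natAbs) (fun _ _ => Nat.zero_le _) h
  have h3 : |a| = (a.natAbs : ℤ) := Int.abs_eq_natAbs a
  rw [h3] at ha
  push_cast at ha
  zify at this
  linarith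
lemma gr_ext (g : GrOK π) (u : H) (h : ∀ a, π a u = 0) : u = 0 := by
  obtain ⟨s, -, hs⟩ := g.fin u
  rw [← hs]; exact Finset.sum_eq_zero fun a _ => h a
lemma g1 (g : GrOK π) (hf : ∀ a u, f (π a u) = π (a + 1) (f u)) (u : H) (h : f u = u) : u = 0 := by
  apply gr_ext g
  intro a
  obtain ⟨N, hN⟩ := gr_bd g u
  have hk : ∀ k : ℕ, (f ^ k) u = u := by
    intro k
    induction k with
    | zero => rfl
    | succ k ih => rw [pow_succ, mAp, h, ih]
  have := gr_pow hf (N + a.natAbs) (a - (N + a.natAbs : ℕ)) u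
  rw [hk, hN _ (by rw [le_abs]; right; push_cast; linarith [le_abs_self a]), map_zero] at this
  rw [this]; congr 1; ring
lemma g2 (g : GrOK π) (hf : ∀ a u, f (π a u) = π (a + 1) (f u)) (c : ℤ) (y u : H) (hy : π c y = y) (h : f u - u = y) : ∃ N : ℕ, (f ^ N) y = 0 := by
  obtain ⟨N, hN⟩ := gr_bd g u
  have e : ∀ a, a ≠ c → π a u = f (π (a-1) u) := by
    intro a ha
    have := congrArg (π a) h
    rw [← hy, g.orth, if_neg ha, map_sub, sub_eq_zero] at this
    rw [← this, hf, sub_add_cancel]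
  have low : ∀ (k : ℕ) (a : ℤ), a < c → π a u = (f ^ k) (π (a - k) u) := by
    intro k
    induction k with
    | zero => intro a _; simp
    | succ k ih =>
      intro a ha
      rw [ih a ha, e (a - k) ω, pow_succ, mAp]
      have e3 : a - (k:ℤ) - 1 = a - ((k+1:ℕ):ℤ) := by push_cast; ring
      rw [e3]
  have z : π (c-1) u = 0 := by
    rw [low (N + (c-1).natAbs) (c-1) ω, hN, map_zero]
    rw [le_abs]; right; push_cast; linarith [le_abs_self (c-1)]
  have hc : π c u = - y := by
    have := congrArg (π c) h
    rw [hy, map_sub] at this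
    have e2 := hf (c-1) u
    rw [z, map_zero, sub_add_cancel] at e2
    rw [← e2, zero_sub] at this
    rw [← this, neg_neg]
  have up : ∀ (k : ℕ), π (c + k) u = - (f ^ k) y := by
    intro k
    induction k with
    | zero => simpa using hc
    | succ k ih =>
      rw [e _ ω]
      have : c + ((k+1 : ℕ):ℤ) - 1 = c + k := by push_cast; ring
      rw [this, ih, map_neg, pow_succ']; rfl
  refine ⟨N + c.natAbs, ?_⟩
  have := up (N + c.natAbs)
  rw [hN] at this
  · exact neg_eq_zero.1 this.symm
  · rw [le_abs]; left; push_cast; linarith [neg_abs_le c]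
lemma pow_sub_mem (k : ℕ) (u : H) : (f ^ k) u - u ∈ LinearMap.range (f - 1) := by
  induction k with
  | zero => simp
  | succ k ih =>
    have : (f ^ (k+1)) u - u = ((f - 1) ((f ^ k) u)) + ((f ^ k) u - u) := by
      rw [pow_succ']; simp
    rw [this]
    exact add_mem ⟨_, rfl⟩ ih
lemma g3 (g : GrOK π) (hf : ∀ a u, f (π a u) = π (a + 1) (f u)) (c0 : ℤ) (u : H) : ∃ c w, c0 ≤ c ∧ π c w = w ∧ u - w ∈ LinearMap.range (f - 1) := by
  obtain ⟨N, hN⟩ := gr_bd g u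
  obtain ⟨s, hs1, hs2⟩ := g.fin u
  let c : ℤ := N + c0.natAbs
  refine ⟨c, ∑ a ∈ s, (f ^ (c - a).toNat) (π a u), ?_, ?_, ?_⟩
  · simp only [c, Int.natCast_natAbs]; linarith [le_abs_self c0]
  · rw [map_sum]
    refine Finset.sum_congr rfl fun a _ => ?_
    by_cases hac : a ≤ c
    · rw [gr_pow hf, g.orth, if_pos]
      rw [Int.toNat_of_nonneg ω]; ring
    · have : π a u = 0 := hN a (by rw [le_abs]; left; simp only [c] at hac; omega)
      rw [this]; simp
  · rw [← neg_mem_iff, neg_sub]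
    have : ∑ a ∈ s, (f ^ (c - a).toNat) (π a u) - u =
      ∑ a ∈ s, ((f ^ (c - a).toNat) (π a u) - π a u) := by
      rw [Finset.sum_sub_distrib, hs2]
    rw [this]
    exact Submodule.sum_mem _ fun a _ => pow_sub_mem _ _
def Wg (π : ℤ → Module.End ℂ H) (c : ℤ) : Submodule ℂ H := LinearMap.ker (π c - 1)
lemma mem_Wg {c : ℤ} {u : H} : u ∈ Wg π c ↔ π c u = u := by
  simp [Wg, LinearMap.mem_ker, sub_eq_zero]
lemma Wg_quot (g : GrOK π) (hf : ∀ a u, f (π a u) = π (a + 1) (f u)) (c0 : ℤ) (hi : ∀ c, c0 ≤ c → ∀ w ∈ Wg π c, f w = 0 → w = 0)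
    (hsj : ∀ c, c0 ≤ c → ∀ w ∈ Wg π (c+1), ∃ z, f z = w) :
    Nonempty (Wg π c0 ≃ₗ[ℂ] (H ⧸ LinearMap.range (f - 1))) := by
  have st : ∀ c, ∀ w ∈ Wg π c, f w ∈ Wg π (c+1) := by
    intro c w hw
    rw [mem_Wg] at hw ⊢
    rw [← hf, hw]
  refine ⟨LinearEquiv.ofBijective ((LinearMap.range (f - 1)).mkQ ∘ₗ (Wg π c0).subtype) ⟨?_, ?_⟩⟩
  · rw [inj0]
    rintro ⟨w, hw⟩ h
    have h : w ∈ LinearMap.range (f - 1) := (qz _).1 h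
    obtain ⟨u, hu⟩ := h
    obtain ⟨N, hN⟩ := g2 g hf c0 w u (mem_Wg.1 hw) hu
    have : ∀ (N : ℕ) c w, c0 ≤ c → w ∈ Wg π c → (f ^ N) w = 0 → w = 0 := by
      intro N
      induction N with
      | zero => intro c w _ _ h; exact h
      | succ N ih =>
        intro c w hc hw h
        exact hi c hc w hw (ih (c+1) (f w) ω (st c w hw) (by rwa [pow_succ] at h))
    exact Subtype.ext (this N c0 w le_rfl hw hN)
  · intro y
    obtain ⟨u, rfl⟩ := mkS _ y
    obtain ⟨c, w, hc, hw, hm⟩ := g3 g hf c0 u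
    obtain ⟨n, rfl⟩ := Int.le.dest hc
    have : ∀ (n : ℕ) w, w ∈ Wg π (c0 + n) → ∃ w0 ∈ Wg π c0, (f ^ n) w0 = w := by
      intro n
      induction n with
      | zero => intro w hw; exact ⟨w, by simpa using hw, rfl⟩
      | succ n ih =>
        intro w hw
        have e : c0 + ((n+1 : ℕ):ℤ) = c0 + n + 1 := by push_cast; ring
        rw [e] at hw
        obtain ⟨z, hz⟩ := hsj (c0 + n) ω w hw
        have hz2 : f (π (c0 + n) z) = w := by rw [hf, hz, mem_Wg.1 hw]
        obtain ⟨w0, h1, h2⟩ := ih (π (c0+n) z) (by rw [mem_Wg, g.orth, if_pos rfl])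
        exact ⟨w0, h1, by rw [pow_succ', mAp, h2, hz2]⟩
    obtain ⟨w0, h1, rfl⟩ := this n w (mem_Wg.2 hw)
    refine ⟨⟨w0, h1⟩, ?_⟩
    show (LinearMap.range (f - 1)).mkQ w0 = _
    rw [← sub_eq_zero, ← map_sub]
    refine (qz _).2 ?_
    have h5 := add_mem (pow_sub_mem n w0) hm
    rw [← neg_mem_iff]
    convert h5 using 1
    abel
end int
def Dm (H : Type*) [AddCommGroup H] [Module ℂ H] (c : ℕ) : Prop := Module.Finite ℂ H ∧ Module.finrank ℂ H = c
lemma Dm.equiv {H K : Type*} [AddCommGroup H] [Module ℂ H] [AddCommGroup K] [Module ℂ K] {c : ℕ}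
    (h : Dm H c) (e : Nonempty (H ≃ₗ[ℂ] K)) : Dm K c := by
  obtain ⟨e⟩ := e
  obtain ⟨h1, h2⟩ := h
  exact ⟨Module.Finite.equiv e, by rw [← e.finrank_eq, h2]⟩
lemma Dm.zero {H : Type*} [AddCommGroup H] [Module ℂ H] (h : Dm H 0) (u : H) : u = 0 := by
  obtain ⟨h1, h2⟩ := h
  have := Module.finrank_zero_iff.1 h2
  exact Subsingleton.elim _ _
lemma Dm_zero {H : Type*} [AddCommGroup H] [Module ℂ H] (h : ∀ u : H, u = 0) : Dm H 0 := by
  have : Subsingleton H := ⟨fun a b => by rw [h a, h b]⟩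
  exact ⟨inferInstance, Module.finrank_zero_of_subsingleton⟩
lemma Dm.ext {A H C : Type*} [AddCommGroup A] [Module ℂ A] [AddCommGroup H] [Module ℂ H]
    [AddCommGroup C] [Module ℂ C] {a b : ℕ} (i : A →ₗ[ℂ] H) (p : H →ₗ[ℂ] C)
    (ex : Function.Exact i p) (h1 : Dm (LinearMap.range i) a) (h2 : Dm (LinearMap.range p) b) : Dm H (a + b) := by
  have e : LinearMap.ker p = LinearMap.range i := by
    ext u; exact ex u
  rw [← e] at h1
  obtain ⟨f1, r1⟩ := h1
  obtain ⟨f2, r2⟩ := h2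
  have f3 : Module.Finite ℂ (H ⧸ LinearMap.ker p) := Module.Finite.equiv p.quotKerEquivRange.symm
  have fH : Module.Finite ℂ H := Module.Finite.of_submodule_quotient (LinearMap.ker p)
  refine ⟨fH, ?_⟩
  rw [← LinearMap.finrank_range_add_finrank_ker p, r1, r2, add_comm]
lemma weylDims {H : Type*} [AddCommGroup H] [Module ℂ H] (x D T : Module.End ℂ H)
    (hW : ∀ u, D (x u) = x (D u) + u) (hxD : ∀ u, T u = x (D u)) (hT : IntA T) {a b : ℕ}
    (ha : Dm (H ⧸ LinearMap.range (x - 1)) a) (hb : Dm (H ⧸ LinearMap.range (D - 1)) b)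
    (hab : a = 0 ∨ b = 0) : Dm (LinearMap.ker x) b ∧ Dm (H ⧸ LinearMap.range x) a := by
  obtain ⟨π, g, p2, p3, pf⟩ := IntA_grad T hT
  have hx := pf x 1 (fun u => by simp [hxD, hW])
  have hD := pf D (-1) (fun u => by
    simp only [hxD]
    have := hW (D u)
    rw [this]; simp)
  have xi : ∀ c : ℤ, c ≠ -1 → ∀ w ∈ Wg π c, x w = 0 → w = 0 := by
    intro c hc w hw h
    obtain ⟨k, hk⟩ := p2 c w
    rw [mem_Wg.1 hw] at hk
    have e : T w = (-1:ℂ) • w := by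
      have := hW w
      rw [h, map_zero] at this
      rw [hxD, neg_smul, one_smul]
      exact eq_neg_of_add_eq_zero_left this.symm
    have e2 : ∀ k : ℕ, ((T - (c:ℂ) • 1) ^ k) w = ((-1 - (c:ℂ)) ^ k) • w := by
      intro k
      induction k with
      | zero => simp
      | succ k ih =>
        rw [pow_succ', mAp, ih, map_smul]
        simp only [sbA, smA, onA, e]
        rw [← sub_smul, smul_smul, pow_succ]
    rw [e2] at hk
    refine (smul_eq_zero.1 hk).resolve_left (pow_ne_zero _ ?_)
    intro h
    apply hc
    have : (c:ℂ) = ((-1:ℤ):ℂ) := by push_cast; linear_combination -h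
    exact_mod_cast this
  have di : ∀ c : ℤ, c ≠ 0 → ∀ w ∈ Wg π c, D w = 0 → w = 0 := by
    intro c hc w hw h
    obtain ⟨k, hk⟩ := p2 c w
    rw [mem_Wg.1 hw] at hk
    have e : T w = 0 := by rw [hxD, h, map_zero]
    have e2 : ∀ k : ℕ, ((T - (c:ℂ) • 1) ^ k) w = ((- (c:ℂ)) ^ k) • w := by
      intro k
      induction k with
      | zero => simp
      | succ k ih =>
        rw [pow_succ', mAp, ih, map_smul]
        simp only [sbA, smA, onA, e]
        rw [zero_sub, ← neg_smul, smul_smul, pow_succ]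
    rw [e2] at hk
    refine (smul_eq_zero.1 hk).resolve_left (pow_ne_zero _ ?_)
    simpa using hc
  have xs : ∀ c : ℤ, c ≠ 0 → ∀ w ∈ Wg π c, ∃ z, x z = w := by
    intro c hc w hw
    obtain ⟨k, hk⟩ := p2 c w
    rw [mem_Wg.1 hw] at hk
    obtain ⟨z, -, hz⟩ := eig_surj T 0 c (by exact_mod_cast hc) k w hk
    exact ⟨D z, by rw [← hz, hxD]; simp⟩
  have ds : ∀ c : ℤ, c ≠ -1 → ∀ w ∈ Wg π c, ∃ z, D z = w := by
    intro c hc w hw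
    obtain ⟨k, hk⟩ := p2 c w
    rw [mem_Wg.1 hw] at hk
    obtain ⟨z, -, hz⟩ := eig_surj T (-1) c (by exact_mod_cast hc) k w hk
    exact ⟨x z, by rw [← hz, hxD, hW]; simp⟩
  have W0 := Wg_quot g hx 0 (fun c hc => xi c ω) (fun c hc => xs (c+1) ω)
  have g' : GrOK (fun a => π (-a)) := by
    refine ⟨fun u => ?_, fun a b u => ?_⟩
    · obtain ⟨s, h1, h2⟩ := g.fin u
      refine ⟨s.map (Equiv.neg ℤ).toEmbedding, fun a ha => h1 _ (fun h => ha ?_), ?_⟩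
      · rw [Finset.mem_map]; exact ⟨-a, h, by simp⟩
      · rw [Finset.sum_map]; simpa using h2
    · simp only [g.orth, neg_inj]
  have W1 := Wg_quot g' (f := D) (fun a u => by rw [hD]; congr 2; ring) 1
    (fun c hc w hw => di (-c) ω w hw) (fun c hc w hw => ds (-(c+1)) ω w hw)
  have dW0 : Dm (Wg π 0) a := ha.equiv ⟨W0.some.symm⟩
  have dW1 : Dm (Wg π (-1)) b := hb.equiv ⟨W1.some.symm⟩
  have st : ∀ w ∈ Wg π (-1), x w ∈ Wg π 0 := by
    intro w hw
    rw [mem_Wg] at hw ⊢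
    have := hx (-1) w
    rw [hw] at this
    exact this.symm
  have x0 : ∀ w ∈ Wg π (-1), x w = 0 := by
    intro w hw
    rcases hab with rfl | rfl
    · exact congrArg Subtype.val (dW0.zero ⟨x w, st w hw⟩)
    · have := congrArg Subtype.val (dW1.zero ⟨w, hw⟩)
      simp only [ZeroMemClass.coe_zero] at this
      rw [this, map_zero]
  constructor
  · have : LinearMap.ker x = Wg π (-1) := by
      ext u
      rw [LinearMap.mem_ker]
      refine ⟨fun h => ?_, x0 u⟩
      rw [mem_Wg]
      rw [← sub_eq_zero]
      apply gr_ext g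
      intro c
      rw [map_sub, g.orth]
      split_ifs with hc
      · rw [hc, sub_self]
      · rw [zero_sub, neg_eq_zero]
        apply xi c hc _ (mem_Wg.2 (by rw [g.orth, if_pos rfl]))
        rw [hx, h, map_zero]
    rw [this]; exact dW1
  · refine dW0.equiv ⟨LinearEquiv.ofBijective ((LinearMap.range x).mkQ ∘ₗ (Wg π 0).subtype) ⟨?_, ?_⟩⟩
    · rw [inj0]
      rintro ⟨w, hw⟩ h
      have h : w ∈ LinearMap.range x := (qz _).1 h
      obtain ⟨u, hu⟩ := h
      apply Subtype.ext
      have e := hx (-1) u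
      rw [hu, x0 _ (mem_Wg.2 (by rw [g.orth, if_pos rfl]))] at e
      have e2 := mem_Wg.1 hw
      exact e2.symm.trans e.symm
    · intro y
      obtain ⟨u, rfl⟩ := mkS _ y
      refine ⟨⟨π 0 u, mem_Wg.2 (by rw [g.orth, if_pos rfl])⟩, ?_⟩
      show (LinearMap.range x).mkQ (π 0 u) = _
      rw [← sub_eq_zero, ← map_sub]
      refine (qz _).2 ?_
      obtain ⟨s, h1, h2⟩ := g.fin (π 0 u - u)
      rw [← h2]
      refine Submodule.sum_mem _ fun c _ => ?_
      rw [map_sub, g.orth]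
      split_ifs with hc
      · rw [hc, sub_self]; exact zero_mem _
      · rw [zero_sub]
        apply neg_mem
        obtain ⟨z, hz⟩ := xs c hc (π c u) (mem_Wg.2 (by rw [g.orth, if_pos rfl]))
        exact ⟨z, hz⟩
end SkewLC
end

section
namespace SkewLC
open MvPolynomial
section ci
variable {τ : Type} {M : Type} [AddCommGroup M] [Module ℂ M]
lemma Cm.tp {Φ : Rp τ M} {L : List τ} {f : Module.End ℂ M} (h : Cm Φ Φ L f) (l : List ℤ) :
    Cm Φ Φ L (SkewLC.tp f l) := fun t ht a => by
  rw [← tp_F f f (Φ (X t)) (fun u => (h t ht u).symm)]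
lemma Hf_tp {Φ : Rp τ M} {L : List τ} {f : Module.End ℂ M} (h : Cm Φ Φ L f) (l : List ℤ) (j : ℤ) (x) :
    tp (Hf Φ Φ h j) l x = Hf Φ Φ (h.tp l) j x := by
  induction l generalizing x with
  | nil => rw [Hf_id Φ _ (fun a => rfl)]; rfl
  | cons a l ih =>
    rw [tp_cons, ih]
    obtain ⟨a, h1, h2, rfl⟩ := k_ind x
    rw [Hf_mk, kmk_smul, kmk_sub, Hf_mk, Hf_mk]
    exact kmk_congr rfl _ _ _ _
lemma Int0 {Φ : Rp τ M} {L : List τ} {f : Module.End ℂ M} (h : Cm Φ Φ L f) (hn : IntA f) (j : ℤ) :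
    IntA (Hf Φ Φ h j) := by
  intro x
  obtain ⟨a, h1, h2, rfl⟩ := k_ind x
  obtain ⟨k, hk⟩ := gr_dir (fun k : List ℤ => tp f k) (fun i1 i2 => ⟨i1 ++ i2, fun u hu => by
    rcases hu with hu | hu
    · rw [tp_append, hu, map_zero]
    · rw [tp_append, tp_comm, hu, map_zero]⟩) hn L j a h1
  refine ⟨k, ?_⟩
  rw [Hf_tp, Hf_mk, kmk_zero_iff (sub_add_cancel j 1)]
  exact ⟨0, zero_mem _, by rw [map_zero, hk]⟩
lemma coneInt (Φ : Rp τ M) (t : τ) (L : List τ) (θ θ' D : Module.End ℂ M) (c' : Cm Φ Φ L θ')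
    (cθ : Cm Φ Φ (t :: L) θ) (cD : Cm Φ Φ L D) (hW : ∀ u, D (Φ (X t) u) = Φ (X t) (D u) + u)
    (e : ∀ u, θ' u = θ u + Φ (X t) (D u)) (hI : ∀ j, IntA (Hf Φ Φ c' j)) (j : ℤ) :
    IntA (Hf Φ Φ cθ j) := by
  have cL := (Cm.cons_iff.1 cθ).2
  have cr := Cm.rho Φ L (X t)
  have cc : Cm Φ Φ L (Φ (X t) ∘ₗ D) := fun s hs a => by
    simp only [cmA]; rw [cD s hs, cr s hs]
  have E : ∀ j y, Hf Φ Φ c' j y = Hf Φ Φ cL j y + Hf Φ Φ cr j (Hf Φ Φ cD j y) := fun j y => by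
    rw [Hf_lin Φ Φ cL cc c' e, Hf_comp Φ Φ Φ cD cr cc (fun a => rfl)]
  intro x
  obtain ⟨l, hl⟩ := hI j (cπ Φ t L j x)
  have k1 : ∀ l y, Hf Φ Φ cr j y = 0 → tp (Hf Φ Φ cL j) (l.map (· + 1)) y = tp (Hf Φ Φ c' j) l y := by
    intro l
    induction l with
    | nil => intro y _; rfl
    | cons a l ih =>
      intro y hy
      have w := Hf_weyl Φ cD cr hW j y
      rw [hy, map_zero] at w
      have e2 : Hf Φ Φ cL j y = Hf Φ Φ c' j y + y := by
        rw [E, add_assoc, ← w, add_zero]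
      have cm : Hf Φ Φ cr j (Hf Φ Φ cL j y) = Hf Φ Φ cL j (Hf Φ Φ cr j y) := by
        have c3 : Cm Φ Φ L (Φ (X t) ∘ₗ θ) := fun s hs a => by
          simp only [cmA]; rw [cL s hs, cr s hs]
        rw [← Hf_comp Φ Φ Φ cL cr c3 (fun a => rfl), ← Hf_comp Φ Φ Φ cr cL c3 (fun a => ?_)]
        exact ((Cm.cons_iff.1 cθ).1 a).symm
      rw [List.map_cons, tp_cons, tp_cons, ih]
      · congr 1; rw [e2]; push_cast; module
      · rw [map_sub, map_smul, cm, hy, map_zero, smul_zero, sub_zero]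
  have hz : Hf Φ Φ cr j (cπ Φ t L j x) = 0 := (cone_exact2 Φ t L j _).2 ⟨x, rfl⟩
  have h0 : cπ Φ t L j (tp (Hf Φ Φ cθ j) (l.map (· + 1)) x) = 0 := by
    rw [tp_F _ (Hf Φ Φ cL j) _ (cπ_nat Φ Φ cθ j), k1 _ _ hz, hl]
  obtain ⟨w, hw⟩ := (cone_exact1 Φ t L (sub_add_cancel j 1) _).1 h0
  obtain ⟨l', hl'⟩ := hI _ w
  refine ⟨l.map (· + 1) ++ l', ?_⟩
  rw [tp_append, ← hw, ← tp_F (Hf Φ Φ c' _), hl', map_zero]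
  intro u
  rw [cι_nat, E, map_add]
  rw [(cone_exact3 Φ t L (sub_add_cancel j 1) _).2 ⟨_, rfl⟩, add_zero]
def thS (Φ : Rp τ M) (D : τ → Module.End ℂ M) (θ0 : Module.End ℂ M) : List τ → Module.End ℂ M
  | [] => θ0
  | t :: bs => thS Φ D θ0 bs - Φ (X t) * D t
lemma thS_cons (Φ : Rp τ M) (D : τ → Module.End ℂ M) (θ0 t bs u) :
  thS Φ D θ0 (t :: bs) u = thS Φ D θ0 bs u - Φ (X t) (D t u) := rfl
lemma conesInt (Φ : Rp τ M) (L0 : List τ) (D : τ → Module.End ℂ M) (θ0 : Module.End ℂ M)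
    (c0 : Cm Φ Φ L0 θ0) (hT : IntA θ0) (bs : List τ) (nd : bs.Nodup)
    (h1 : ∀ t ∈ bs, ∀ u, θ0 (Φ (X t) u) = Φ (X t) (θ0 u) + Φ (X t) u)
    (hD : ∀ t ∈ bs, ∀ s ∈ bs ++ L0, s ≠ t → ∀ u, D t (Φ (X s) u) = Φ (X s) (D t u))
    (hW : ∀ t ∈ bs, ∀ u, D t (Φ (X t) u) = Φ (X t) (D t u) + u)
    (hdis : ∀ t ∈ bs, t ∉ L0) :
    ∃ h : Cm Φ Φ (bs ++ L0) (thS Φ D θ0 bs), ∀ j, IntA (Hf Φ Φ h j) := by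
  induction bs with
  | nil => exact ⟨c0, Int0 c0 hT⟩
  | cons t bs ih =>
    obtain ⟨hn, nd⟩ := List.nodup_cons.1 nd
    obtain ⟨h, hI⟩ := ih nd (fun s hs => h1 s (List.mem_cons_of_mem _ hs))
      (fun s hs r hr => hD s (List.mem_cons_of_mem _ hs) r (List.mem_cons_of_mem _ hr))
      (fun s hs => hW s (List.mem_cons_of_mem _ hs)) (fun s hs => hdis s (List.mem_cons_of_mem _ hs))
    have ht : t ∈ t :: bs := List.mem_cons_self
    have hnt : ∀ s ∈ bs ++ L0, s ≠ t := by
      rintro s hs rfl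
      rcases List.mem_append.1 hs with h | h
      · exact hn h
      · exact hdis s ht h
    have cD : Cm Φ Φ (bs ++ L0) (D t) := fun s hs u =>
      hD t ht s (List.mem_cons_of_mem _ hs) (hnt s hs) u
    have aux : ∀ u, thS Φ D θ0 bs (Φ (X t) u) = Φ (X t) (thS Φ D θ0 bs u) + Φ (X t) u := by
      have : ∀ bs', (∀ s ∈ bs', s ∈ bs) → ∀ u, thS Φ D θ0 bs' (Φ (X t) u) = Φ (X t) (thS Φ D θ0 bs' u) + Φ (X t) u := by
        intro bs'
        induction bs' with
        | nil => intro _ u; exact h1 t ht u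
        | cons s bs' ih' =>
          intro hs u
          have hsb := hs s List.mem_cons_self
          rw [thS_cons, thS_cons, ih' (fun r hr => hs r (List.mem_cons_of_mem _ hr)),
            hD s (List.mem_cons_of_mem _ hsb) t (List.mem_cons_self)
              (hnt s (List.mem_append_left _ hsb)).symm, rp_comm, map_sub]
          abel
      exact this bs (fun _ h => h)
    have c : Cm Φ Φ (t :: (bs ++ L0)) (thS Φ D θ0 (t :: bs)) := by
      rw [Cm.cons_iff]
      constructor
      · intro u
        rw [thS_cons, thS_cons, aux, hW t ht, map_add, map_sub]; abel
      · intro s hs u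
        rw [thS_cons, thS_cons, h s hs, cD s hs, rp_comm, map_sub]
    exact ⟨c, coneInt Φ t _ _ _ (D t) h c cD (hW t ht) (fun u => by rw [thS_cons]; abel) hI⟩
end ci
end SkewLC
end

section
namespace SkewLC
open MvPolynomial
abbrev P2 := PP (ℕ × ℕ)
def ent (i j : ℕ) : P2 := if i < j then X (i,j) else if j < i then -X (j,i) else 0
lemma ent_sk (i j : ℕ) : ent j i = - ent i j := by
  unfold ent; split_ifs <;> first | omega | simp
lemma ent_lt {i j : ℕ} (h : i < j) : ent i j = X (i,j) := by rw [ent, if_pos h]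
lemma ent_self (i : ℕ) : ent i i = 0 := by simp [ent]
def dl (i j : ℕ) : ℂ := if i = j then 1 else 0
lemma dl_self (i : ℕ) : dl i i = 1 := if_pos rfl
lemma dl_comm (i j : ℕ) : dl i j = dl j i := by simp [dl, eq_comm]
lemma dl_ne {i j : ℕ} (h : i ≠ j) : dl i j = 0 := if_neg h
def en (n : ℕ) : P2 →ₐ[ℂ] P2 := aeval (fun p => if p.1 < p.2 ∧ p.2 < n then X p else 0)
lemma en_X (n : ℕ) (p) : en n (X p) = if p.1 < p.2 ∧ p.2 < n then X p else 0 := by simp [en]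
def cm {A : Type*} [Ring A] (a b : A) : A := a * b - b * a
section cm
variable {A : Type*} [Ring A]
lemma cm_mulL (a b c : A) : cm (a * b) c = a * cm b c + cm a c * b := by unfold cm; noncomm_ring
lemma cm_mulR (a b c : A) : cm a (b * c) = cm a b * c + b * cm a c := by unfold cm; noncomm_ring
lemma cm_sumL {ι : Type*} (s : Finset ι) (f : ι → A) (c : A) : cm (∑ i ∈ s, f i) c = ∑ i ∈ s, cm (f i) c := by
  simp only [cm, Finset.sum_mul, Finset.mul_sum, Finset.sum_sub_distrib]
lemma cm_sumR {ι : Type*} (s : Finset ι) (f : ι → A) (c : A) : cm c (∑ i ∈ s, f i) = ∑ i ∈ s, cm c (f i) := by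
  simp only [cm, Finset.sum_mul, Finset.mul_sum, Finset.sum_sub_distrib]
lemma cm_addR (a b c : A) : cm a (b + c) = cm a b + cm a c := by unfold cm; noncomm_ring
lemma cm_subR (a b c : A) : cm a (b - c) = cm a b - cm a c := by unfold cm; noncomm_ring
lemma cm_subL (a b c : A) : cm (a - b) c = cm a c - cm b c := by unfold cm; noncomm_ring
lemma cm_swap (a b : A) : cm a b = - cm b a := by unfold cm; noncomm_ring
end cm
section cls
variable {M : Type} [AddCommGroup M] [Module ℂ M]
lemma cm_app {a b c : Module.End ℂ M} (h : cm a b = c) (u : M) : a (b u) = b (a u) + c u := by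
  rw [← h]; simp [cm]
lemma cm_app0 {a b : Module.End ℂ M} (h : cm a b = 0) (u : M) : a (b u) = b (a u) := by
  rw [cm_app h]; simp
lemma cm_of {a b : Module.End ℂ M} (h : ∀ u, a (b u) = b (a u)) : cm a b = 0 := by
  apply LinearMap.ext; intro u; simp [cm, h]
structure CC (n κ : ℕ) (Φ : Rp (ℕ × ℕ) M) (D : ℕ → ℕ → Module.End ℂ M) (v : M) : Prop where
  out : ∀ p : ℕ × ℕ, ¬ (p.1 < p.2 ∧ p.2 < n) → Φ (X p) = 0
  Dsk : ∀ i j, i < n → j < n → D j i = - D i j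
  DD : ∀ i j k l, i < n → j < n → k < n → l < n → cm (D i j) (D k l) = 0
  DX : ∀ i j k l, i < n → j < n → k < n → l < n →
    cm (D i j) (Φ (ent k l)) = (dl i k * dl j l - dl i l * dl j k) • 1
  v0 : v ≠ 0
  gen : ∀ W : Submodule ℂ M, v ∈ W → (∀ i j, i < n → j < n → ∀ u ∈ W, Φ (ent i j) u ∈ W ∧ D i j u ∈ W) → W = ⊤
  ev : ∀ i l, i < n → l < n → (∑ j ∈ Finset.range n, Φ (ent i j) * D l j) v = (-(2 * κ : ℂ) * dl i l) • v
  tf : ∀ f, en n f ≠ 0 → Function.Injective (Φ f)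
def Eo (Φ : Rp (ℕ × ℕ) M) (D : ℕ → ℕ → Module.End ℂ M) (n i l : ℕ) : Module.End ℂ M :=
  ∑ j ∈ Finset.range n, Φ (ent i j) * D l j
variable {n κ : ℕ} {Φ : Rp (ℕ × ℕ) M} {D : ℕ → ℕ → Module.End ℂ M} {v : M}
lemma cXX (f g : P2) : cm (Φ f) (Φ g) = 0 := by
  rw [cm, ← map_mul, ← map_mul, mul_comm, sub_self]
lemma Xsk (i j : ℕ) : Φ (ent j i) = - Φ (ent i j) := by rw [ent_sk, map_neg]
namespace CC
lemma cEX (h : CC n κ Φ D v) {i l p q : ℕ} (hi : i < n) (hl : l < n) (hp : p < n) (hq : q < n) :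
    cm (Eo Φ D n i l) (Φ (ent p q)) = dl l p • Φ (ent i q) - dl l q • Φ (ent i p) := by
  rw [Eo, cm_sumL]
  have : ∀ j ∈ Finset.range n, cm (Φ (ent i j) * D l j) (Φ (ent p q)) =
      (if j = q then dl l p • Φ (ent i j) else 0) - (if j = p then dl l q • Φ (ent i j) else 0) := by
    intro j hj
    rw [cm_mulL, cXX, zero_mul, add_zero, h.DX _ _ _ _ hl (Finset.mem_range.1 hj) hp hq, mul_smul_comm, mul_one,
      sub_smul]
    unfold dl
    congr 1 <;> split_ifs <;> simp_all
  rw [Finset.sum_congr rfl this, Finset.sum_sub_distrib, Finset.sum_ite_eq', Finset.sum_ite_eq',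
    if_pos (Finset.mem_range.2 hq), if_pos (Finset.mem_range.2 hp)]
lemma cED (h : CC n κ Φ D v) {i l p q : ℕ} (hi : i < n) (hl : l < n) (hp : p < n) (hq : q < n) :
    cm (Eo Φ D n i l) (D p q) = dl q i • D l p - dl p i • D l q := by
  rw [Eo, cm_sumL]
  have : ∀ j ∈ Finset.range n, cm (Φ (ent i j) * D l j) (D p q) =
      (if j = p then dl q i • D l j else 0) - (if j = q then dl p i • D l j else 0) := by
    intro j hj
    have hj := Finset.mem_range.1 hj
    rw [cm_mulL, h.DD _ _ _ _ hl hj hp hq, mul_zero, zero_add, cm_swap, h.DX _ _ _ _ hp hq hi hj, neg_mul,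
      smul_mul_assoc, one_mul, sub_smul, neg_sub, mul_comm (dl p j)]
    congr 1
    · by_cases e : j = p
      · subst e; simp [dl_self]
      · simp [dl_ne (Ne.symm e), e]
    · by_cases e : j = q
      · subst e; simp [dl_self]
      · simp [dl_ne (Ne.symm e), e]
  rw [Finset.sum_congr rfl this, Finset.sum_sub_distrib, Finset.sum_ite_eq', Finset.sum_ite_eq',
    if_pos (Finset.mem_range.2 hq), if_pos (Finset.mem_range.2 hp)]
lemma cEE (h : CC n κ Φ D v) {i l p q : ℕ} (hi : i < n) (hl : l < n) (hp : p < n) (hq : q < n) :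
    cm (Eo Φ D n i l) (Eo Φ D n p q) = dl l p • Eo Φ D n i q - dl q i • Eo Φ D n p l := by
  have e : Eo Φ D n p q = ∑ j ∈ Finset.range n, Φ (ent p j) * D q j := rfl
  conv_lhs => rw [e, cm_sumR]
  have : ∀ j ∈ Finset.range n, cm (Eo Φ D n i l) (Φ (ent p j) * D q j) =
      dl l p • (Φ (ent i j) * D q j) - dl q i • (Φ (ent p j) * D l j) +
      ((if j = i then Φ (ent p j) * D l q else 0) - (if j = l then Φ (ent i p) * D q j else 0)) := by
    intro j hj
    have hj := Finset.mem_range.1 hj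
    rw [cm_mulR, h.cEX hi hl hp hj, h.cED hi hl hq hj]
    have e1 : (if j = i then Φ (ent p j) * D l q else 0) = dl j i • (Φ (ent p j) * D l q) := by
      unfold dl; split_ifs <;> simp
    have e2 : (if j = l then Φ (ent i p) * D q j else 0) = dl l j • (Φ (ent i p) * D q j) := by
      unfold dl; simp only [eq_comm]; split_ifs <;> simp
    rw [e1, e2, sub_mul, mul_sub, smul_mul_assoc, smul_mul_assoc, mul_smul_comm, mul_smul_comm]
    abel
  rw [Finset.sum_congr rfl this, Finset.sum_add_distrib, Finset.sum_sub_distrib, Finset.sum_sub_distrib,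
    Finset.sum_ite_eq', Finset.sum_ite_eq', if_pos (Finset.mem_range.2 hi), if_pos (Finset.mem_range.2 hl),
    ← Finset.smul_sum, ← Finset.smul_sum, h.Dsk l q hl hq, Xsk p i]
  rw [mul_neg, neg_mul, neg_neg, sub_self, add_zero]
  rfl
lemma Ev (h : CC n κ Φ D v) {i l : ℕ} (hi : i < n) (hl : l < n) : Eo Φ D n i l v = (-(2 * κ : ℂ) * dl i l) • v := h.ev i l hi hl
lemma Dself (h : CC n κ Φ D v) {i : ℕ} (hi : i < n) : D i i = 0 := by
  have := h.Dsk i i hi hi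
  apply LinearMap.ext
  intro u
  have e : D i i u = - D i i u := by conv_lhs => { rw [this, ngA] }
  have e2 : (2:ℂ) • D i i u = 0 := by rw [two_smul]; nth_rewrite 1 [e]; simp
  exact (smul_eq_zero.1 e2).resolve_left two_ne_zero
lemma nilE (h : CC n κ Φ D v) {i l : ℕ} (hi : i < n) (hl : l < n) (hil : i ≠ l) : LNil (Eo Φ D n i l) := by
  set T := Eo Φ D n i l with hT
  have key : ∀ Y Z : Module.End ℂ M, cm T Y = Z → cm T Z = 0 → ∀ (k : ℕ) u,
      (T ^ (k+1)) (Y u) = Y ((T ^ (k+1)) u) + ((k:ℂ)+1) • Z ((T ^ k) u) := by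
    intro Y Z h1 h2 k
    induction k with
    | zero => intro u; simp [cm_app h1]
    | succ k ih =>
      intro u
      have e1 : ∀ k w, (T ^ (k+1)) w = T ((T ^ k) w) := fun k w => by rw [pow_succ']; rfl
      rw [e1 (k+1), ih, map_add, map_smul, cm_app h1, cm_app0 h2, e1 (k+1), ← e1 k]
      push_cast
      module
  have st : ∀ Y Z : Module.End ℂ M, cm T Y = Z → cm T Z = 0 → ∀ u, (∃ k, (T ^ k) u = 0) →
      ∃ k, (T ^ k) (Y u) = 0 := by
    rintro Y Z h1 h2 u ⟨k, hk⟩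
    refine ⟨k + 1, ?_⟩
    rw [key Y Z h1 h2, pow_succ', mAp, hk]; simp
  let W : Submodule ℂ M :=
    { carrier := {u | ∃ k, (T ^ k) u = 0}
      add_mem' := by
        rintro a b ⟨k, hk⟩ ⟨k', hk'⟩
        refine ⟨k + k', ?_⟩
        have e1 : (T ^ (k + k')) a = 0 := by
          rw [add_comm k, pow_add, mAp, hk, map_zero]
        have e2 : (T ^ (k + k')) b = 0 := by rw [pow_add, mAp, hk', map_zero]
        rw [map_add, e1, e2, add_zero]
      zero_mem' := ⟨0, by simp⟩
      smul_mem' := by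
        rintro c a ⟨k, hk⟩
        exact ⟨k, by rw [map_smul, hk, smul_zero]⟩ }
  have hW : W = ⊤ := by
    apply h.gen
    · refine ⟨1, ?_⟩
      rw [pow_one, hT, h.Ev hi hl, dl_ne hil]; simp
    · intro p q hp hq u hu
      refine ⟨st _ _ rfl ?_ u hu, st _ _ rfl ?_ u hu⟩
      · have e := dl_ne (Ne.symm hil)
        rw [h.cEX hi hl hp hq, cm_subR]
        have : ∀ (c : ℂ) (a b : Module.End ℂ M), cm a (c • b) = c • cm a b := fun c a b => by
          simp [cm, smul_sub]
        rw [this, this, h.cEX hi hl hi hq, h.cEX hi hl hi hp, e]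
        unfold dl; split_ifs <;> simp_all [ent_self]
      · have e := dl_ne hil
        rw [h.cED hi hl hp hq, cm_subR]
        have : ∀ (c : ℂ) (a b : Module.End ℂ M), cm a (c • b) = c • cm a b := fun c a b => by
          simp [cm, smul_sub]
        have e2 := dl_ne (Ne.symm hil)
        rw [this, this, h.cED hi hl hl hq, h.cED hi hl hl hp, e2]
        unfold dl; split_ifs <;> simp_all [h.Dself hl]
  intro u
  have : u ∈ W := hW ▸ Submodule.mem_top
  exact this
lemma wX (h : CC n κ Φ D v) {i p q : ℕ} (hi : i < n) (hp : p < n) (hq : q < n) :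
    ∃ d : ℤ, cm (Eo Φ D n i i) (Φ (ent p q)) = (d:ℂ) • Φ (ent p q) := by
  rw [h.cEX hi hi hp hq]
  by_cases h1 : i = p <;> by_cases h2 : i = q
  · subst h1; subst h2; exact ⟨0, by simp⟩
  · subst h1; exact ⟨1, by rw [dl_self, dl_ne h2]; simp⟩
  · subst h2; exact ⟨1, by rw [dl_self, dl_ne h1, Xsk p i]; simp⟩
  · exact ⟨0, by rw [dl_ne h1, dl_ne h2]; simp⟩
lemma wD (h : CC n κ Φ D v) {i p q : ℕ} (hi : i < n) (hp : p < n) (hq : q < n) :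
    ∃ d : ℤ, cm (Eo Φ D n i i) (D p q) = (d:ℂ) • D p q := by
  rw [h.cED hi hi hp hq]
  by_cases h1 : p = i <;> by_cases h2 : q = i
  · subst h1; subst h2; exact ⟨0, by simp⟩
  · subst h1; exact ⟨-1, by rw [dl_self, dl_ne h2]; simp⟩
  · subst h2; exact ⟨-1, by rw [dl_self, dl_ne h1, h.Dsk _ _ hp hi]; simp⟩
  · exact ⟨0, by rw [dl_ne h1, dl_ne h2]; simp⟩
lemma intE (h : CC n κ Φ D v) {i : ℕ} (hi : i < n) : IntA (Eo Φ D n i i) := by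
  set T := Eo Φ D n i i with hT
  have st : ∀ (Y : Module.End ℂ M), (∃ d : ℤ, cm T Y = (d:ℂ) • Y) → ∀ u, (∃ l, tp T l u = 0) → ∃ l, tp T l (Y u) = 0 := by
    rintro Y ⟨d, hd⟩ u ⟨l, hl⟩
    refine ⟨l.map (· + d), ?_⟩
    have : ∀ l u, tp T (l.map (· + d)) (Y u) = Y (tp T l u) := by
      intro l
      induction l with
      | nil => intro u; rfl
      | cons a l ih =>
        intro u
        rw [List.map_cons, tp_cons, tp_cons, ← ih, cm_app hd]
        congr 1
        rw [map_sub, map_smul, smA]; push_cast; module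
    rw [this, hl, map_zero]
  let W : Submodule ℂ M :=
    { carrier := {u | ∃ l, tp T l u = 0}
      add_mem' := by
        rintro a b ⟨k, hk⟩ ⟨k', hk'⟩
        refine ⟨k ++ k', ?_⟩
        rw [map_add, tp_append, hk, tp_append, tp_comm, hk']; simp
      zero_mem' := ⟨[], map_zero _⟩
      smul_mem' := by
        rintro c a ⟨k, hk⟩
        exact ⟨k, by rw [map_smul, hk, smul_zero]⟩ }
  have hW : W = ⊤ := by
    apply h.gen
    · refine ⟨[-(2*κ:ℤ)], ?_⟩
      rw [tp_cons, tp_nil, hT, h.Ev hi hi, dl_self]; push_cast; module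
    · intro p q hp hq u hu
      exact ⟨st _ (h.wX hi hp hq) u hu, st _ (h.wD hi hp hq) u hu⟩
  intro u
  have : u ∈ W := hW ▸ Submodule.mem_top
  exact this
lemma genL (h : CC n κ Φ D v) (A0 : Submodule ℂ M) (hv : v ∈ A0)
    (hA : ∀ W : Submodule ℂ M, W ≤ A0 → (∀ i l, i < n → l < n → ∀ u ∈ W, Eo Φ D n i l u ∈ W) →
      ∀ u ∈ W, ∀ p q, p < n → q < n → Φ (ent p q) u ∈ A0 ∧ D p q u ∈ A0) : A0 = ⊤ := by
  let St : Submodule ℂ M → Prop := fun W => ∀ i l, i < n → l < n → ∀ u ∈ W, Eo Φ D n i l u ∈ W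
  let W : Submodule ℂ M := sSup {W | W ≤ A0 ∧ St W}
  have hle : W ≤ A0 := sSup_le fun _ h => h.1
  have hst : St W := by
    intro i l hi hl u hu
    have : W ≤ W.comap (Eo Φ D n i l) := sSup_le fun W' hW' u hu =>
      le_sSup hW' (hW'.2 i l hi hl u hu)
    exact this hu
  have hmax : ∀ W', W' ≤ A0 → St W' → W' ≤ W := fun W' h1 h2 => le_sSup ⟨h1, h2⟩
  let S : Set M := {y | ∃ u ∈ W, ∃ p q, p < n ∧ q < n ∧ (y = Φ (ent p q) u ∨ y = D p q u)}
  have hS : Submodule.span ℂ S ≤ A0 := by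
    rw [Submodule.span_le]
    rintro y ⟨u, hu, p, q, hp, hq, rfl | rfl⟩
    · exact (hA W hle hst u hu p q hp hq).1
    · exact (hA W hle hst u hu p q hp hq).2
  have hS2 : Submodule.span ℂ S ≤ W := by
    apply hmax _ hS
    intro i l hi hl u hu
    have : Submodule.span ℂ S ≤ (Submodule.span ℂ S).comap (Eo Φ D n i l) := by
      rw [Submodule.span_le]
      have sX : ∀ u ∈ W, ∀ p q, p < n → q < n → Φ (ent p q) u ∈ Submodule.span ℂ S := fun u hu p q hp hq =>
        Submodule.subset_span ⟨u, hu, p, q, hp, hq, Or.inl rfl⟩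
      have sD : ∀ u ∈ W, ∀ p q, p < n → q < n → D p q u ∈ Submodule.span ℂ S := fun u hu p q hp hq =>
        Submodule.subset_span ⟨u, hu, p, q, hp, hq, Or.inr rfl⟩
      rintro y ⟨u, hu, p, q, hp, hq, rfl | rfl⟩
      · show Eo Φ D n i l (Φ (ent p q) u) ∈ Submodule.span ℂ S
        rw [cm_app (h.cEX hi hl hp hq)]
        exact add_mem (sX _ (hst i l hi hl u hu) _ _ hp hq) (sub_mem (Submodule.smul_mem _ _ (sX u hu _ _ hi hq))
          (Submodule.smul_mem _ _ (sX u hu _ _ hi hp)))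
      · show Eo Φ D n i l (D p q u) ∈ Submodule.span ℂ S
        rw [cm_app (h.cED hi hl hp hq)]
        exact add_mem (sD _ (hst i l hi hl u hu) _ _ hp hq) (sub_mem (Submodule.smul_mem _ _ (sD u hu _ _ hl hp))
          (Submodule.smul_mem _ _ (sD u hu _ _ hl hq)))
    exact this hu
  have hT : W = ⊤ := by
    apply h.gen
    · refine hmax (Submodule.span ℂ {v}) ?_ ?_ (Submodule.mem_span_singleton_self v)
      · rwa [Submodule.span_singleton_le_iff_mem]
      · intro i l hi hl u hu
        obtain ⟨c, rfl⟩ := Submodule.mem_span_singleton.1 hu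
        rw [map_smul, h.Ev hi hl, smul_smul]
        exact Submodule.smul_mem _ _ (Submodule.mem_span_singleton_self v)
    · intro p q hp hq u hu
      exact ⟨hS2 (Submodule.subset_span ⟨u, hu, p, q, hp, hq, Or.inl rfl⟩),
        hS2 (Submodule.subset_span ⟨u, hu, p, q, hp, hq, Or.inr rfl⟩)⟩
  exact top_le_iff.1 (hT ▸ hle)
end CC
end cls
end SkewLC
end

section
namespace SkewLC
open MvPolynomial
lemma quotLem {τ : Type} {M Q : Type} [AddCommGroup M] [Module ℂ M] [AddCommGroup Q] [Module ℂ Q]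
    (Φ : Rp τ M) (Ψ : Rp τ Q) {L : List τ} {f : Module.End ℂ M} (hf : Cm Φ Φ L f)
    (fi : ∀ u, f u = u → u = 0) (Hi : ∀ j x, Hf Φ Φ hf j x = x → x = 0)
    {q : M →ₗ[ℂ] Q} (hq : Cm Φ Ψ L q) (qs : Function.Surjective q)
    (ex : ∀ u, q u = 0 ↔ ∃ w, f w - w = u) (j : ℤ) :
    Nonempty ((KH Φ L j ⧸ LinearMap.range ((Hf Φ Φ hf j : Module.End ℂ (KH Φ L j)) - 1)) ≃ₗ[ℂ] KH Ψ L j) := by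
  have h1 : Cm Φ Φ L (f - 1) := fun t ht a => by
    simp only [sbA, onA, map_sub, hf t ht]
  have e1 : ∀ j x, Hf Φ Φ h1 j x = Hf Φ Φ hf j x - x := by
    intro j x
    obtain ⟨a, h2, h3, rfl⟩ := k_ind x
    rw [Hf_mk, Hf_mk, kmk_sub]
    apply kmk_congr
    funext w; simp [mapV]
  obtain ⟨δ, hA, hB, hC⟩ := coefLES Φ Φ Ψ h1 hq (by
    rw [inj0]
    intro u hu
    exact fi u (sub_eq_zero.1 hu)) qs (by
    intro u
    rw [ex]; rfl)
  have dz : ∀ j x, δ j x = 0 := by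
    intro j x
    apply Hi (j+1)
    have := (hC j (δ j x)).2 ⟨x, rfl⟩
    rw [e1] at this
    exact sub_eq_zero.1 this
  have sj : Function.Surjective (Hf Φ Ψ hq j) := fun y => (hB j y).1 (dz j y)
  refine ⟨(Submodule.quotEquivOfEq _ _ ?_).trans (LinearMap.quotKerEquivOfSurjective _ sj)⟩
  ext y
  rw [LinearMap.mem_ker, hA j y]
  constructor
  · rintro ⟨x, rfl⟩; exact ⟨x, e1 j x⟩
  · rintro ⟨x, rfl⟩; exact ⟨x, (e1 j x).symm⟩
def b1 (n : ℕ) : List (ℕ × ℕ) := (List.range n).map (fun i => (i, n))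
def b2 (n : ℕ) : List (ℕ × ℕ) := (List.range n).map (fun i => (i, n+1))
def bl (n : ℕ) : List (ℕ × ℕ) := b1 n ++ b2 n
lemma mem_b1 {n : ℕ} {t : ℕ × ℕ} : t ∈ b1 n ↔ t.1 < n ∧ t.2 = n := by
  obtain ⟨a, b⟩ := t; simp [b1]; aesop
lemma mem_b2 {n : ℕ} {t : ℕ × ℕ} : t ∈ b2 n ↔ t.1 < n ∧ t.2 = n+1 := by
  obtain ⟨a, b⟩ := t; simp [b2]; aesop
lemma mem_bl {n : ℕ} {t : ℕ × ℕ} : t ∈ bl n ↔ t.1 < n ∧ (t.2 = n ∨ t.2 = n+1) := by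
  rw [bl, List.mem_append, mem_b1, mem_b2]; tauto
lemma nd_b1 (n : ℕ) : (b1 n).Nodup := List.Nodup.map (fun a b h => by simpa using h) List.nodup_range
lemma nd_b2 (n : ℕ) : (b2 n).Nodup := List.Nodup.map (fun a b h => by simpa using h) List.nodup_range
lemma nd_bl (n : ℕ) : (bl n).Nodup := by
  refine List.Nodup.append (nd_b1 n) (nd_b2 n) ?_
  intro t h1 h2
  rw [mem_b1] at h1; rw [mem_b2] at h2; omega
lemma len_bl (n : ℕ) : ((bl n).length : ℤ) = 2 * n := by simp [bl, b1, b2]; ring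
lemma en_ent {n k l : ℕ} (hk : k < n) (hl : l < n) : en n (ent k l) = ent k l := by
  unfold ent
  split_ifs <;> simp [en_X, *]
section S1
variable {M : Type} [AddCommGroup M] [Module ℂ M]
variable (Φ : Rp (ℕ × ℕ) M) (D : ℕ → ℕ → Module.End ℂ M) (n : ℕ)
abbrev xo : Module.End ℂ M := Φ (X (n, n+1))
abbrev U1 : Submodule ℂ M := LinearMap.range (xo Φ n - 1)
lemma U1_st {f : Module.End ℂ M} (h : ∀ u, f (xo Φ n u) = xo Φ n (f u)) : ∀ u ∈ U1 Φ n, f u ∈ U1 Φ n := by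
  rintro _ ⟨u, rfl⟩
  refine ⟨f u, ?_⟩
  simp only [sbA, onA, map_sub, h]
abbrev Q1 := M ⧸ U1 Φ n
def ΦQ : Rp (ℕ × ℕ) (Q1 Φ n) := rpQ Φ (U1 Φ n) (fun _ => U1_st Φ n (fun _ => rp_comm _ _ _ _))
lemma ΦQ_mk (f u) : ΦQ Φ n f ((U1 Φ n).mkQ u) = (U1 Φ n).mkQ (Φ f u) := rpQ_mk _ _ _ _ _
abbrev KK1 : Submodule ℂ (Q1 Φ n) := ⨆ t ∈ bl n, LinearMap.range (ΦQ Φ n (X t))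
lemma KK1_st {f : Module.End ℂ (Q1 Φ n)} (h : ∀ t ∈ bl n, ∀ u, f (ΦQ Φ n (X t) u) = ΦQ Φ n (X t) (f u)) :
    ∀ u ∈ KK1 Φ n, f u ∈ KK1 Φ n := by
  have : KK1 Φ n ≤ (KK1 Φ n).comap f := by
    refine iSup₂_le fun t ht => ?_
    rintro _ ⟨u, rfl⟩
    rw [Submodule.mem_comap, h t ht]
    exact Submodule.mem_iSup_of_mem t (Submodule.mem_iSup_of_mem ht ⟨_, rfl⟩)
  exact this
abbrev N1 := Q1 Φ n ⧸ KK1 Φ n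
def ΦN : Rp (ℕ × ℕ) (N1 Φ n) := rpQ (ΦQ Φ n) (KK1 Φ n) (fun _ => KK1_st Φ n (fun _ _ _ => rp_comm _ _ _ _))
def Φ1 : Rp (ℕ × ℕ) (N1 Φ n) := (ΦN Φ n).comp (en n)
def p1 : M →ₗ[ℂ] N1 Φ n := (KK1 Φ n).mkQ ∘ₗ (U1 Φ n).mkQ
lemma p1_surj : Function.Surjective (p1 Φ n) :=
  (mkS _).comp (mkS _)
lemma p1_Φ (f u) : ΦN Φ n f (p1 Φ n u) = p1 Φ n (Φ f u) := by
  simp only [p1, cmA]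
  rw [← ΦQ_mk]; exact rpQ_mk _ _ _ _ _
lemma p1_b {t} (ht : t ∈ bl n) (u) : p1 Φ n (Φ (X t) u) = 0 := by
  simp only [p1, cmA]
  rw [← ΦQ_mk, Submodule.mkQ_apply, qz]
  exact Submodule.mem_iSup_of_mem t (Submodule.mem_iSup_of_mem ht ⟨_, rfl⟩)
lemma q_x (u) : (U1 Φ n).mkQ (xo Φ n u) = (U1 Φ n).mkQ u := by
  rw [← sub_eq_zero, ← map_sub, Submodule.mkQ_apply, qz]
  exact ⟨u, rfl⟩
lemma p1_x (u) : p1 Φ n (xo Φ n u) = p1 Φ n u := by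
  simp only [p1, cmA, q_x]
def D1 (a b : ℕ) : Module.End ℂ (N1 Φ n) := qop (KK1 Φ n) (qop (U1 Φ n) (D a b))
lemma p1_ent {k l : ℕ} (hk : k < n) (hl : l < n) (u) : Φ1 Φ n (ent k l) (p1 Φ n u) = p1 Φ n (Φ (ent k l) u) := by
  rw [Φ1, AlgHom.comp_apply, en_ent hk hl, p1_Φ]
lemma p1_bent {k l : ℕ} (hk : k < n) (hl : n ≤ l) (hl2 : l < n + 2) (u) : p1 Φ n (Φ (ent k l) u) = 0 := by
  rw [ent_lt ω]
  exact p1_b Φ n (mem_bl.2 ⟨hk, by simp only; omega⟩) u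
lemma p1_bent' {k l : ℕ} (hk : k < n) (hl : n ≤ l) (hl2 : l < n + 2) (u) : p1 Φ n (Φ (ent l k) u) = 0 := by
  rw [Xsk k l, ngA, map_neg, p1_bent Φ n hk hl hl2, neg_zero]
variable {Φ D n} {κ : ℕ} {v : M} (h : CC (n+2) κ Φ D v)
lemma D_x (h : CC (n+2) κ Φ D v) {a b : ℕ} (ha : a < n) (hb : b < n) (u) : D a b (xo Φ n u) = xo Φ n (D a b u) := by
  have := h.DX a b n (n+1) ω ω ω ω
  rw [ent_lt ω, dl_ne ω, dl_ne (show a ≠ n+1 by omega)] at this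
  exact cm_app0 (by simpa using this) u
lemma D_b (h : CC (n+2) κ Φ D v) {a b : ℕ} (ha : a < n) (hb : b < n) {t} (ht : t ∈ bl n) (u) :
    D a b (Φ (X t) u) = Φ (X t) (D a b u) := by
  rw [mem_bl] at ht
  have := h.DX a b t.1 t.2 ω ω ω ω
  rw [ent_lt ω, dl_ne (show b ≠ t.2 by omega), dl_ne (show a ≠ t.2 by omega)] at this
  exact cm_app0 (by simpa using this) u
lemma p1_D (h : CC (n+2) κ Φ D v) {a b : ℕ} (ha : a < n) (hb : b < n) (u) :
    D1 Φ D n a b (p1 Φ n u) = p1 Φ n (D a b u) := by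
  have e := qop_mk (U1_st Φ n (D_x h ha hb))
  simp only [p1, cmA, D1]
  rw [qop_mk, e]
  apply KK1_st
  intro t ht w
  obtain ⟨w, rfl⟩ := mkS _ w
  rw [ΦQ_mk, e, e, ΦQ_mk, D_b h ha hb ht]
lemma p1_En {l : ℕ} (u) : p1 Φ n (Eo Φ D (n+2) n l u) = p1 Φ n (D l (n+1) u) := by
  rw [Eo, srS, srS, ent_self, map_zero, zero_mul, add_zero,
    adA, LinearMap.sum_apply, map_add, map_sum, ent_lt ω, mAp, p1_x,
    Finset.sum_eq_zero, zero_add]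
  intro j hj
  exact p1_bent' Φ n (Finset.mem_range.1 hj) le_rfl ω _
lemma p1_En1 {l : ℕ} (u) : p1 Φ n (Eo Φ D (n+2) (n+1) l u) = - p1 Φ n (D l n u) := by
  rw [Eo, srS, srS, ent_self, map_zero, zero_mul, add_zero,
    adA, LinearMap.sum_apply, map_add, map_sum, Xsk n (n+1), ent_lt ω, mAp,
    ngA, map_neg, p1_x,
    Finset.sum_eq_zero, zero_add]
  intro j hj
  exact p1_bent' Φ n (Finset.mem_range.1 hj) ω ω _
def Dt (Φ : Rp (ℕ × ℕ) M) (D : ℕ → ℕ → Module.End ℂ M) (n : ℕ) (t : ℕ × ℕ) : Module.End ℂ M :=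
  if t.2 = n then - Eo Φ D (n+2) (n+1) t.1 else Eo Φ D (n+2) n t.1
lemma LNil_neg {H : Type*} [AddCommGroup H] [Module ℂ H] {T : Module.End ℂ H} (hT : LNil T) : LNil (-T) := by
  intro u
  obtain ⟨k, hk⟩ := hT u
  refine ⟨k, ?_⟩
  rw [neg_pow, mAp, hk, map_zero]
lemma Dt_x (h : CC (n+2) κ Φ D v) {t} (ht : t ∈ bl n) (u) : Dt Φ D n t (xo Φ n u) = xo Φ n (Dt Φ D n t u) := by
  rw [mem_bl] at ht
  have e : ∀ i, i = n ∨ i = n+1 → cm (Eo Φ D (n+2) i t.1) (xo Φ n) = 0 := by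
    intro i hi
    have := h.cEX (i := i) (l := t.1) (p := n) (q := n+1) ω ω ω ω
    rw [ent_lt ω, dl_ne ω, dl_ne ω] at this
    simpa using this
  unfold Dt
  split_ifs
  · rw [ngA, ngA, map_neg, cm_app0 (e _ (Or.inr rfl))]
  · exact cm_app0 (e _ (Or.inl rfl)) u
lemma Dt_nil (h : CC (n+2) κ Φ D v) {t} (ht : t ∈ bl n) : LNil (Dt Φ D n t) := by
  rw [mem_bl] at ht
  unfold Dt
  split_ifs
  · exact LNil_neg (h.nilE ω ω ω)
  · exact h.nilE ω ω ω
lemma Dt_comm (h : CC (n+2) κ Φ D v) {t s} (ht : t ∈ bl n) (hs : s ∈ bl n) (u) :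
    Dt Φ D n t (Dt Φ D n s u) = Dt Φ D n s (Dt Φ D n t u) := by
  rw [mem_bl] at ht hs
  have e : ∀ i p, (i = n ∨ i = n+1) → (p = n ∨ p = n+1) → cm (Eo Φ D (n+2) i t.1) (Eo Φ D (n+2) p s.1) = 0 := by
    intro i p hi hp
    rw [h.cEE ω ω ω ω, dl_ne ω, dl_ne ω]
    simp
  unfold Dt
  split_ifs <;> (try simp only [ngA, map_neg]) <;>
  rw [cm_app0 (e _ _ (by simp) (by simp))]
lemma Dt_X (h : CC (n+2) κ Φ D v) {t s} (ht : t ∈ bl n) (hs : s ∈ bl n) (u) :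
    Dt Φ D n t (Φ (X s) u) = Φ (X s) (Dt Φ D n t u) + if s = t then xo Φ n u else 0 := by
  rw [mem_bl] at ht hs
  have e : ∀ i, (i = n ∨ i = n+1) → cm (Eo Φ D (n+2) i t.1) (Φ (X s)) = dl t.1 s.1 • Φ (ent i s.2) := by
    intro i hi
    have := h.cEX (i := i) (l := t.1) (p := s.1) (q := s.2) ω ω ω ω
    rwa [ent_lt (show s.1 < s.2 by omega), dl_ne (show t.1 ≠ s.2 by omega), zero_smul, sub_zero] at this
  obtain ⟨t1, t2⟩ := t
  obtain ⟨s1, s2⟩ := s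
  simp only at ht hs e
  have e0 : Φ (ent (n+1) n) = - xo Φ n := by rw [Xsk n (n+1), ent_lt ω]
  have e1 : Φ (ent n (n+1)) = xo Φ n := by rw [ent_lt ω]
  unfold Dt
  by_cases h1 : t1 = s1
  · subst h1
    rcases ht.2 with rfl | rfl <;> rcases hs.2 with rfl | rfl
    · simp [cm_app (e _ (Or.inr rfl)), e0, dl_self]; abel
    · simp [cm_app (e _ (Or.inr rfl)), ent_self]
    · simp [cm_app (e _ (Or.inl rfl)), ent_self]
    · simp [cm_app (e _ (Or.inl rfl)), e1, dl_self]
  · rw [if_neg (show ¬ ((s1, s2) = (t1, t2)) by simp; intro h; exact absurd h.symm h1)]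
    split_ifs
    · simp [cm_app (e _ (Or.inr rfl)), dl_ne h1]
    · simp [cm_app (e _ (Or.inl rfl)), dl_ne h1]
lemma Dt_v (h : CC (n+2) κ Φ D v) {t} (ht : t ∈ bl n) : Dt Φ D n t v = 0 := by
  rw [mem_bl] at ht
  unfold Dt
  split_ifs
  · rw [ngA, h.Ev ω ω, dl_ne ω]; simp
  · rw [h.Ev ω ω, dl_ne ω]; simp
lemma S1_W (h : CC (n+2) κ Φ D v) (L : List (ℕ × ℕ)) (hL : ∀ t ∈ L, t.1 < t.2 ∧ t.2 < n) :
    (∀ i j : ℤ, i + (bl n).length = j → Nonempty (KH (ΦQ Φ n) (bl n ++ L) j ≃ₗ[ℂ] KH (Φ1 Φ n) L i)) ∧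
    (∀ w : N1 Φ n, ∃ u, (KK1 Φ n).mkQ u = w ∧ ∀ t ∈ bl n, qop (U1 Φ n) (Dt Φ D n t) u = 0) ∧
    (∀ u, (KK1 Φ n).mkQ u = 0 → (∀ t ∈ bl n, qop (U1 Φ n) (Dt Φ D n t) u = 0) → u = 0) := by
  have e : ∀ {t}, t ∈ bl n → ∀ u, qop (U1 Φ n) (Dt Φ D n t) ((U1 Φ n).mkQ u) = (U1 Φ n).mkQ (Dt Φ D n t u) :=
    fun ht => qop_mk (U1_st Φ n (Dt_x h ht))
  have sj := mkS (U1 Φ n)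
  apply lemW (Φ1 Φ n) L (bl n) (nd_bl n) (ΦQ Φ n) _ (KK1 Φ n).mkQ
  · intro t ht s hs hst u
    obtain ⟨u, rfl⟩ := sj u
    rw [ΦQ_mk, e ht, e ht, ΦQ_mk, Dt_X h ht hs, if_neg hst, add_zero]
  · intro t ht u
    obtain ⟨u, rfl⟩ := sj u
    rw [ΦQ_mk, e ht, e ht, ΦQ_mk, Dt_X h ht ht, if_pos rfl, map_add, q_x]
  · intro t ht
    exact LNil_surj _ sj _ _ (fun u => (e ht u).symm) (Dt_nil h ht)
  · intro t ht s hs u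
    obtain ⟨u, rfl⟩ := sj u
    rw [e hs, e ht, e ht, e hs, Dt_comm h ht hs]
  · exact mkS _
  · intro t ht u
    rw [Submodule.mkQ_apply, qz]
    exact Submodule.mem_iSup_of_mem t (Submodule.mem_iSup_of_mem ht ⟨_, rfl⟩)
  · intro u hu
    rwa [Submodule.mkQ_apply, qz] at hu
  · intro t ht u
    rw [Φ1, AlgHom.comp_apply, en_X, if_pos (hL t ht)]
    exact (rpQ_mk _ _ _ _ _).symm
end S1
end SkewLC
end

section
namespace SkewLC
open MvPolynomial
def zh (n i j : ℕ) : P2 := X (n, n+1) * ent i j - (ent i n * ent j (n+1) - ent i (n+1) * ent j n)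
def evz (n : ℕ) : P2 →ₐ[ℂ] P2 := aeval (fun p => if p.1 < p.2 ∧ p.2 < n then zh n p.1 p.2 else 0)
lemma evz_X (n p) : evz n (X p) = if p.1 < p.2 ∧ p.2 < n then zh n p.1 p.2 else 0 := by simp [evz]
def t0 (n : ℕ) : P2 →ₐ[ℂ] P2 := aeval (fun p => if p = (n,n+1) then 1 else if p.1 < p.2 ∧ p.2 < n then X p else 0)
lemma t0_X (n p) : t0 n (X p) = if p = (n,n+1) then 1 else if p.1 < p.2 ∧ p.2 < n then X p else 0 := by simp [t0]
lemma t0_b {n t} (ht : t ∈ bl n) : t0 n (X t) = 0 := by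
  rw [mem_bl] at ht
  rw [t0_X, if_neg (by rintro rfl; simp at ht), if_neg ω]
lemma t0_evz (n f) : t0 n (evz n f) = en n f := by
  have : (t0 n).comp (evz n) = en n := by
    apply MvPolynomial.algHom_ext
    rintro ⟨i, j⟩
    rw [AlgHom.comp_apply, evz_X, en_X]
    split_ifs with h
    · simp only at h
      simp only [zh]
      rw [ent_lt h.1, ent_lt (show i < n by omega), ent_lt (show i < n+1 by omega)]
      simp only [map_sub, map_mul]
      rw [t0_b (t := (i,n)) (mem_bl.2 (by simp; omega)), t0_b (t := (i,n+1)) (mem_bl.2 (by simp; omega)),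
        t0_X, if_pos rfl, t0_X, if_neg (by simp; omega), if_pos h]
      ring
    · simp
  rw [← this]; rfl
lemma t0_en (n f) : t0 n (en (n+2) f) = t0 n f := by
  have : (t0 n).comp (en (n+2)) = t0 n := by
    apply MvPolynomial.algHom_ext
    rintro ⟨i, j⟩
    rw [AlgHom.comp_apply, en_X]
    split_ifs with h
    · rfl
    · rw [t0_X, if_neg, if_neg, map_zero]
      · simp only at h ⊢; omega
      · rintro h2; rw [Prod.mk.injEq] at h2; simp only at h; omega
  conv_rhs => rw [← this]
  rfl
section S1
variable {M : Type} [AddCommGroup M] [Module ℂ M]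
variable {Φ : Rp (ℕ × ℕ) M} {D : ℕ → ℕ → Module.End ℂ M} {n : ℕ}
variable {κ : ℕ} {v : M}
lemma CC.cEX' (h : CC n κ Φ D v) {i l p q : ℕ} (hi : i < n) (hl : l < n) (hp : p < n) (hq : q < n) :
    cm (Eo Φ D n i l) (Φ (ent p q)) = Φ (dl l p • ent i q - dl l q • ent i p) := by
  rw [h.cEX hi hl hp hq, map_sub, map_smul, map_smul]
lemma cm_poly {E : Module.End ℂ M} {f g f' g' : P2} (h1 : cm E (Φ f) = Φ f') (h2 : cm E (Φ g) = Φ g') :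
    cm E (Φ (f * g)) = Φ (f' * g + f * g') := by
  rw [map_mul, cm_mulR, h1, h2, map_add, map_mul, map_mul]
lemma cm_polys {E : Module.End ℂ M} {f g f' g' : P2} (h1 : cm E (Φ f) = Φ f') (h2 : cm E (Φ g) = Φ g') :
    cm E (Φ (f - g)) = Φ (f' - g') := by
  rw [map_sub, cm_subR, h1, h2, map_sub]
lemma cm_zh (h : CC (n+2) κ Φ D v) {a l i j : ℕ} (ha : a = n ∨ a = n+1) (hl : l < n) (hi : i < n) (hj : j < n) :
    cm (Eo Φ D (n+2) a l) (Φ (zh n i j)) = 0 := by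
  have e := fun {p q : ℕ} (hp : p < n+2) (hq : q < n+2) => h.cEX' (i := a) (l := l) ω ω hp hq
  have ex := e (p := n) (q := n+1) ω ω
  rw [ent_lt ω] at ex
  rw [zh, cm_polys (cm_poly ex (e (p := i) (q := j) ω ω))
    (cm_polys (cm_poly (e (p := i) (q := n) ω ω) (e (p := j) (q := n+1) ω ω))
      (cm_poly (e (p := i) (q := n+1) ω ω) (e (p := j) (q := n) ω ω)))]
  rw [dl_ne (show l ≠ n by omega), dl_ne (show l ≠ n+1 by omega)]
  convert map_zero Φ
  have e1 : (X (n, n+1) : P2) = ent n (n+1) := (ent_lt ω).symm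
  rw [e1]
  simp only [zero_smul, sub_zero, smul_eq_C_mul]
  rcases ha with rfl | rfl
  · rw [ent_self, ent_sk i a, ent_sk j a]; ring
  · rw [ent_self, ent_sk i (n+1), ent_sk j (n+1), ent_sk n (n+1)]; ring
lemma Dt_evz (h : CC (n+2) κ Φ D v) {t} (ht : t ∈ bl n) (f : P2) (u : M) :
    Dt Φ D n t (Φ (evz n f) u) = Φ (evz n f) (Dt Φ D n t u) := by
  rw [mem_bl] at ht
  have e : ∀ a, a = n ∨ a = n+1 → cm (Eo Φ D (n+2) a t.1) (Φ (evz n f)) = 0 := by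
    intro a ha
    induction f using MvPolynomial.induction_on with
    | C c =>
      rw [← MvPolynomial.algebraMap_eq, AlgHom.commutes, AlgHom.commutes, cm]
      rw [Algebra.commutes, sub_self]
    | add f g hf hg => rw [map_add, map_add, cm_addR, hf, hg, add_zero]
    | mul_X f p hf =>
      rw [map_mul, map_mul, cm_mulR, hf, zero_mul, zero_add, evz_X]
      split_ifs with hp
      · rw [cm_zh h ha ht.1 ω ω, mul_zero]
      · simp [cm]
  unfold Dt
  split_ifs
  · rw [ngA, ngA, map_neg, cm_app0 (e _ (Or.inr rfl))]
  · exact cm_app0 (e _ (Or.inl rfl)) u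
def Wt (Φ : Rp (ℕ × ℕ) M) (T : Module.End ℂ M) (d : ℕ) (f : P2) : Prop := cm T (Φ f) = Φ ((d:ℂ) • f)
lemma Wt.mul {T : Module.End ℂ M} {d e : ℕ} {f g : P2} (hf : Wt Φ T d f) (hg : Wt Φ T e g) :
    Wt Φ T (d+e) (f * g) := by
  rw [Wt, cm_poly hf hg]; congr 1
  simp only [smul_eq_C_mul]; push_cast; simp only [map_add]; ring
lemma Wt.pow {T : Module.End ℂ M} {f : P2} (hf : Wt Φ T 1 f) (k : ℕ) : Wt Φ T k (f ^ k) := by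
  induction k with
  | zero => simp [Wt, cm]
  | succ k ih => rw [pow_succ]; exact ih.mul hf
lemma Wt.add {T : Module.End ℂ M} {d : ℕ} {f g : P2} (hf : Wt Φ T d f) (hg : Wt Φ T d g) :
    Wt Φ T d (f + g) := by
  unfold Wt at *
  rw [map_add, cm_addR, hf, hg, smul_add, map_add]
lemma Wt.sub {T : Module.End ℂ M} {d : ℕ} {f g : P2} (hf : Wt Φ T d f) (hg : Wt Φ T d g) :
    Wt Φ T d (f - g) := cm_polys hf hg |>.trans (by rw [smul_sub])
lemma wt_ent1 (h : CC (n+2) κ Φ D v) {p : ℕ} (hp : p < n + 2) (hp2 : p ≠ n) :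
    Wt Φ (Eo Φ D (n+2) n n) 1 (ent p n) := by
  rw [Wt, h.cEX' ω ω hp ω, dl_self, dl_ne (Ne.symm hp2)]
  rw [ent_sk p n]; simp
lemma wt_ent1' (h : CC (n+2) κ Φ D v) {p : ℕ} (hp : p < n + 2) (hp2 : p ≠ n) :
    Wt Φ (Eo Φ D (n+2) n n) 1 (ent n p) := by
  rw [Wt, h.cEX' ω ω ω hp, dl_self, dl_ne (Ne.symm hp2)]
  simp
lemma wt_ent0 (h : CC (n+2) κ Φ D v) {p q : ℕ} (hp : p < n + 2) (hp2 : p ≠ n) (hq : q < n + 2) (hq2 : q ≠ n) :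
    Wt Φ (Eo Φ D (n+2) n n) 0 (ent p q) := by
  rw [Wt, h.cEX' ω ω hp hq, dl_ne (Ne.symm hp2), dl_ne (Ne.symm hq2)]
  simp
lemma wt_x (h : CC (n+2) κ Φ D v) : Wt Φ (Eo Φ D (n+2) n n) 1 (X (n, n+1)) := by
  rw [← ent_lt ω]; exact wt_ent1' h ω ω
lemma wt_zh (h : CC (n+2) κ Φ D v) {i j : ℕ} (hi : i < n) (hj : j < n) : Wt Φ (Eo Φ D (n+2) n n) 1 (zh n i j) := by
  refine ((wt_x h).mul (wt_ent0 h ω ω ω ω)).sub (Wt.sub ?_ ?_)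
  · exact (wt_ent1 h ω ω).mul (wt_ent0 h ω ω ω ω)
  · have := (wt_ent0 h (p := i) (q := n+1) ω ω ω ω).mul (wt_ent1 h (p := j) ω ω)
    simpa using this
lemma homog (h : CC (n+2) κ Φ D v) (f : P2) : ∃ (g : P2) (d : ℕ), Wt Φ (Eo Φ D (n+2) n n) d g ∧
    ∃ r, evz n f - g = (X (n,n+1) - 1) * r := by
  have pw : ∀ d : ℕ, ∃ r : P2, (X (n,n+1)) ^ d - 1 = (X (n,n+1) - 1) * r := fun d => by
    obtain ⟨r, hr⟩ := sub_dvd_pow_sub_pow (X (n,n+1) : P2) 1 d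
    exact ⟨r, by rw [← hr, one_pow]⟩
  induction f using MvPolynomial.induction_on with
  | C c =>
    refine ⟨C c, 0, ?_, 0, ?_⟩
    · rw [Wt, ← MvPolynomial.algebraMap_eq, AlgHom.commutes, cm, Algebra.commutes]; simp
    · rw [← MvPolynomial.algebraMap_eq, AlgHom.commutes]; simp
  | add f g hf hg =>
    obtain ⟨f1, d, hd, r, hr⟩ := hf
    obtain ⟨g1, e, he, s, hs⟩ := hg
    obtain ⟨a, ha⟩ := pw d
    obtain ⟨b, hb⟩ := pw e
    refine ⟨f1 * X (n,n+1) ^ e + X (n,n+1) ^ d * g1, d + e, (hd.mul ((wt_x h).pow e)).add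
      (((wt_x h).pow d).mul he), r + s - f1 * b - g1 * a, ?_⟩
    rw [map_add]
    linear_combination hr + hs - f1 * hb - g1 * ha
  | mul_X f p hf =>
    obtain ⟨f1, d, hd, r, hr⟩ := hf
    by_cases hp : p.1 < p.2 ∧ p.2 < n
    · refine ⟨f1 * zh n p.1 p.2, d + 1, hd.mul (wt_zh h ω ω), r * zh n p.1 p.2, ?_⟩
      rw [map_mul, evz_X, if_pos hp]
      linear_combination (zh n p.1 p.2) * hr
    · refine ⟨0, 0, by simp [Wt, cm], 0, ?_⟩
      rw [map_mul, evz_X, if_neg hp]; simp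
lemma S1_gr (h : CC (n+2) κ Φ D v) : ∃ π : ℤ → Module.End ℂ M, GrOK π ∧
    (∀ a u, xo Φ n (π a u) = π (a+1) (xo Φ n u)) ∧
    π (-(2*κ:ℤ)) v = v ∧
    (∀ (f : Module.End ℂ M) (d : ℤ), cm (Eo Φ D (n+2) n n) f = (d:ℂ) • f → ∀ a u, f (π a u) = π (a+d) (f u)) := by
  obtain ⟨π, g, -, h2, h3⟩ := IntA_grad _ (h.intE (i := n) ω)
  have hx := wt_x h
  refine ⟨π, g, h3 _ 1 fun u => ?_, ?_, fun f d hd => h3 _ d fun u => ?_⟩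
  · rw [cm_app hx]; simp
  · rw [h2 (-(2*κ:ℤ)) _ 1 v, if_pos rfl]
    rw [pow_one, sbA, h.Ev ω ω, dl_self]; push_cast
    simp
  · rw [cm_app hd]; rfl
lemma x_inj (h : CC (n+2) κ Φ D v) : Function.Injective (xo Φ n) := by
  apply h.tf
  rw [en_X, if_pos (by simp)]
  exact X_ne_zero _
lemma xpow_inj (h : CC (n+2) κ Φ D v) {N : ℕ} {u : M} (e : ((xo Φ n) ^ N) u = 0) : u = 0 := by
  induction N with
  | zero => simpa using e
  | succ k ih =>
    rw [pow_succ', mAp] at e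
    exact ih (x_inj h (by rw [e, map_zero]))
lemma mem_U1_hom (h : CC (n+2) κ Φ D v) {π : ℤ → Module.End ℂ M} (g : GrOK π)
    (hf : ∀ a u, xo Φ n (π a u) = π (a+1) (xo Φ n u)) {c : ℤ} {y : M} (hy : π c y = y)
    (e : (U1 Φ n).mkQ y = 0) : y = 0 := by
  rw [Submodule.mkQ_apply, qz] at e
  obtain ⟨u, hu⟩ := e
  obtain ⟨N, hN⟩ := g2 g hf c y u hy hu
  exact xpow_inj h hN
lemma S1_tf (h : CC (n+2) κ Φ D v) (f : P2) (hf : en n f ≠ 0) : Function.Injective (Φ1 Φ n f) := by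
  rw [inj0]
  intro w hw
  obtain ⟨-, w2, w3⟩ := S1_W h [] (by simp)
  obtain ⟨π, g, gx, -, gf⟩ := S1_gr h
  have qs := fun {t} ht => qop_mk (U1_st Φ n (Dt_x (t := t) h ht))
  obtain ⟨u, rfl, hu⟩ := w2 w
  obtain ⟨u, rfl⟩ := mkS _ u
  obtain ⟨c, u', -, hu', huu⟩ := g3 g gx 0 u
  have e1 : (U1 Φ n).mkQ u = (U1 Φ n).mkQ u' := by
    rw [← sub_eq_zero, ← map_sub, Submodule.mkQ_apply, qz]; exact huu
  rw [e1] at hw hu ⊢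
  obtain ⟨F, d, hF, r, hr⟩ := homog h f
  have e2 : (U1 Φ n).mkQ (Φ F u') = (U1 Φ n).mkQ (Φ (evz n f) u') := by
    rw [← sub_eq_zero, ← map_sub, Submodule.mkQ_apply, qz, ← neg_mem_iff, neg_sub]
    refine ⟨Φ r u', ?_⟩
    rw [← sbA, ← map_sub, hr, map_mul, map_sub, map_one]; rfl
  have e3 : ∀ f w, ΦN Φ n (evz n f) w = Φ1 Φ n f w := by
    intro f
    induction f using MvPolynomial.induction_on with
    | C c => intro w; rw [← MvPolynomial.algebraMap_eq, AlgHom.commutes, AlgHom.commutes, AlgHom.commutes]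
    | add f g hf hg => intro w; simp only [map_add, adA, hf, hg]
    | mul_X f p hf =>
      intro w
      rw [map_mul, map_mul, map_mul, mAp, mAp, hf]
      congr 1
      rw [evz_X, Φ1, AlgHom.comp_apply, en_X]
      split_ifs with hp
      · obtain ⟨w, rfl⟩ := p1_surj Φ n w
        rw [p1_Φ, p1_Φ, zh, map_sub, map_sub, sbA, sbA, map_sub, map_sub, map_mul,
          map_mul, map_mul, mAp, mAp, mAp, p1_bent Φ n ω ω ω,
          p1_bent Φ n ω ω ω, p1_x, ent_lt hp.1]
        simp
      · rfl
  have e4 : (U1 Φ n).mkQ (Φ F u') = 0 := by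
    apply w3
    · rw [e2]
      have := p1_Φ Φ n (evz n f) u'
      rw [e3] at this
      exact this.symm.trans hw
    · intro t ht
      rw [e2, qs ht, Dt_evz h ht, ← ΦQ_mk, ← qs ht, hu t ht, map_zero]
  have e5 : Φ F u' = 0 := by
    refine mem_U1_hom h g gx (c := c + d) ?_ e4
    have := gf (Φ F) d (by rw [hF, map_smul]; push_cast; rfl) c u'
    rw [hu'] at this; exact this.symm
  have e6 : en (n+2) F ≠ 0 := by
    intro h0
    apply hf
    have := congrArg (t0 n) hr
    rw [map_sub, t0_evz, ← t0_en n F, h0, map_zero, sub_zero, map_mul, map_sub, t0_X, if_pos rfl, map_one, sub_self,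
      zero_mul] at this
    exact this
  have e7 : u' = 0 := h.tf F e6 (by rw [e5, map_zero])
  rw [e7, map_zero, map_zero]
lemma S1_v (h : CC (n+2) κ Φ D v) : p1 Φ n v ≠ 0 := by
  intro h0
  obtain ⟨-, -, w3⟩ := S1_W h [] (by simp)
  obtain ⟨π, g, gx, gv, -⟩ := S1_gr h
  have qs := fun {t} ht => qop_mk (U1_st Φ n (Dt_x (t := t) h ht))
  refine h.v0 (mem_U1_hom h g gx gv (w3 _ h0 fun t ht => ?_))
  rw [qs ht, Dt_v h ht, map_zero]
lemma S1_CC (h : CC (n+2) κ Φ D v) : CC n κ (Φ1 Φ n) (D1 Φ D n) (p1 Φ n v) where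
  out p hp := by rw [Φ1, AlgHom.comp_apply, en_X, if_neg hp, map_zero]
  Dsk i j hi hj := by
    apply LinearMap.ext; intro w
    obtain ⟨u, rfl⟩ := p1_surj Φ n w
    rw [ngA, p1_D h hj hi, p1_D h hi hj, h.Dsk i j ω ω]; simp
  DD i j k l hi hj hk hl := by
    apply cm_of; intro w
    obtain ⟨u, rfl⟩ := p1_surj Φ n w
    rw [p1_D h hk hl, p1_D h hi hj, p1_D h hi hj, p1_D h hk hl,
      cm_app0 (h.DD _ _ _ _ ω ω ω ω)]
  DX i j k l hi hj hk hl := by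
    apply LinearMap.ext; intro w
    obtain ⟨u, rfl⟩ := p1_surj Φ n w
    simp only [cm, sbA, mAp]
    rw [p1_ent Φ n hk hl, p1_D h hi hj, p1_D h hi hj, p1_ent Φ n hk hl,
      cm_app (h.DX i j k l ω ω ω ω)]
    simp
  v0 := S1_v h
  gen W hv hW := by
    have key : W.comap (p1 Φ n) = ⊤ := by
      apply h.genL _ hv
      intro W' hW' hE u hu
      have u0 : p1 Φ n u ∈ W := hW' hu
      have dl1 : ∀ l, l < n+2 → p1 Φ n (D l (n+1) u) ∈ W := fun l hl => by
        rw [← p1_En (Φ := Φ) (D := D)]; exact hW' (hE n l ω hl u hu)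
      have dl2 : ∀ l, l < n+2 → p1 Φ n (D l n u) ∈ W := fun l hl => by
        rw [← neg_mem_iff, ← p1_En1 (Φ := Φ) (D := D)]; exact hW' (hE (n+1) l ω hl u hu)
      intro p q hp hq
      simp only [Submodule.mem_comap]
      constructor
      · rcases lt_trichotomy p q with hpq | rfl | hpq
        · by_cases hqn : q < n
          · rw [← p1_ent Φ n ω hqn]; exact (hW p q ω hqn _ u0).1
          · by_cases hpn : p < n
            · rw [p1_bent Φ n hpn ω hq]; exact zero_mem _
            · obtain rfl : p = n := by omega
              obtain rfl : q = p+1 := by omega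
              rw [ent_lt hpq, p1_x]; exact u0
        · rw [ent_self]; simp
        · by_cases hqn : p < n
          · rw [← p1_ent Φ n hqn ω]; exact (hW p q hqn ω _ u0).1
          · by_cases hpn : q < n
            · rw [p1_bent' Φ n hpn ω hp]; exact zero_mem _
            · obtain rfl : q = n := by omega
              obtain rfl : p = q+1 := by omega
              rw [Xsk q, ngA, map_neg, ent_lt hpq, p1_x, neg_mem_iff]; exact u0
      · have d3 : ∀ l q, l < n+2 → q < n+2 → n ≤ q → p1 Φ n (D l q u) ∈ W := by
          intro l q hl hq hnq
          rcases (show q = n ∨ q = n+1 by omega) with rfl | rfl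
          · exact dl2 l hl
          · exact dl1 l hl
        by_cases hqn : n ≤ q
        · exact d3 p q hp hq hqn
        · by_cases hpn : n ≤ p
          · rw [h.Dsk q p hq hp, ngA, map_neg, neg_mem_iff]; exact d3 q p hq hp hpn
          · rw [← p1_D h ω ω]; exact (hW p q ω ω _ u0).2
    rw [eq_top_iff]
    intro w _
    obtain ⟨u, rfl⟩ := p1_surj Φ n w
    have : u ∈ W.comap (p1 Φ n) := key ▸ Submodule.mem_top
    exact this
  ev i l hi hl := by
    have e : (∑ j ∈ Finset.range n, Φ1 Φ n (ent i j) * D1 Φ D n l j) (p1 Φ n v) =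
        p1 Φ n ((∑ j ∈ Finset.range n, Φ (ent i j) * D l j) v) := by
      rw [LinearMap.sum_apply, LinearMap.sum_apply, map_sum]
      refine Finset.sum_congr rfl fun j hj => ?_
      have hj := Finset.mem_range.1 hj
      rw [mAp, mAp, p1_D h hl hj, p1_ent Φ n hi hj]
    have e2 := h.Ev (i := i) (l := l) ω ω
    rw [Eo, srS, srS] at e2
    have e3 := congrArg (p1 Φ n) e2
    rw [adA, adA, map_add, map_add, mAp, mAp,
      p1_bent Φ n hi le_rfl ω, p1_bent Φ n hi ω ω, add_zero, add_zero, map_smul] at e3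
    rw [e, e3]
  tf := S1_tf h
end S1
end SkewLC
end

section
namespace SkewLC
open MvPolynomial
def k2 (n : ℕ) : P2 →ₐ[ℂ] P2 := aeval (fun p => if p = (n,n+1) then 0 else X p)
lemma k2_X (n p) : k2 n (X p) = if p = (n,n+1) then 0 else X p := by simp [k2]
lemma k2_en (n f) : k2 n (en n f) = en n f := by
  have : (k2 n).comp (en n) = en n := by
    apply MvPolynomial.algHom_ext
    intro p
    rw [AlgHom.comp_apply, en_X]
    split_ifs with h
    · rw [k2_X, if_neg (by rintro rfl; simp at h)]
    · simp
  conv_rhs => rw [← this]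
  rfl
section S2
variable {M : Type} [AddCommGroup M] [Module ℂ M]
variable {Φ : Rp (ℕ × ℕ) M} {D : ℕ → ℕ → Module.End ℂ M} {n : ℕ}
variable {κ : ℕ} {v : M}
abbrev U2 (D : ℕ → ℕ → Module.End ℂ M) (n : ℕ) : Submodule ℂ M := LinearMap.range (D n (n+1) - 1)
lemma U2_st {f : Module.End ℂ M} (h : ∀ u, f (D n (n+1) u) = D n (n+1) (f u)) : ∀ u ∈ U2 D n, f u ∈ U2 D n := by
  rintro _ ⟨u, rfl⟩
  refine ⟨f u, ?_⟩
  simp only [sbA, onA, map_sub, h]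
abbrev Q2 (D : ℕ → ℕ → Module.End ℂ M) (n : ℕ) := M ⧸ U2 D n
abbrev m2 (D : ℕ → ℕ → Module.End ℂ M) (n : ℕ) : M →ₗ[ℂ] Q2 D n := (U2 D n).mkQ
lemma m2_s : Function.Surjective (m2 D n) := mkS _
lemma m2_d (u) : m2 D n (D n (n+1) u) = m2 D n u := by
  rw [← sub_eq_zero, ← map_sub, Submodule.mkQ_apply, qz]
  exact ⟨u, rfl⟩
lemma X_d (h : CC (n+2) κ Φ D v) (f : P2) (u) : Φ (k2 n f) (D n (n+1) u) = D n (n+1) (Φ (k2 n f) u) := by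
  induction f using MvPolynomial.induction_on generalizing u with
  | C c => rw [← MvPolynomial.algebraMap_eq, AlgHom.commutes, AlgHom.commutes]; simp [Algebra.algebraMap_eq_smul_one]
  | add f g hf hg => simp only [map_add, adA, hf, hg]
  | mul_X f p hf =>
    rw [map_mul, map_mul, mAp, mAp, ← hf]
    congr 1
    rw [k2_X]
    split_ifs with hp
    · simp
    · by_cases hb : p.1 < p.2 ∧ p.2 < n+2
      · have := h.DX n (n+1) p.1 p.2 ω ω ω ω
        rw [ent_lt hb.1] at this
        have hz : dl n p.1 * dl (n+1) p.2 - dl n p.2 * dl (n+1) p.1 = 0 := by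
          have : ¬ (n = p.1 ∧ n+1 = p.2) := fun ⟨h1, h2⟩ => hp (Prod.ext h1.symm h2.symm)
          have h3 : ¬ (n = p.2 ∧ n+1 = p.1) := by omega
          unfold dl
          split_ifs <;> simp_all
        rw [hz, zero_smul] at this
        exact (cm_app0 this u).symm
      · rw [h.out p hb]; simp
def ΦH (h : CC (n+2) κ Φ D v) : Rp (ℕ × ℕ) (Q2 D n) := rpQ (Φ.comp (k2 n)) (U2 D n) (fun _ => U2_st (X_d h _))
lemma ΦH_mk (h : CC (n+2) κ Φ D v) (f u) : ΦH h f (m2 D n u) = m2 D n (Φ (k2 n f) u) := rpQ_mk _ _ _ _ _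
lemma ΦH_X (h : CC (n+2) κ Φ D v) {t} (ht : t ≠ (n,n+1)) (u) : ΦH h (X t) (m2 D n u) = m2 D n (Φ (X t) u) := by
  rw [ΦH_mk, k2_X, if_neg ht]
lemma ΦH_ent (h : CC (n+2) κ Φ D v) {p q} (hp : p < n) (u) :
    ΦH h (ent p q) (m2 D n u) = m2 D n (Φ (ent p q) u) := by
  rw [ΦH_mk]
  congr 3
  unfold ent
  split_ifs
  · rw [k2_X, if_neg]; rw [Prod.mk.injEq]; omega
  · rw [map_neg, k2_X, if_neg]; rw [Prod.mk.injEq]; omega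
  · simp
def Eu (Φ : Rp (ℕ × ℕ) M) (D : ℕ → ℕ → Module.End ℂ M) (n : ℕ) (t : ℕ × ℕ) : Module.End ℂ M :=
  if t.2 = n then - Eo Φ D (n+2) t.1 (n+1) else Eo Φ D (n+2) t.1 n
lemma Eo_d (h : CC (n+2) κ Φ D v) {i l} (hi : i < n) (hl : l < n+2) (u) :
    Eo Φ D (n+2) i l (D n (n+1) u) = D n (n+1) (Eo Φ D (n+2) i l u) := by
  have := h.cED (i := i) (l := l) (p := n) (q := n+1) ω hl ω ω
  rw [dl_ne ω, dl_ne ω] at this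
  exact cm_app0 (by simpa using this) u
lemma Eu_d (h : CC (n+2) κ Φ D v) {t} (ht : t ∈ bl n) (u) : Eu Φ D n t (D n (n+1) u) = D n (n+1) (Eu Φ D n t u) := by
  rw [mem_bl] at ht
  unfold Eu
  split_ifs
  · rw [ngA, ngA, map_neg, Eo_d h ω ω]
  · exact Eo_d h ω ω u
lemma Eu_nil (h : CC (n+2) κ Φ D v) {t} (ht : t ∈ bl n) : LNil (Eu Φ D n t) := by
  rw [mem_bl] at ht
  unfold Eu
  split_ifs
  · exact LNil_neg (h.nilE ω ω ω)
  · exact h.nilE ω ω ω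
lemma Eu_comm (h : CC (n+2) κ Φ D v) {t s} (ht : t ∈ bl n) (hs : s ∈ bl n) (u) :
    Eu Φ D n t (Eu Φ D n s u) = Eu Φ D n s (Eu Φ D n t u) := by
  rw [mem_bl] at ht hs
  have e : ∀ i p, (i = n ∨ i = n+1) → (p = n ∨ p = n+1) → cm (Eo Φ D (n+2) t.1 i) (Eo Φ D (n+2) s.1 p) = 0 := by
    intro i p hi hp
    rw [h.cEE ω ω ω ω, dl_ne ω, dl_ne ω]
    simp
  unfold Eu
  split_ifs <;> (try simp only [ngA, map_neg]) <;>
  rw [cm_app0 (e _ _ (by simp) (by simp))]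
lemma Eu_D (h : CC (n+2) κ Φ D v) {t s} (ht : t ∈ bl n) (hs : s ∈ bl n) (u) :
    D t.1 t.2 (Eu Φ D n s u) = Eu Φ D n s (D t.1 t.2 u) + if s = t then D n (n+1) u else 0 := by
  rw [mem_bl] at ht hs
  have e : ∀ i, (i = n ∨ i = n+1) → cm (Eo Φ D (n+2) s.1 i) (D t.1 t.2) = - dl t.1 s.1 • D i t.2 := by
    intro i hi
    have := h.cED (i := s.1) (l := i) (p := t.1) (q := t.2) ω ω ω ω
    rwa [dl_ne (show t.2 ≠ s.1 by omega), zero_smul, zero_sub, ← neg_smul] at this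
  obtain ⟨t1, t2⟩ := t
  obtain ⟨s1, s2⟩ := s
  simp only at ht hs e ⊢
  have e0 : D (n+1) n = - D n (n+1) := h.Dsk _ _ ω ω
  unfold Eu
  by_cases h1 : t1 = s1
  · subst h1
    rcases ht.2 with rfl | rfl <;> rcases hs.2 with rfl | rfl
    · simp [cm_app (e _ (Or.inr rfl)), e0, dl_self]
    · simp [cm_app (e _ (Or.inl rfl)), h.Dself (show t2 < t2 + 2 by omega)]
    · simp [cm_app (e _ (Or.inr rfl)), h.Dself (show s2 + 1 < s2 + 2 by omega)]
    · simp [cm_app (e _ (Or.inl rfl)), dl_self]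
  · rw [if_neg (show ¬ ((s1, s2) = (t1, t2)) by simp; intro h; exact absurd h.symm h1)]
    split_ifs
    · simp [cm_app (e _ (Or.inr rfl)), dl_ne h1]
    · simp [cm_app (e _ (Or.inl rfl)), dl_ne h1]
lemma Eu_X (h : CC (n+2) κ Φ D v) {t} (ht : t ∈ bl n) (f : P2) (u) :
    Eu Φ D n t (Φ (en n f) u) = Φ (en n f) (Eu Φ D n t u) := by
  rw [mem_bl] at ht
  have e : ∀ a, a = n ∨ a = n+1 → cm (Eo Φ D (n+2) t.1 a) (Φ (en n f)) = 0 := by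
    intro a ha
    induction f using MvPolynomial.induction_on with
    | C c =>
      rw [← MvPolynomial.algebraMap_eq, AlgHom.commutes, AlgHom.commutes, cm]
      rw [Algebra.commutes, sub_self]
    | add f g hf hg => rw [map_add, map_add, cm_addR, hf, hg, add_zero]
    | mul_X f p hf =>
      rw [map_mul, map_mul, cm_mulR, hf, zero_mul, zero_add, en_X]
      split_ifs with hp
      · rw [← ent_lt hp.1, h.cEX ω ω ω ω, dl_ne ω, dl_ne ω]
        simp
      · simp [cm]
  unfold Eu
  split_ifs
  · rw [ngA, ngA, map_neg, cm_app0 (e _ (Or.inr rfl))]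
  · exact cm_app0 (e _ (Or.inl rfl)) u
lemma Eu_v (h : CC (n+2) κ Φ D v) {t} (ht : t ∈ bl n) : Eu Φ D n t v = 0 := by
  rw [mem_bl] at ht
  unfold Eu
  split_ifs
  · rw [ngA, h.Ev ω ω, dl_ne ω]; simp
  · rw [h.Ev ω ω, dl_ne ω]; simp
def EH (Φ : Rp (ℕ × ℕ) M) (D : ℕ → ℕ → Module.End ℂ M) (n : ℕ) (t : ℕ × ℕ) : Module.End ℂ (Q2 D n) := qop (U2 D n) (Eu Φ D n t)
def DH (D : ℕ → ℕ → Module.End ℂ M) (n p q : ℕ) : Module.End ℂ (Q2 D n) := qop (U2 D n) (D p q)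
lemma EH_mk (h : CC (n+2) κ Φ D v) {t} (ht : t ∈ bl n) (u) : EH Φ D n t (m2 D n u) = m2 D n (Eu Φ D n t u) :=
  qop_mk (U2_st (Eu_d h ht)) u
lemma DH_mk (h : CC (n+2) κ Φ D v) {p q} (hp : p < n+2) (hq : q < n+2) (u) : DH D n p q (m2 D n u) = m2 D n (D p q u) :=
  qop_mk (U2_st (fun u => cm_app0 (h.DD _ _ _ _ hp hq ω ω) u)) u
lemma DX0 (h : CC (n+2) κ Φ D v) {p q : ℕ} {s : ℕ × ℕ} (hp : p < n+2) (hq : q < n+2) (hs : s.1 < s.2 ∧ s.2 < n+2)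
    (hn : s ≠ (p,q)) (hn' : s ≠ (q,p)) (u) : D p q (Φ (X s) u) = Φ (X s) (D p q u) := by
  have := h.DX p q s.1 s.2 hp hq ω ω
  rw [ent_lt hs.1] at this
  have hz : dl p s.1 * dl q s.2 - dl p s.2 * dl q s.1 = 0 := by
    have h1 : ¬ (p = s.1 ∧ q = s.2) := fun ⟨h1, h2⟩ => hn (Prod.ext h1.symm h2.symm)
    have h3 : ¬ (p = s.2 ∧ q = s.1) := fun ⟨h1, h2⟩ => hn' (Prod.ext h2.symm h1.symm)
    unfold dl
    split_ifs <;> simp_all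
  rw [hz, zero_smul] at this
  exact cm_app0 this u
lemma DX1 (h : CC (n+2) κ Φ D v) {s : ℕ × ℕ} (hs : s.1 < s.2 ∧ s.2 < n+2) (u) :
    D s.1 s.2 (Φ (X s) u) = Φ (X s) (D s.1 s.2 u) + u := by
  have := h.DX s.1 s.2 s.1 s.2 ω ω ω ω
  rw [ent_lt hs.1, dl_self, dl_self, dl_ne (show s.1 ≠ s.2 by omega)] at this
  rw [cm_app this]; simp
lemma X_EH (h : CC (n+2) κ Φ D v) {t} (ht : t ∈ bl n) : ∃ c : ℕ, c < n + 2 ∧ n ≤ c ∧ ∃ ε : ℂ,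
    ∀ w, ΦH h (X t) w = EH Φ D n t w + ∑ j ∈ Finset.range n, ε • ΦH h (ent t.1 j) (DH D n c j w) := by
  have ht' := mem_bl.1 ht
  obtain ⟨p, q⟩ := t
  simp only at ht'
  have hpn := ht'.1
  have hne : (p,q) ≠ (n,n+1) := by rw [Ne, Prod.mk.injEq]; omega
  rcases ht'.2 with rfl | rfl
  · refine ⟨q+1, by omega, by omega, 1, fun w => ?_⟩
    obtain ⟨u, rfl⟩ := m2_s w
    rw [ΦH_X h hne, EH_mk h ht, Finset.sum_congr rfl fun j hj => by
      rw [DH_mk h ω (by have := Finset.mem_range.1 hj; omega), ΦH_ent h hpn, ← map_smul], ← map_sum,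
      ← map_add, Eu, if_pos rfl, Eo, srS, srS, h.Dself ω,
      h.Dsk q (q+1) ω ω, ent_lt (show p < q by omega)]
    have : ∀ u, D q (q+1) (Φ (X (p,q)) u) = Φ (X (p,q)) (D q (q+1) u) :=
      DX0 h ω ω (by simp; omega) hne (by rw [Ne, Prod.mk.injEq]; omega)
    simp only [ngA, adA, LinearMap.sum_apply, mAp, map_neg, ← this, one_smul,
      LinearMap.zero_apply, map_zero, neg_zero, add_zero, neg_add, neg_neg]
    rw [map_add, map_add, m2_d, map_neg]; abel
  · refine ⟨n, by omega, by omega, -1, fun w => ?_⟩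
    obtain ⟨u, rfl⟩ := m2_s w
    rw [ΦH_X h hne, EH_mk h ht, Finset.sum_congr rfl fun j hj => by
      rw [DH_mk h ω (by have := Finset.mem_range.1 hj; omega), ΦH_ent h hpn, ← map_smul], ← map_sum,
      ← map_add, Eu, if_neg (by simp), Eo, srS, srS, h.Dself (show n < n+2 by omega),
      ent_lt (show p < n+1 by omega)]
    have : ∀ u, D n (n+1) (Φ (X (p,n+1)) u) = Φ (X (p,n+1)) (D n (n+1) u) :=
      DX0 h ω ω (by simp; omega) hne (by rw [Ne, Prod.mk.injEq]; omega)
    simp only [adA, LinearMap.sum_apply, mAp, ← this, neg_smul, one_smul,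
      LinearMap.zero_apply, map_zero, add_zero, mul_zero, Finset.sum_neg_distrib]
    rw [map_add, map_add, m2_d, map_neg]; abel
abbrev N2 (Φ : Rp (ℕ × ℕ) M) (D : ℕ → ℕ → Module.End ℂ M) (n : ℕ) : Submodule ℂ (Q2 D n) := ⨅ t ∈ bl n, LinearMap.ker (EH Φ D n t)
lemma mem_N2 {w : Q2 D n} : w ∈ N2 Φ D n ↔ ∀ t ∈ bl n, EH Φ D n t w = 0 := by simp [Submodule.mem_iInf]
lemma N2_st {f : Module.End ℂ (Q2 D n)} (hf : ∀ t ∈ bl n, ∀ u, EH Φ D n t (f u) = f (EH Φ D n t u)) :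
    ∀ u ∈ N2 Φ D n, f u ∈ N2 Φ D n := by
  intro u hu
  rw [mem_N2] at hu ⊢
  intro t ht
  rw [hf t ht, hu t ht, map_zero]
def ΦE (h : CC (n+2) κ Φ D v) : Rp (ℕ × ℕ) (Q2 D n) := (ΦH h).comp (en n)
lemma ΦE_mk (h : CC (n+2) κ Φ D v) (f u) : ΦE h f (m2 D n u) = m2 D n (Φ (en n f) u) := by
  rw [ΦE, AlgHom.comp_apply, ΦH_mk, k2_en]
lemma EH_ΦE (h : CC (n+2) κ Φ D v) {t} (ht : t ∈ bl n) (f u) : EH Φ D n t (ΦE h f u) = ΦE h f (EH Φ D n t u) := by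
  obtain ⟨u, rfl⟩ := m2_s u
  rw [ΦE_mk, EH_mk h ht, EH_mk h ht, ΦE_mk, Eu_X h ht]
def Φ2 (h : CC (n+2) κ Φ D v) : Rp (ℕ × ℕ) (N2 Φ D n) := rpS (ΦE h) (N2 Φ D n) (fun _ => N2_st fun _ ht _ => EH_ΦE h ht _ _)
lemma KH_S2 (h : CC (n+2) κ Φ D v) (L : List (ℕ × ℕ)) (hL : ∀ t, t ∈ L ↔ t.1 < t.2 ∧ t.2 < n) (j : ℤ) :
    Nonempty (KH (ΦH h) (bl n ++ L) j ≃ₗ[ℂ] KH (Φ2 h) L j) := by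
  have ls : ∀ {s}, s ∈ bl n ++ L → s.1 < s.2 ∧ s.2 < n+2 ∧ s ≠ (n,n+1) := by
    intro s hs
    rw [List.mem_append, mem_bl, hL] at hs
    refine ⟨by omega, by omega, ?_⟩
    rintro rfl; simp at hs
  have bL : ∀ {s}, s ∈ bl n → s ∈ bl n ++ L := fun hs => List.mem_append_left _ hs
  have DXc : ∀ t ∈ bl n, ∀ s ∈ bl n ++ L, s ≠ t → ∀ u, DH D n t.1 t.2 (ΦH h (X s) u) = ΦH h (X s) (DH D n t.1 t.2 u) := by
    intro t ht s hs hst u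
    obtain ⟨a1, a2, a3⟩ := ls (bL ht)
    obtain ⟨c1, c2, c3⟩ := ls hs
    obtain ⟨u, rfl⟩ := m2_s u
    rw [ΦH_X h c3, DH_mk h ω ω, DH_mk h ω ω, ΦH_X h c3,
      DX0 h ω ω ⟨c1, c2⟩ hst (by rintro rfl; simp at c1; omega)]
  have hdis : ∀ t ∈ bl n, t ∉ L := by
    intro t ht h2
    rw [mem_bl] at ht; rw [hL] at h2; omega
  have cE : ∀ t ∈ bl n, Cm (ΦH h) (ΦH h) L (EH Φ D n t) := by
    intro t ht s hs u
    have := EH_ΦE h ht (X s) u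
    rwa [ΦE, AlgHom.comp_apply, en_X, if_pos ((hL s).1 hs)] at this
  have cD : ∀ c, c < n+2 → n ≤ c → ∀ j, j < n → Cm (ΦH h) (ΦH h) L (DH D n c j) := by
    intro c hc hc2 j hj s hs u
    obtain ⟨u, rfl⟩ := m2_s u
    have hs' := (hL s).1 hs
    have hne : s ≠ (n,n+1) := by rintro rfl; simp at hs'
    rw [ΦH_X h hne, DH_mk h ω ω, DH_mk h ω ω, ΦH_X h hne,
      DX0 h ω ω ⟨hs'.1, by omega⟩ (by rintro rfl; simp at hs'; omega) (by rintro rfl; simp at hs'; omega)]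
  have key : ∀ t (ht : t ∈ bl n), ∀ j x, Hf (ΦH h) (ΦH h) (Cm.rho (ΦH h) L (X t)) j x = Hf (ΦH h) (ΦH h) (cE t ht) j x := by
    intro t ht j x
    obtain ⟨c, hc, hc2, ε, hX⟩ := X_EH h ht
    have ht1 := (mem_bl.1 ht).1
    have cg : ∀ k, k ≤ n → ∃ hh : Cm (ΦH h) (ΦH h) L (EH Φ D n t + ∑ j ∈ Finset.range k, ε • (ΦH h (ent t.1 j) * DH D n c j)),
        Hf (ΦH h) (ΦH h) hh j x = Hf (ΦH h) (ΦH h) (cE t ht) j x := by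
      intro k hk
      induction k with
      | zero => exact ⟨by simpa using cE t ht, by congr 2; simp⟩
      | succ k ih =>
        obtain ⟨hh, e⟩ := ih ω
        have h3 : Cm (ΦH h) (ΦH h) L (ΦH h (ent t.1 k) * DH D n c k) := by
          intro s hs u
          rw [mAp, cD c hc hc2 k ω s hs, rp_comm]; rfl
        have h4 : Cm (ΦH h) (ΦH h) L (ε • (ΦH h (ent t.1 k) * DH D n c k)) := by
          intro s hs u
          rw [smA, h3 s hs, smA, map_smul]
        have h5 : Hf (ΦH h) (ΦH h) (Cm.rho (ΦH h) L (ent t.1 k)) j (Hf (ΦH h) (ΦH h) (cD c hc hc2 k ω) j x) = 0 := by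
          generalize Hf (ΦH h) (ΦH h) (cD c hc hc2 k ω) j x = y
          rcases lt_trichotomy t.1 k with h6 | h6 | h6
          · rw [← hom_zero (ΦH h) (t.1,k) L ((hL _).2 ⟨h6, by simp; omega⟩) j y]
            congr 2; rw [ent_lt h6]
          · rw [Hf_smul (ΦH h) (ΦH h) (Cm.rho (ΦH h) L 1) 0, zero_smul]
            intro a; rw [h6, ent_self]; simp
          · rw [Hf_smul (ΦH h) (ΦH h) (Cm.rho (ΦH h) L (X (k,t.1))) (-1), hom_zero, smul_zero]
            · exact (hL _).2 ⟨h6, by simp; omega⟩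
            · intro a; rw [Xsk k t.1, ent_lt h6]; simp
        have h9 : Cm (ΦH h) (ΦH h) L (EH Φ D n t + ∑ j ∈ Finset.range (k+1), ε • (ΦH h (ent t.1 j) * DH D n c j)) := by
          intro s hs u
          have h7 := hh s hs u
          have h8 := h4 s hs u
          rw [srS, ← add_assoc, adA (_ + _), h7, h8, ← map_add]; rfl
        refine ⟨h9, ?_⟩
        have e1 := Hf_lin (ΦH h) (ΦH h) hh h4 h9 (by
          intro a; rw [srS, ← add_assoc, adA (_ + _)]) j x
        rw [e1, e, Hf_smul (ΦH h) (ΦH h) h3 ε h4 (fun a => rfl),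
          Hf_comp (ΦH h) (ΦH h) (ΦH h) (cD c hc hc2 k ω) (Cm.rho (ΦH h) L (ent t.1 k)) h3 (fun a => rfl), h5,
          smul_zero, add_zero]
    obtain ⟨hh, e⟩ := cg n le_rfl
    rw [← e]
    have : ΦH h (X t) = EH Φ D n t + ∑ j ∈ Finset.range n, ε • (ΦH h (ent t.1 j) * DH D n c j) := by
      apply LinearMap.ext; intro w
      rw [hX w, adA, LinearMap.sum_apply]; rfl
    congr 2
  have nilH : ∀ t ∈ bl n, LNil (EH Φ D n t) := fun t ht =>
    LNil_surj _ m2_s _ _ (fun u => (EH_mk h ht u).symm) (Eu_nil h ht)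
  obtain ⟨F, Fi, Fr, -⟩ := lemP (ΦH h) L (fun t => DH D n t.1 t.2) (bl n) (nd_bl n) DXc (by
    intro t ht u
    obtain ⟨a1, a2, a3⟩ := ls (bL ht)
    obtain ⟨u, rfl⟩ := m2_s u
    rw [ΦH_X h a3, DH_mk h ω ω, DH_mk h ω ω, ΦH_X h a3, DX1 h ⟨a1, a2⟩, map_add]) hdis (by
    intro t ht j
    have : Hf (ΦH h) (ΦH h) (Cm.rho (ΦH h) L (X t)) j = Hf (ΦH h) (ΦH h) (cE t ht) j := LinearMap.ext (key t ht j)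
    rw [this]
    exact LNil_H _ (nilH t ht) j) j
  have cf : Cm (Φ2 h) (ΦE h) L (N2 Φ D n).subtype := fun s _ a => rpS_coe (ΦE h) (N2 Φ D n) (fun _ => N2_st fun _ ht _ => EH_ΦE h ht _ _) (X s) a
  have hEE : ∀ t ∈ bl n, ∀ s u, EH Φ D n t (ΦE h (X s) u) = ΦE h (X s) (EH Φ D n t u) := fun t ht s u => EH_ΦE h ht _ _
  have hEX : ∀ s ∈ L, ∀ u, ΦH h (X s) u = ΦE h (X s) u := by
    intro s hs u
    rw [ΦE, AlgHom.comp_apply, en_X, if_pos ((hL s).1 hs)]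
  have ED : ∀ t ∈ bl n, ∀ s ∈ bl n, ∀ u, DH D n t.1 t.2 (EH Φ D n s u) = EH Φ D n s (DH D n t.1 t.2 u) + if s = t then u else 0 := by
    intro t ht s hs u
    obtain ⟨u, rfl⟩ := m2_s u
    obtain ⟨a1, a2, a3⟩ := ls (bL ht)
    rw [EH_mk h hs, DH_mk h ω ω, DH_mk h ω ω, EH_mk h hs, Eu_D h ht hs, map_add]
    split_ifs
    · rw [m2_d]
    · rw [map_zero]
  obtain ⟨Gi, Gr⟩ := lemG (Φ2 h) L (bl n) (nd_bl n) (ΦE h) (EH Φ D n) (fun t => DH D n t.1 t.2) (N2 Φ D n).subtype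
    (by intro t ht s hs hst u; rw [ED t ht s hs, if_neg hst, add_zero])
    (by intro t ht u; rw [ED t ht t ht, if_pos rfl])
    nilH
    (by
      intro t ht s hs u
      obtain ⟨u, rfl⟩ := m2_s u
      rw [EH_mk h hs, EH_mk h ht, EH_mk h ht, EH_mk h hs, Eu_comm h ht hs])
    (Submodule.subtype_injective _)
    (by
      intro u
      rw [← mem_N2]
      constructor
      · rintro ⟨a, rfl⟩; exact a.2
      · intro hu; exact ⟨⟨u, hu⟩, rfl⟩)
    hEE
    (by
      intro t ht s hs u
      rw [← hEX s hs, ← hEX s hs, DXc t ht s (List.mem_append_right _ hs) (by rintro rfl; exact hdis _ ht hs)])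
    cf j
  obtain ⟨e, he⟩ := KH_congr (ΦH h) (ΦE h) L hEX j
  have rr : LinearMap.range (e.toLinearMap ∘ₗ F) = LinearMap.range (Hf (Φ2 h) (ΦE h) cf j) := by
    ext y
    have := Gr y
    rw [LinearMap.mem_range, LinearMap.mem_range, this]
    constructor
    · rintro ⟨x, rfl⟩ t ht
      have h1 := (Fr (F x)).1 ⟨x, rfl⟩ t ht
      rw [key t ht] at h1
      have h2 := he (EH Φ D n t) (cE t ht) (fun s _ => hEE t ht s) (F x)
      rw [h1, map_zero] at h2
      exact h2.symm
    · intro hy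
      obtain ⟨z, rfl⟩ := e.surjective y
      obtain ⟨x, hx⟩ := (Fr z).2 (by
        intro t ht
        rw [key t ht]
        apply e.injective
        rw [he (EH Φ D n t) (cE t ht) (fun s _ => hEE t ht s) z, map_zero]
        exact hy t ht)
      exact ⟨x, by rw [cmA, hx]; rfl⟩
  exact ⟨(LinearEquiv.ofInjective _ (e.injective.comp Fi : Function.Injective (e.toLinearMap ∘ₗ F))).trans
    ((LinearEquiv.ofEq _ _ rr).trans (LinearEquiv.ofInjective _ Gi).symm)⟩
end S2
end SkewLC
end

section
namespace SkewLC
open MvPolynomial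
lemma disj {τ Q : Type} [AddCommGroup Q] [Module ℂ Q] (E A : τ → Module.End ℂ Q) (bs : List τ) (nd : bs.Nodup)
    (h1 : ∀ t ∈ bs, ∀ s ∈ bs, s ≠ t → ∀ u, E t (A s u) = A s (E t u))
    (h2 : ∀ t ∈ bs, ∀ u, E t (A t u) = A t (E t u) + u) (h3 : ∀ t ∈ bs, LNil (E t))
    (h4 : ∀ t ∈ bs, ∀ s ∈ bs, ∀ u, E t (E s u) = E s (E t u))
    (h5 : ∀ t ∈ bs, ∀ s ∈ bs, ∀ u, A t (A s u) = A s (A t u)) :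
    ∀ (S : Submodule ℂ Q) (_ : ∀ t ∈ bs, ∀ u ∈ S, E t u ∈ S ∧ A t u ∈ S) (r : Q),
      r ∈ ⨆ t ∈ bs, S.map (A t) → (∀ t ∈ bs, E t r = 0) → r = 0 := by
  induction bs with
  | nil => intro S _ r hr _; simpa using hr
  | cons t bs ih =>
    intro S hS r hr hE
    have tm : t ∈ t :: bs := List.mem_cons_self
    have sm : ∀ {s}, s ∈ bs → s ∈ t :: bs := fun h => List.mem_cons_of_mem _ h
    have ne : ∀ {s}, s ∈ bs → s ≠ t := by
      rintro s hs rfl; exact (List.nodup_cons.1 nd).1 hs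
    set S' := S ⊓ LinearMap.ker (E t) with hS'
    have eE : ∀ u : S, ((rop S (E t) u : S) : Q) = E t u := fun u => rop_coe (fun u hu => (hS t tm u hu).1) u
    have eA : ∀ u : S, ((rop S (A t) u : S) : Q) = A t u := fun u => rop_coe (fun u hu => (hS t tm u hu).2) u
    have hW : ∀ u : S, rop S (E t) (rop S (A t) u) = rop S (A t) (rop S (E t) u) + u := by
      intro u
      apply Subtype.ext
      rw [Submodule.coe_add, eE, eA, eA, eE, h2 t tm]
    have hN : LNil (rop S (E t)) := LNil_inj S.subtype (Submodule.subtype_injective _) _ _ eE (h3 t tm)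
    have st : ∀ s ∈ bs, S.map (A s) ≤ S.map (A t) ⊔ ⨆ s ∈ bs, S'.map (A s) := by
      rintro s hs _ ⟨b, hb, rfl⟩
      obtain ⟨z, hz⟩ := bd_split _ _ hW hN ⟨b, hb⟩
      have hz' := congrArg Subtype.val hz
      rw [eE, Submodule.coe_sub, eA] at hz'
      have e : A s b = A t (A s z) + A s (b - A t z) := by
        rw [map_sub, h5 t tm s (sm hs)]; abel
      rw [e]
      refine Submodule.add_mem_sup ⟨_, (hS s (sm hs) _ z.2).2, rfl⟩ (Submodule.mem_iSup_of_mem s (Submodule.mem_iSup_of_mem hs ?_))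
      exact ⟨_, ⟨sub_mem hb (hS t tm _ z.2).2, hz'⟩, rfl⟩
    have hr2 : r ∈ S.map (A t) ⊔ ⨆ s ∈ bs, S'.map (A s) := by
      refine (iSup₂_le fun s hs => ?_ : (⨆ t_1 ∈ t :: bs, S.map (A t_1)) ≤ _) hr
      rcases List.mem_cons.1 hs with rfl | hs
      · exact le_sup_left
      · exact st s hs
    obtain ⟨_, ⟨a, ha, rfl⟩, r', hr', rfl⟩ := Submodule.mem_sup.1 hr2
    have e0 : E t r' = 0 := by
      have : (⨆ s ∈ bs, S'.map (A s)) ≤ LinearMap.ker (E t) := by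
        refine iSup₂_le fun s hs => ?_
        rintro _ ⟨b, hb, rfl⟩
        rw [LinearMap.mem_ker, h1 t tm s (sm hs) (ne hs), LinearMap.mem_ker.1 hb.2, map_zero]
      exact this hr'
    have e1 : A t a = 0 := by
      have := hE t tm
      rw [map_add, e0, add_zero] at this
      have h6 := bd_disj _ _ hW hN ⟨a, ha⟩ (Subtype.ext (by rw [eE, eA]; exact this))
      have := congrArg Subtype.val h6
      rwa [eA] at this
    rw [e1, zero_add] at hE ⊢
    refine ih (List.nodup_cons.1 nd).2 (fun t ht s hs => h1 t (sm ht) s (sm hs)) (fun t ht => h2 t (sm ht))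
      (fun t ht => h3 t (sm ht)) (fun t ht s hs => h4 t (sm ht) s (sm hs)) (fun t ht s hs => h5 t (sm ht) s (sm hs)) S' ?_ r' hr'
      (fun s hs => hE s (sm hs))
    intro s hs u hu
    have := LinearMap.mem_ker.1 hu.2
    refine ⟨⟨(hS s (sm hs) u hu.1).1, ?_⟩, ⟨(hS s (sm hs) u hu.1).2, ?_⟩⟩
    · show E t _ = 0
      rw [h4 t tm s (sm hs), this, map_zero]
    · show E t _ = 0
      rw [h1 t tm s (sm hs) (ne hs), this, map_zero]
section S2
variable {M : Type} [AddCommGroup M] [Module ℂ M]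
variable {Φ : Rp (ℕ × ℕ) M} {D : ℕ → ℕ → Module.End ℂ M} {n : ℕ}
variable {κ : ℕ} {v : M}
lemma GrOK.neg {π : ℤ → Module.End ℂ M} (g : GrOK π) : GrOK (fun a => π (-a)) where
  fin u := by
    obtain ⟨s, h1, h2⟩ := g.fin u
    refine ⟨s.map (Equiv.neg ℤ).toEmbedding, fun a ha => h1 _ fun h => ha ?_, ?_⟩
    · rw [Finset.mem_map]; exact ⟨-a, h, by simp⟩
    · rw [Finset.sum_map]; simpa using h2
  orth a b u := by rw [g.orth]; simp [neg_inj]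
lemma S2_gr (h : CC (n+2) κ Φ D v) : ∃ π : ℤ → Module.End ℂ M, GrOK π ∧
    (∀ a u, D n (n+1) (π a u) = π (a+1) (D n (n+1) u)) ∧ π (2*κ:ℤ) v = v ∧
    (∀ (f : Module.End ℂ M), cm (Eo Φ D (n+2) n n) f = 0 → ∀ a u, f (π a u) = π a (f u)) := by
  obtain ⟨π, g, -, h2, h3⟩ := S1_gr h
  refine ⟨_, g.neg, fun a u => ?_, h2, fun f hf a u => ?_⟩
  · have := h3 (D n (n+1)) (-1) (by
      rw [h.cED ω ω ω ω, dl_self, dl_ne ω]; simp) (-a) u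
    rw [this]; congr 2; ring
  · have := h3 f 0 (by simpa using hf) (-a) u
    rw [this, add_zero]
lemma cEen (h : CC (n+2) κ Φ D v) (f : P2) : cm (Eo Φ D (n+2) n n) (Φ (en n f)) = 0 := by
  induction f using MvPolynomial.induction_on with
  | C c =>
    rw [← MvPolynomial.algebraMap_eq, AlgHom.commutes, AlgHom.commutes, cm]
    rw [Algebra.commutes, sub_self]
  | add f g hf hg => rw [map_add, map_add, cm_addR, hf, hg, add_zero]
  | mul_X f p hf =>
    rw [map_mul, map_mul, cm_mulR, hf, zero_mul, zero_add, en_X]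
    split_ifs with hp
    · rw [← ent_lt hp.1, h.cEX ω ω ω ω, dl_ne ω, dl_ne ω]
      simp
    · simp [cm]
lemma en_en (f : P2) : en (n+2) (en n f) = en n f := by
  have : (en (n+2)).comp (en n) = en n := by
    apply MvPolynomial.algHom_ext
    intro p
    rw [AlgHom.comp_apply, en_X]
    split_ifs with h
    · rw [en_X, if_pos ω]
    · simp
  conv_rhs => rw [← this]
  rfl
lemma m2_zero {u : M} : m2 D n u = 0 ↔ ∃ w, D n (n+1) w - w = u := by
  rw [Submodule.mkQ_apply, qz, LinearMap.mem_range]; rfl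
lemma S2_tf (h : CC (n+2) κ Φ D v) (f : P2) (hf : en n f ≠ 0) : Function.Injective (Φ2 h f) := by
  rw [inj0]
  intro w hw
  have hw1 : ΦE h f w = 0 := by
    have := rpS_coe (ΦE h) (N2 Φ D n) (fun _ => N2_st fun _ ht _ => EH_ΦE h ht _ _) f w
    rw [← this]; exact congrArg Subtype.val hw
  apply Subtype.ext
  obtain ⟨w, hw0⟩ := w
  simp only at hw1 ⊢
  obtain ⟨π, g, gx, -, gf⟩ := S2_gr h
  obtain ⟨u, rfl⟩ := m2_s w
  obtain ⟨c, u', -, hu', huu⟩ := g3 g gx 0 u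
  have e1 : m2 D n u = m2 D n u' := by
    rw [← sub_eq_zero, ← map_sub, Submodule.mkQ_apply, qz]; exact huu
  rw [e1, ΦE_mk, m2_zero] at hw1
  obtain ⟨z, hz⟩ := hw1
  obtain ⟨N, hN⟩ := g2 g gx c _ z (by rw [← gf _ (cEen h f), hu']) hz
  have e2 : ∀ N u, ((D n (n+1))^N) (Φ (en n f) u) = Φ (en n f) (((D n (n+1))^N) u) := by
    intro N
    induction N with
    | zero => intro u; rfl
    | succ k ih =>
      intro u
      rw [pow_succ, mAp, mAp, ← ih]
      congr 1
      have := X_d h (en n f) u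
      rw [k2_en] at this
      exact this.symm
  rw [e2] at hN
  have e3 := h.tf (en n f) (by rwa [en_en]) (hN.trans (map_zero _).symm)
  rw [e1]
  have := pow_sub_mem (f := D n (n+1)) N u'
  rw [e3, zero_sub, neg_mem_iff] at this
  show m2 D n u' = 0
  rw [Submodule.mkQ_apply, qz]; exact this
lemma S2_v (h : CC (n+2) (κ+1) Φ D v) : m2 D n v ≠ 0 := by
  intro h0
  obtain ⟨π, g, gx, gv, -⟩ := S2_gr h
  obtain ⟨z, hz⟩ := m2_zero.1 h0
  obtain ⟨N, hN⟩ := g2 g gx _ _ z gv hz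
  set d := D n (n+1) with hd
  classical
  have ex : ∃ N, (d^N) v = 0 := ⟨N, hN⟩
  obtain ⟨k, hk⟩ : ∃ k, Nat.find ex = k + 1 := by
    refine Nat.exists_eq_succ_of_ne_zero fun h0 => h.v0 ?_
    have := Nat.find_spec ex
    rwa [h0] at this
  have hk0 := Nat.find_spec ex
  rw [hk] at hk0
  have hw : (d^k) v ≠ 0 := Nat.find_min ex ω
  have key : ∀ (Y Z : Module.End ℂ M), cm Y d = Z → cm Z d = 0 → ∀ (k : ℕ) u,
      Y ((d ^ (k+1)) u) = (d ^ (k+1)) (Y u) + ((k:ℂ)+1) • (d ^ k) (Z u) := by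
    intro Y Z h1 h2 k
    induction k with
    | zero => intro u; simp [cm_app h1]
    | succ k ih =>
      intro u
      rw [pow_succ, mAp, ih, cm_app h1, map_add, cm_app0 h2, mAp]
      have e : (d ^ (k+1)) (Z u) = (d ^ k) (d (Z u)) := by rw [pow_succ]; rfl
      rw [e]
      push_cast
      module
  have hD : ∀ l, l < n+2 → D n l ((d^k) v) = 0 := by
    intro l hl
    by_cases hln : l = n + 1
    · subst hln; rw [pow_succ'] at hk0; exact hk0
    have := key (Eo Φ D (n+2) (n+1) l) (D l n) (by
      rw [hd, h.cED ω hl ω ω, dl_self, dl_ne ω]; simp)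
      (h.DD _ _ _ _ hl ω ω ω) k v
    rw [hk0, map_zero, h.Ev ω hl, dl_ne ω, mul_zero, zero_smul, map_zero, zero_add] at this
    have h2 := (smul_eq_zero.1 this.symm).resolve_left (by exact_mod_cast k.succ_ne_zero)
    have h3 : ∀ k u, D l n ((d^k) u) = (d^k) (D l n u) := by
      intro k
      induction k with
      | zero => intro u; rfl
      | succ k ih =>
        intro u
        rw [pow_succ, mAp, ih, mAp, cm_app0 (h.DD _ _ _ _ hl ω ω ω)]
    rw [h.Dsk l n hl ω, ngA, h3, h2, neg_zero]
  have h0 : Eo Φ D (n+2) n n ((d^k) v) = 0 := by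
    rw [Eo, LinearMap.sum_apply]
    exact Finset.sum_eq_zero fun j hj => by rw [mAp, hD j (Finset.mem_range.1 hj), map_zero]
  have hE : ∀ k : ℕ, Eo Φ D (n+2) n n ((d^k) v) = (-(2 * ((κ+1 : ℕ):ℂ)) - k) • (d^k) v := by
    intro k
    induction k with
    | zero => simp [h.Ev (i := n) (l := n) ω ω, dl_self]
    | succ k ih =>
      have hc : cm (Eo Φ D (n+2) n n) d = -d := by
        rw [hd, h.cED ω ω ω ω, dl_self, dl_ne ω]; simp
      rw [pow_succ', mAp, cm_app hc, ih, map_smul, ngA]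
      push_cast
      module
  rw [hE] at h0
  have := (smul_eq_zero.1 h0).resolve_right hw
  have h5 : ((2 * (κ+1) + k : ℕ) : ℂ) = 0 := by push_cast at this ⊢; linear_combination -this
  have := Nat.cast_eq_zero.1 h5
  omega
end S2
end SkewLC
end

section
namespace SkewLC
open MvPolynomial
section S2
variable {M : Type} [AddCommGroup M] [Module ℂ M]
variable {Φ : Rp (ℕ × ℕ) M} {D : ℕ → ℕ → Module.End ℂ M} {n : ℕ}
variable {κ : ℕ} {v : M}
def Dh (D : ℕ → ℕ → Module.End ℂ M) (n p q : ℕ) : Module.End ℂ M :=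
  D n (n+1) * D p q - (D n p * D (n+1) q - D n q * D (n+1) p)
lemma Dh_D (h : CC (n+2) κ Φ D v) {p q i j} (hp : p < n+2) (hq : q < n+2) (hi : i < n+2) (hj : j < n+2) :
    cm (Dh D n p q) (D i j) = 0 := by
  have e : ∀ a b, a < n+2 → b < n+2 → cm (D a b) (D i j) = 0 := fun a b ha hb => h.DD a b i j ha hb hi hj
  unfold Dh
  simp [cm_subL, cm_mulL, e _ _ hp hq, e n p ω hp, e n q ω hq, e (n+1) p ω hp, e (n+1) q ω hq,
    e n (n+1) ω ω]
lemma Dh_X (h : CC (n+2) κ Φ D v) {p q i j} (hp : p < n) (hq : q < n) (hi : i < n) (hj : j < n) :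
    cm (Dh D n p q) (Φ (ent i j)) = (dl p i * dl q j - dl p j * dl q i) • D n (n+1) := by
  have e : ∀ a b, n ≤ a → a < n+2 → b < n+2 → cm (D a b) (Φ (ent i j)) = 0 := fun a b ha ha' hb => by
    rw [h.DX _ _ _ _ ha' hb ω ω, dl_ne (show a ≠ i by omega), dl_ne (show a ≠ j by omega)]; simp
  unfold Dh
  simp [cm_subL, cm_mulL, h.DX p q i j ω ω ω ω, e n p le_rfl ω ω,
    e n q le_rfl ω ω, e (n+1) p ω ω ω, e (n+1) q ω ω ω,
    e n (n+1) le_rfl ω ω]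
lemma Dh_Eo (h : CC (n+2) κ Φ D v) {p q i c} (hp : p < n) (hq : q < n) (hi : i < n) (hc : c = n ∨ c = n+1) :
    cm (Eo Φ D (n+2) i c) (Dh D n p q) = 0 := by
  have hc' : c < n+2 := by omega
  have e := fun a b (ha : a < n+2) (hb : b < n+2) => h.cED (i := i) (l := c) (p := a) (q := b) ω hc' ha hb
  unfold Dh
  rw [cm_subR, cm_subR, cm_mulR, cm_mulR, cm_mulR, e p q ω ω, e n p ω ω,
    e n q ω ω, e (n+1) p ω ω, e (n+1) q ω ω, e n (n+1) ω ω,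
    dl_ne (show n ≠ i by omega), dl_ne (show n+1 ≠ i by omega)]
  simp only [zero_smul, sub_zero, zero_mul, zero_add]
  have c1 : ∀ a b, a < n+2 → b < n+2 → D n (n+1) * D a b = D a b * D n (n+1) := fun a b ha hb =>
    sub_eq_zero.1 (h.DD n (n+1) a b ω ω ha hb)
  have c2 : ∀ a b, a < n+2 → b < n+2 → D n a * D (n+1) b = D (n+1) b * D n a := fun a b ha hb =>
    sub_eq_zero.1 (h.DD n a (n+1) b ω ω ω ω)
  have e1 : D (n+1) n = - D n (n+1) := h.Dsk _ _ ω ω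
  rcases hc with rfl | rfl
  · rw [h.Dself (show c < c + 2 by omega)]
    simp only [smul_mul_assoc, mul_smul_comm, smul_zero, zero_mul, zero_add, mul_neg, mul_sub, sub_zero, smul_neg,
      c1 p (c+1), c1 c p ω ω, c1 c q ω ω]
    abel
  · rw [h.Dself (show n+1 < n+1+1 by omega), e1]
    simp only [smul_mul_assoc, mul_smul_comm, smul_zero, mul_zero, add_zero, mul_sub,
      c1 (n+1) p ω ω, c1 (n+1) q ω ω]
    simp only [neg_mul, smul_neg, c1 (n+1) p ω ω, c1 (n+1) q ω ω]
    abel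
lemma Dh_Eu (h : CC (n+2) κ Φ D v) {p q t} (hp : p < n) (hq : q < n) (ht : t ∈ bl n) (u) :
    Eu Φ D n t (Dh D n p q u) = Dh D n p q (Eu Φ D n t u) := by
  rw [mem_bl] at ht
  unfold Eu
  split_ifs
  · rw [ngA, ngA, map_neg, cm_app0 (Dh_Eo h hp hq ω ω)]
  · rw [cm_app0 (Dh_Eo h hp hq ω ω)]
def DhH (D : ℕ → ℕ → Module.End ℂ M) (n p q : ℕ) : Module.End ℂ (Q2 D n) := qop (U2 D n) (Dh D n p q)
lemma DhH_mk (h : CC (n+2) κ Φ D v) {p q} (hp : p < n) (hq : q < n) (u) : DhH D n p q (m2 D n u) = m2 D n (Dh D n p q u) :=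
  qop_mk (U2_st (fun u => cm_app0 (Dh_D h ω ω ω ω) u)) u
def D2 (Φ : Rp (ℕ × ℕ) M) (D : ℕ → ℕ → Module.End ℂ M) (n p q : ℕ) : Module.End ℂ (N2 Φ D n) := rop (N2 Φ D n) (DhH D n p q)
lemma D2_coe (h : CC (n+2) κ Φ D v) {p q} (hp : p < n) (hq : q < n) (w : N2 Φ D n) : (D2 Φ D n p q w : Q2 D n) = DhH D n p q w := by
  refine rop_coe (N2_st fun t ht u => ?_) w
  obtain ⟨u, rfl⟩ := m2_s u
  rw [DhH_mk h hp hq, EH_mk h ht, EH_mk h ht, DhH_mk h hp hq, Dh_Eu h hp hq ht]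
lemma Φ2_coe (h : CC (n+2) κ Φ D v) (f) (w : N2 Φ D n) : (Φ2 h f w : Q2 D n) = ΦE h f w :=
  rpS_coe (ΦE h) (N2 Φ D n) (fun _ => N2_st fun _ ht _ => EH_ΦE h ht _ _) f w
lemma Φ2_ent (h : CC (n+2) κ Φ D v) {p q} (hp : p < n) (hq : q < n) (w : N2 Φ D n) : (Φ2 h (ent p q) w : Q2 D n) = ΦH h (ent p q) w := by
  rw [Φ2_coe, ΦE, AlgHom.comp_apply, en_ent hp hq]
def v2 (h : CC (n+2) κ Φ D v) : N2 Φ D n := ⟨m2 D n v, by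
  rw [mem_N2]; intro t ht; rw [EH_mk h ht, Eu_v h ht, map_zero]⟩
lemma ev2 (h : CC (n+2) κ Φ D v) {i l} (hi : i < n) (hl : l < n) :
    ∑ j ∈ Finset.range n, Φ (ent i j) * Dh D n l j = Eo Φ D (n+2) i l * D n (n+1) - Eo Φ D (n+2) i (n+1) * D n l
      + Eo Φ D (n+2) i n * D (n+1) l := by
  have c : ∀ a b e f, a < n+2 → b < n+2 → e < n+2 → f < n+2 → D a b * D e f = D e f * D a b := fun a b e f ha hb he hf =>
    sub_eq_zero.1 (h.DD _ _ _ _ ha hb he hf)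
  have e1 : D (n+1) n = - D n (n+1) := h.Dsk _ _ ω ω
  have e2 : D l n = - D n l := h.Dsk _ _ ω ω
  have e3 : D l (n+1) = - D (n+1) l := h.Dsk _ _ ω ω
  simp only [Eo, srS, h.Dself (show n < n+2 by omega), h.Dself (show n+1 < n+2 by omega), e1, e2, e3,
    mul_zero, add_zero, add_mul, Finset.sum_mul, mul_assoc, mul_neg, neg_mul]
  rw [c n l n (n+1) ω ω ω ω, c (n+1) l n (n+1) ω ω ω ω]
  have e4 : ∀ j ∈ Finset.range n, Φ (ent i j) * Dh D n l j = Φ (ent i j) * (D l j * D n (n+1)) - Φ (ent i j) * (D (n+1) j * D n l)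
      + Φ (ent i j) * (D n j * D (n+1) l) := by
    intro j hj
    have hj := Finset.mem_range.1 hj
    rw [Dh, c n (n+1) l j ω ω ω ω, c n l (n+1) j ω ω ω ω,
      mul_sub, mul_sub]
    abel
  rw [Finset.sum_congr rfl e4, Finset.sum_add_distrib, Finset.sum_sub_distrib]
  abel
lemma ev2v (h : CC (n+2) κ Φ D v) {i l} (hi : i < n) (hl : l < n) :
    (∑ j ∈ Finset.range n, Φ (ent i j) * Dh D n l j) v = ((-(2*κ:ℂ) + 2) * dl i l) • D n (n+1) v := by
  rw [ev2 h hi hl]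
  have c := fun a b c (ha : a < n+2) (hb : b < n+2) (hc : c < n+2) => h.cED (i := i) (l := c) (p := a) (q := b) ω hc ha hb
  simp only [adA, sbA, mAp]
  rw [cm_app (c n (n+1) l ω ω ω), cm_app (c n l (n+1) ω ω ω),
    cm_app (c (n+1) l n ω ω ω), h.Ev ω ω, h.Ev ω ω,
    h.Ev ω ω, dl_ne (show n ≠ i by omega), dl_ne (show n+1 ≠ i by omega), dl_ne (show i ≠ n+1 by omega),
    dl_ne (show i ≠ n by omega), h.Dsk n (n+1) ω ω, dl_comm l i]
  simp
  module
end S2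
end SkewLC
end

section
namespace SkewLC
open MvPolynomial
section S2
variable {M : Type} [AddCommGroup M] [Module ℂ M]
def clo {τ : Type} (A : τ → Module.End ℂ M) (bs : List τ) (N : Submodule ℂ M) : Submodule ℂ M :=
  sInf {V | N ≤ V ∧ ∀ t ∈ bs, ∀ u ∈ V, A t u ∈ V}
section
variable {τ : Type} {A : τ → Module.End ℂ M} {bs : List τ} {N : Submodule ℂ M}
lemma clo_le : N ≤ clo A bs N := le_sInf fun _ h => h.1
lemma clo_st {t} (ht : t ∈ bs) {u} (hu : u ∈ clo A bs N) : A t u ∈ clo A bs N := by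
  rw [clo, Submodule.mem_sInf] at hu ⊢
  exact fun V hV => hV.2 t ht u (hu V hV)
lemma clo_pres (Y : Module.End ℂ M) (h : ∀ t ∈ bs, ∃ c : ℂ, ∀ u, Y (A t u) = A t (Y u) + c • u)
    (hN : ∀ u ∈ N, Y u ∈ clo A bs N) {u} (hu : u ∈ clo A bs N) : Y u ∈ clo A bs N := by
  have : clo A bs N ≤ clo A bs N ⊓ (clo A bs N).comap Y := by
    refine sInf_le ⟨le_inf clo_le hN, fun t ht u hu => ⟨clo_st ht hu.1, ?_⟩⟩
    obtain ⟨c, hc⟩ := h t ht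
    show Y (A t u) ∈ clo A bs N
    rw [hc]
    exact add_mem (clo_st ht hu.2) (Submodule.smul_mem _ _ hu.1)
  exact (this hu).2
lemma clo_sup : clo A bs N ≤ N ⊔ ⨆ t ∈ bs, (⊤ : Submodule ℂ M).map (A t) := by
  refine sInf_le ⟨le_sup_left, fun t ht u _ => ?_⟩
  exact Submodule.mem_sup_right (Submodule.mem_iSup_of_mem t (Submodule.mem_iSup_of_mem ht ⟨u, trivial, rfl⟩))
end
variable {Φ : Rp (ℕ × ℕ) M} {D : ℕ → ℕ → Module.End ℂ M} {n : ℕ}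
variable {κ : ℕ} {v : M}
lemma EH_D (h : CC (n+2) κ Φ D v) {t s} (ht : t ∈ bl n) (hs : s ∈ bl n) (u) :
    DH D n t.1 t.2 (EH Φ D n s u) = EH Φ D n s (DH D n t.1 t.2 u) + if s = t then u else 0 := by
  obtain ⟨u, rfl⟩ := m2_s u
  have ht' := mem_bl.1 ht
  rw [EH_mk h hs, DH_mk h ω ω, DH_mk h ω ω, EH_mk h hs, Eu_D h ht hs, map_add]
  split_ifs
  · rw [m2_d]
  · rw [map_zero]
lemma S2_gen (h : CC (n+2) κ Φ D v) (W : Submodule ℂ (N2 Φ D n)) (hv : v2 h ∈ W)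
    (hW : ∀ i j, i < n → j < n → ∀ u ∈ W, Φ2 h (ent i j) u ∈ W ∧ D2 Φ D n i j u ∈ W) : W = ⊤ := by
  set N1 := W.map (N2 Φ D n).subtype with hN1
  set A : ℕ × ℕ → Module.End ℂ (Q2 D n) := fun t => - DH D n t.1 t.2 with hA
  set W1 := clo A (bl n) N1 with hW1
  have stD : ∀ {t}, t ∈ bl n → ∀ {u}, u ∈ W1 → DH D n t.1 t.2 u ∈ W1 := by
    intro t ht u hu
    have := clo_st ht hu
    simpa [hA] using this
  have pres : ∀ (Y : Module.End ℂ (Q2 D n)), (∀ t ∈ bl n, ∃ c : ℂ, ∀ u, Y (DH D n t.1 t.2 u) = DH D n t.1 t.2 (Y u) + c • u) →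
      (∀ u ∈ N1, Y u ∈ W1) → ∀ {u}, u ∈ W1 → Y u ∈ W1 := by
    intro Y h1 h2 u hu
    refine clo_pres Y (fun t ht => ?_) h2 hu
    obtain ⟨c, hc⟩ := h1 t ht
    exact ⟨-c, fun u => by simp only [hA, ngA, map_neg, hc]; module⟩
  have stX0 : ∀ {p q}, p < n → q < n → ∀ {u}, u ∈ W1 → ΦH h (ent p q) u ∈ W1 := by
    intro p q hp hq u hu
    refine pres _ (fun t ht => ⟨0, fun u => ?_⟩) ?_ hu
    · obtain ⟨u, rfl⟩ := m2_s u
      have ht' := mem_bl.1 ht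
      rw [DH_mk h ω ω, ΦH_ent h hp, ΦH_ent h hp, DH_mk h ω ω, zero_smul, add_zero]
      congr 1
      refine (cm_app0 ?_ u).symm
      rw [h.DX _ _ _ _ ω ω ω ω, dl_ne (show t.2 ≠ q by omega), dl_ne (show t.2 ≠ p by omega)]
      simp
    · rintro _ ⟨w, hw, rfl⟩
      exact clo_le ⟨_, (hW p q hp hq w hw).1, Φ2_ent h hp hq w⟩
  have stDh : ∀ {p q}, p < n → q < n → ∀ {u}, u ∈ W1 → DhH D n p q u ∈ W1 := by
    intro p q hp hq u hu
    refine pres _ (fun t ht => ⟨0, fun u => ?_⟩) ?_ hu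
    · obtain ⟨u, rfl⟩ := m2_s u
      have ht' := mem_bl.1 ht
      rw [DH_mk h ω ω, DhH_mk h hp hq, DhH_mk h hp hq, DH_mk h ω ω, zero_smul, add_zero,
        cm_app0 (Dh_D h ω ω ω ω)]
    · rintro _ ⟨w, hw, rfl⟩
      exact clo_le ⟨_, (hW p q hp hq w hw).2, D2_coe h hp hq w⟩
  have stE : ∀ {s}, s ∈ bl n → ∀ {u}, u ∈ W1 → EH Φ D n s u ∈ W1 := by
    intro s hs u hu
    refine pres _ (fun t ht => ?_) ?_ hu
    · by_cases hst : s = t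
      · exact ⟨-1, fun u => by rw [EH_D h ht hs, if_pos hst]; module⟩
      · exact ⟨0, fun u => by rw [EH_D h ht hs, if_neg hst]; module⟩
    · rintro _ ⟨w, hw, rfl⟩
      have := mem_N2.1 w.2 s hs
      rw [Submodule.subtype_apply, this]; exact zero_mem _
  have stDl : ∀ {c j}, n ≤ c → c < n+2 → j < n → ∀ {u}, u ∈ W1 → DH D n c j u ∈ W1 := by
    intro c j hc hc' hj u hu
    have h1 := stD (t := (j,c)) (by rw [mem_bl]; simp; omega) hu
    obtain ⟨u, rfl⟩ := m2_s u
    rw [DH_mk h ω ω] at h1 ⊢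
    rw [h.Dsk j c ω ω, ngA, map_neg]
    exact neg_mem h1
  have stX1 : ∀ {t}, t ∈ bl n → ∀ {u}, u ∈ W1 → ΦH h (X t) u ∈ W1 := by
    intro t ht u hu
    obtain ⟨c, hc, hc2, ε, e⟩ := X_EH h ht
    rw [e]
    refine add_mem (stE ht hu) (Submodule.sum_mem _ fun j hj => Submodule.smul_mem _ _ (stX0 (mem_bl.1 ht).1 (Finset.mem_range.1 hj) ?_))
    exact stDl hc2 hc (Finset.mem_range.1 hj) hu
  have key : W1.comap (m2 D n) = ⊤ := by
    apply h.genL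
    · exact clo_le ⟨v2 h, hv, rfl⟩
    intro W' hW' hE u hu
    have u0 : m2 D n u ∈ W1 := hW' hu
    have D0 : ∀ p q, p < q → q < n+2 → m2 D n (D p q u) ∈ W1 := by
      intro p q hp hq
      by_cases hqn : q < n
      · have e : m2 D n (D p q u) = DhH D n p q (m2 D n u) + (DH D n n p (DH D n (n+1) q (m2 D n u)) - DH D n n q (DH D n (n+1) p (m2 D n u))) := by
          rw [DhH_mk h ω hqn, DH_mk h ω ω, DH_mk h ω ω, DH_mk h ω ω,
            DH_mk h ω ω, ← map_sub, ← map_add, Dh, sbA, sbA,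
            mAp, mAp, mAp, sub_add_cancel, m2_d]
        rw [e]
        exact add_mem (stDh ω hqn u0) (sub_mem (stDl ω ω ω (stDl ω ω ω u0))
          (stDl ω ω ω (stDl ω ω ω u0)))
      · by_cases hpn : p < n
        · rw [← DH_mk h ω ω]
          exact stD (t := (p,q)) (by rw [mem_bl]; simp; omega) u0
        · obtain rfl : p = n := by omega
          obtain rfl : q = p+1 := by omega
          rw [m2_d]; exact u0
    have X0 : ∀ p q, p < q → q < n+2 → m2 D n (Φ (ent p q) u) ∈ W1 := by
      intro p q hp hq
      by_cases hpn : p < n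
      · rw [← ΦH_ent h hpn]
        by_cases hqn : q < n
        · exact stX0 hpn hqn u0
        · rw [ent_lt hp]; exact stX1 (by rw [mem_bl]; simp; omega) u0
      · obtain rfl : p = n := by omega
        obtain rfl : q = p+1 := by omega
        have e := congrArg (m2 D p) (LinearMap.congr_fun (show Eo Φ D (p+2) p p = ∑ j ∈ Finset.range (p+2), Φ (ent p j) * D p j from rfl) u)
        rw [srS, srS, ent_self, map_zero, zero_mul, add_zero, adA, map_add,
          mAp, LinearMap.sum_apply, map_sum] at e
        have e2 := cm_app (h.DX p (p+1) p (p+1) ω ω ω ω) u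
        rw [dl_self, dl_self, dl_ne (show p ≠ p+1 by omega)] at e2
        have e3 := congrArg (m2 D p) e2
        rw [m2_d, map_add] at e3
        have e4 : m2 D p (Φ (ent p (p+1)) u) = m2 D p (Eo Φ D (p+2) p p u) + m2 D p u
          - ∑ j ∈ Finset.range p, m2 D p ((Φ (ent p j) * D p j) u) := by
          rw [e3, e]; simp; abel
        rw [e4]
        refine sub_mem (add_mem (hW' (hE p p ω ω u hu)) u0) (Submodule.sum_mem _ fun j hj => ?_)
        have hj := Finset.mem_range.1 hj
        rw [mAp, Xsk j p, ngA, map_neg, neg_mem_iff, ← ΦH_ent h hj, ← DH_mk h ω ω,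
          ent_lt hj]
        exact stX1 (by rw [mem_bl]; simp; omega) (stDl le_rfl ω hj u0)
    intro p q hp hq
    simp only [Submodule.mem_comap]
    rcases lt_trichotomy p q with hpq | rfl | hpq
    · exact ⟨X0 p q hpq hq, D0 p q hpq hq⟩
    · rw [ent_self, h.Dself hp]; simp
    · rw [Xsk q p, h.Dsk q p hq hp, ngA, ngA, map_neg, map_neg, neg_mem_iff, neg_mem_iff]
      exact ⟨X0 q p hpq hp, D0 q p hpq hp⟩
  rw [eq_top_iff]
  rintro ⟨w, hw⟩ _
  have hw1 : w ∈ W1 := by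
    obtain ⟨u, rfl⟩ := m2_s w
    have : u ∈ W1.comap (m2 D n) := key ▸ Submodule.mem_top
    exact this
  obtain ⟨_, ⟨w', hw', rfl⟩, r, hr, e⟩ := Submodule.mem_sup.1 (clo_sup hw1)
  have hr0 : r = 0 := by
    refine disj (EH Φ D n) A (bl n) (nd_bl n) ?_ ?_ ?_ ?_ ?_ ⊤ (fun _ _ _ _ => ⟨trivial, trivial⟩) r hr ?_
    · intro t ht s hs hst u
      have := EH_D h hs ht u
      rw [if_neg (Ne.symm hst), add_zero] at this
      simp only [hA, ngA, map_neg, this]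
    · intro t ht u
      have := EH_D h ht ht u
      rw [if_pos rfl] at this
      simp only [hA, ngA, map_neg, this]; abel
    · exact fun t ht => LNil_surj _ m2_s _ _ (fun u => (EH_mk h ht u).symm) (Eu_nil h ht)
    · intro t ht s hs u
      obtain ⟨u, rfl⟩ := m2_s u
      rw [EH_mk h hs, EH_mk h ht, EH_mk h ht, EH_mk h hs, Eu_comm h ht hs]
    · intro t ht s hs u
      obtain ⟨u, rfl⟩ := m2_s u
      rw [mem_bl] at ht hs
      simp only [hA, ngA, map_neg]
      rw [DH_mk h ω ω, DH_mk h ω ω, DH_mk h ω ω, DH_mk h ω ω,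
        cm_app0 (h.DD _ _ _ _ ω ω ω ω)]
    · intro t ht
      have : r = w - w' := by rw [← e]; simp
      rw [this, map_sub, mem_N2.1 hw t ht, mem_N2.1 w'.2 t ht, sub_zero]
  rw [hr0, add_zero] at e
  have : (⟨w, hw⟩ : N2 Φ D n) = w' := Subtype.ext e.symm
  rw [this]; exact hw'
lemma S2_CC (h : CC (n+2) (κ+1) Φ D v) : CC n κ (Φ2 h) (D2 Φ D n) (v2 h) where
  out p hp := by
    apply LinearMap.ext; intro w; apply Subtype.ext
    rw [Φ2_coe, ΦE, AlgHom.comp_apply, en_X, if_neg hp, map_zero]; rfl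
  Dsk i j hi hj := by
    apply LinearMap.ext; intro w; apply Subtype.ext
    rw [ngA, Submodule.coe_neg, D2_coe h hj hi, D2_coe h hi hj]
    obtain ⟨w, hw⟩ := w
    obtain ⟨u, rfl⟩ := m2_s w
    simp only
    rw [DhH_mk h hj hi, DhH_mk h hi hj, ← map_neg, ← ngA]
    congr 2
    unfold Dh
    rw [h.Dsk i j ω ω, mul_neg]
    abel
  DD i j k l hi hj hk hl := by
    apply cm_of; intro w; apply Subtype.ext
    rw [D2_coe h hi hj, D2_coe h hk hl, D2_coe h hk hl, D2_coe h hi hj]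
    obtain ⟨w, hw⟩ := w
    obtain ⟨u, rfl⟩ := m2_s w
    simp only
    rw [DhH_mk h hi hj, DhH_mk h hk hl, DhH_mk h hk hl, DhH_mk h hi hj]
    congr 1
    refine cm_app0 ?_ u
    have e : ∀ a b, a < n+2 → b < n+2 → cm (Dh D n i j) (D a b) = 0 := fun a b ha hb => Dh_D h ω ω ha hb
    conv_lhs => arg 2; unfold Dh
    rw [cm_subR, cm_subR, cm_mulR, cm_mulR, cm_mulR, e k l ω ω, e n k ω ω,
      e n l ω ω, e (n+1) k ω ω, e (n+1) l ω ω, e n (n+1) ω ω]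
    simp
  DX i j k l hi hj hk hl := by
    apply LinearMap.ext; intro w; apply Subtype.ext
    simp only [cm, sbA, mAp]
    rw [Submodule.coe_sub, D2_coe h hi hj, Φ2_ent h hk hl, Φ2_ent h hk hl, D2_coe h hi hj]
    obtain ⟨w, hw⟩ := w
    obtain ⟨u, rfl⟩ := m2_s w
    simp only [smA, onA, Submodule.coe_smul]
    rw [DhH_mk h hi hj, ΦH_ent h hk, ΦH_ent h hk, DhH_mk h hi hj, cm_app (Dh_X h hi hj hk hl), map_add, add_sub_cancel_left,
      smA, map_smul, m2_d]
  v0 e := S2_v h (congrArg Subtype.val e)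
  gen := S2_gen h
  ev i l hi hl := by
    apply Subtype.ext
    rw [LinearMap.sum_apply, AddSubmonoidClass.coe_finsetSum]
    have e := congrArg (m2 D n) (ev2v h hi hl)
    rw [LinearMap.sum_apply, map_sum, map_smul, m2_d] at e
    rw [Submodule.coe_smul]
    refine Eq.trans (Finset.sum_congr rfl fun j hj => ?_) (e.trans ?_)
    · have hj := Finset.mem_range.1 hj
      rw [mAp, mAp, Φ2_ent h hi hj, D2_coe h hl hj, ← ΦH_ent h hi, ← DhH_mk h hl hj]; rfl
    · congr 1
      push_cast; ring
  tf := S2_tf h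
end S2
end SkewLC
end

section
namespace SkewLC
open MvPolynomial
section S3
def jv (p : ℕ × ℕ) : ℂ := if p.2 = p.1 + 1 ∧ p.1 % 2 = 0 then 1 else 0
def jp (i : ℕ) : ℕ := if i % 2 = 0 then i + 1 else i - 1
lemma jv_ent (i j : ℕ) : aeval jv (ent i j) = if j = jp i then (if i % 2 = 0 then (1:ℂ) else -1) else 0 := by
  unfold ent jp
  split_ifs <;> simp [jv] <;> omega
def gA (N : ℕ) : Matrix (Fin N) (Fin N) P2 := Matrix.of fun i j => ent i j
lemma det_gA (r : ℕ) : en (2*r) (gA (2*r)).det ≠ 0 := by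
  have e : en (2*r) (gA (2*r)).det = (gA (2*r)).det := by
    rw [AlgHom.map_det]
    congr 1
    ext1 i j
    exact en_ent i.2 j.2
  rw [e]
  intro h0
  have h1 : ((gA (2*r)).map (aeval (R := ℂ) jv)).det = 0 := by
    have := AlgHom.map_det (aeval (R := ℂ) jv) (gA (2*r))
    rw [h0, map_zero] at this
    exact this.symm
  have h2 : ((gA (2*r)).map (aeval (R := ℂ) jv)) * ((gA (2*r)).map (aeval (R := ℂ) jv)) = -1 := by
    ext i k
    have hp : jp i < 2 * r := by have := i.2; unfold jp; split_ifs <;> omega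
    rw [Matrix.mul_apply, Finset.sum_eq_single (⟨jp i, hp⟩ : Fin (2*r))]
    · simp only [gA, Matrix.map_apply, Matrix.of_apply, jv_ent, Matrix.neg_apply, Matrix.one_apply, Fin.ext_iff]
      unfold jp
      split_ifs <;> first | omega | simp
    · intro b _ hb
      have : (b:ℕ) ≠ jp i := fun e => hb (Fin.ext e)
      simp only [gA, Matrix.map_apply, Matrix.of_apply, jv_ent, if_neg this, zero_mul]
    · simp
  have h3 := congrArg Matrix.det h2
  rw [Matrix.det_mul, h1, zero_mul] at h3
  have h4 : ((-1 : Matrix (Fin (2*r)) (Fin (2*r)) ℂ)).det * ((-1 : Matrix (Fin (2*r)) (Fin (2*r)) ℂ)).det = 1 := by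
    rw [← Matrix.det_mul]; simp
  rw [← h3] at h4
  simp at h4
variable {M : Type} [AddCommGroup M] [Module ℂ M]
variable {Φ : Rp (ℕ × ℕ) M} {D : ℕ → ℕ → Module.End ℂ M} {n : ℕ}
variable {κ : ℕ} {v : M}
lemma Dv0 {r : ℕ} (h : CC (2*r) 0 Φ D v) {k l : ℕ} (hk : k < 2*r) (hl : l < 2*r) : D l k v = 0 := by
  apply h.tf _ (det_gA r)
  rw [map_zero]
  have e0 : ∀ i : Fin (2*r), ∑ j : Fin (2*r), Φ (ent i j) (D l j v) = 0 := by
    intro i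
    have := h.ev i l i.2 hl
    rw [Finset.sum_range] at this
    simpa using this
  have e1 : ∑ i : Fin (2*r), Φ ((gA (2*r)).adjugate ⟨k,hk⟩ i) (∑ j : Fin (2*r), Φ (ent i j) (D l j v)) = 0 := by
    simp [e0]
  simp only [map_sum] at e1
  rw [Finset.sum_comm] at e1
  have e2 : ∀ j : Fin (2*r), ∑ i : Fin (2*r), Φ ((gA (2*r)).adjugate ⟨k,hk⟩ i) (Φ (ent i j) (D l j v)) =
      if j = ⟨k,hk⟩ then Φ (gA (2*r)).det (D l k v) else 0 := by
    intro j
    have := congrFun (congrFun (Matrix.adjugate_mul (gA (2*r))) ⟨k,hk⟩) j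
    rw [Matrix.mul_apply] at this
    have t2 := congrArg (fun f => Φ f (D l j v)) this
    simp only [map_sum, map_mul, LinearMap.sum_apply, mAp] at t2
    refine Eq.trans t2 ?_
    split_ifs with hj
    · subst hj; simp
    · rw [Matrix.smul_apply, Matrix.one_apply_ne (Ne.symm hj)]; simp
  simp only [e2, Finset.sum_ite_eq', Finset.mem_univ, if_true] at e1
  exact e1
lemma nil0 {r : ℕ} (h : CC (2*r) 0 Φ D v) {k l : ℕ} (hk : k < 2*r) (hl : l < 2*r) : LNil (D k l) := by
  set T := D k l with hT
  have hm : ∀ u, u ∈ T.maxGenEigenspace 0 ↔ ∃ a : ℕ, (T ^ a) u = 0 := by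
    intro u; simp [Module.End.mem_maxGenEigenspace]
  have : T.maxGenEigenspace 0 = ⊤ := by
    apply h.gen
    · rw [hm]; exact ⟨1, by simpa using Dv0 h hl hk⟩
    · intro i j hi hj u hu
      rw [hm] at hu
      obtain ⟨a, ha⟩ := hu
      constructor
      · rw [hm]
        set c := (dl k i * dl l j - dl k j * dl l i)
        have h1 : ∀ u, T (Φ (ent i j) u) = Φ (ent i j) (T u) + c • u := fun u => by
          rw [cm_app (h.DX k l i j hk hl hi hj) u]; rfl
        have h2 : ∀ (a : ℕ) u, (T ^ (a+1)) (Φ (ent i j) u) = Φ (ent i j) ((T ^ (a+1)) u) + (((a:ℂ)+1) * c) • (T ^ a) u := by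
          intro a
          induction a with
          | zero => intro u; simp [h1]
          | succ a ih =>
            intro u
            have e1 : ∀ k w, (T ^ (k+1)) w = T ((T ^ k) w) := fun k w => by rw [pow_succ']; rfl
            rw [e1 (a+1), ih, map_add, map_smul, h1, e1 (a+1), ← e1 a]
            push_cast
            module
        exact ⟨a+1, by rw [h2, pow_succ', mAp, ha]; simp⟩
      · rw [hm]
        refine ⟨a, ?_⟩
        have : Commute (T ^ a) (D i j) := Commute.pow_left (sub_eq_zero.1 (h.DD k l i j hk hl hi hj)) a
        rw [← mAp, this.eq, mAp, ha, map_zero]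
  intro u
  exact (hm u).1 (this ▸ Submodule.mem_top)
lemma KH_sub0 {τ Q : Type} [AddCommGroup Q] [Module ℂ Q] [Subsingleton Q] (Ψ : Rp τ Q) (L : List τ) (j : ℤ) : Dm (KH Ψ L j) 0 := by
  apply Dm_zero
  intro x
  obtain ⟨a, h1, h2, rfl⟩ := k_ind x
  rw [kmk_zero_iff (show (j-1)+1 = j by omega)]
  exact ⟨0, zero_mem _, by rw [map_zero]; exact Subsingleton.elim _ _⟩
lemma b0 {r : ℕ} (e : n + 2 = 2*r) (h : CC (n+2) 0 Φ D v) (L j) : Dm (KH (ΦH h) L j) 0 := by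
  have : Subsingleton (Q2 D n) := by
    rw [Submodule.Quotient.subsingleton_iff, eq_top_iff]
    intro u _
    obtain ⟨k, hk⟩ := nil0 (e ▸ h) (k := n) (l := n+1) ω ω u
    have := pow_sub_mem (f := D n (n+1)) k u
    rw [hk, zero_sub] at this
    exact neg_mem_iff.1 this
  exact KH_sub0 _ _ _
lemma thS_sum {τ : Type} (Φ : Rp τ M) (D : τ → Module.End ℂ M) (θ0 : Module.End ℂ M) (bs : List τ) (u) :
    thS Φ D θ0 bs u = θ0 u - (bs.map fun t => Φ (X t) (D t u)).sum := by
  induction bs with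
  | nil => simp [thS]
  | cons t bs ih => rw [thS_cons, ih, List.map_cons, List.sum_cons]; abel
lemma xd (h : CC (n+2) κ Φ D v) (u) :
    thS Φ (fun t => D t.1 t.2) (Eo Φ D (n+2) n n) (b1 n) u = xo Φ n (D n (n+1) u) := by
  rw [thS_sum, b1, List.map_map]
  have : (List.map ((fun t => Φ (X t) (D t.1 t.2 u)) ∘ fun i => (i, n)) (List.range n)).sum =
    ∑ i ∈ Finset.range n, Φ (X (i,n)) (D i n u) := rfl
  rw [this, Eo, srS, srS, ent_self, ent_lt (Nat.lt_succ_self n)]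
  have e : ∀ i ∈ Finset.range n, Φ (ent n i) * D n i = Φ (X (i,n)) * D i n := by
    intro i hi
    rw [Finset.mem_range] at hi
    rw [Xsk, h.Dsk i n ω ω, ent_lt hi, neg_mul_neg]
  rw [Finset.sum_congr rfl e]
  simp
lemma xdInt (h : CC (n+2) κ Φ D v) (L : List (ℕ × ℕ)) (hL : ∀ t, t ∈ L ↔ t.1 < t.2 ∧ t.2 < n) :
    ∃ h' : Cm Φ Φ (bl n ++ L) (thS Φ (fun t => D t.1 t.2) (Eo Φ D (n+2) n n) (b1 n)),
      ∀ j, IntA (Hf Φ Φ h' j) := by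
  rw [bl, List.append_assoc]
  have hm : ∀ t ∈ b1 n ++ (b2 n ++ L), t.1 < t.2 ∧ t.2 < n + 2 := by
    intro t ht
    rw [List.mem_append, List.mem_append, mem_b1, mem_b2, hL] at ht; omega
  have hm2 : ∀ t ∈ b2 n ++ L, t.1 < t.2 ∧ t.2 < n + 2 ∧ t.1 < n ∧ t.2 ≠ n := by
    intro t ht
    rw [List.mem_append, mem_b2, hL] at ht; omega
  refine conesInt Φ _ _ _ ?_ (h.intE ω) _ (nd_b1 n) ?_ ?_ ?_ ?_
  · intro t ht u
    obtain ⟨h1, h2, h3, h4⟩ := hm2 t ht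
    have := h.cEX (i := n) (l := n) (p := t.1) (q := t.2) ω ω ω ω
    rw [dl_ne ω, dl_ne (Ne.symm h4), ent_lt h1] at this
    exact cm_app0 (by simpa using this) u
  · intro t ht u
    rw [mem_b1] at ht
    have := h.cEX (i := n) (l := n) (p := t.1) (q := t.2) ω ω ω ω
    rw [dl_ne ω, ht.2, dl_self, Xsk t.1 n, ent_lt ht.1] at this
    have e : t = (t.1, n) := by rw [← ht.2]
    rw [e]
    rw [cm_app this u]; simp
  · intro t ht s hs hst u
    have h1 := hm s hs
    rw [mem_b1] at ht
    refine DX0 h ω ω h1 (fun e => hst e) (fun e => ?_) u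
    rw [e] at h1; simp at h1; omega
  · intro t ht u
    rw [mem_b1] at ht
    exact DX1 h ω u
  · intro t ht ht2
    rw [mem_b1] at ht
    have := hm2 t ht2
    omega
lemma step (h : CC (n+2) κ Φ D v) (L : List (ℕ × ℕ)) (hL : ∀ t, t ∈ L ↔ t.1 < t.2 ∧ t.2 < n) (a b : ℤ → ℕ)
    (ha : ∀ i, Dm (KH (Φ1 Φ n) L i) (a i)) (hb : ∀ j, Dm (KH (ΦH h) (bl n ++ L) j) (b j))
    (hab : ∀ j : ℤ, a (j - 2*n) = 0 ∨ b j = 0) (j : ℤ) :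
    Dm (KH Φ ((n,n+1) :: (bl n ++ L)) j) (a (j - 1 - 2*n) + b j) := by
  have hm : ∀ t ∈ bl n ++ L, t.1 < t.2 ∧ t.2 < n + 2 ∧ t ≠ (n,n+1) ∧ t ≠ (n+1,n) := by
    intro t ht
    rw [List.mem_append, mem_bl, hL] at ht
    refine ⟨by omega, by omega, fun e => ?_, fun e => ?_⟩ <;> rw [e] at ht <;> simp at ht
  have hx := Cm.rho Φ (bl n ++ L) (X (n,n+1))
  have hd : Cm Φ Φ (bl n ++ L) (D n (n+1)) := fun t ht u =>
    DX0 h ω ω ⟨(hm t ht).1, (hm t ht).2.1⟩ (hm t ht).2.2.1 (hm t ht).2.2.2 u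
  obtain ⟨hT, IT⟩ := xdInt h L hL
  have hxD : ∀ j u, Hf Φ Φ hT j u = Hf Φ Φ hx j (Hf Φ Φ hd j u) := fun j u =>
    Hf_comp Φ Φ Φ hd hx hT (fun w => xd h w) j u
  have hW : ∀ j u, Hf Φ Φ hd j (Hf Φ Φ hx j u) = Hf Φ Φ hx j (Hf Φ Φ hd j u) + u :=
    Hf_weyl Φ hd hx (fun u => DX1 h (s := (n,n+1)) ⟨by simp, by simp⟩ u)
  have X1 : ∀ j, Nonempty ((KH Φ (bl n ++ L) j ⧸ LinearMap.range ((Hf Φ Φ hx j : Module.End ℂ _) - 1)) ≃ₗ[ℂ] KH (ΦQ Φ n) (bl n ++ L) j) := by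
    obtain ⟨π, g, hg, -, -⟩ := S1_gr h
    refine quotLem Φ (ΦQ Φ n) hx (g1 g hg) ?_ (q := (U1 Φ n).mkQ) (fun t _ u => (ΦQ_mk Φ n _ u).symm) (mkS _) ?_
    · intro j x hxx
      obtain ⟨π, g, -, -, hw⟩ := IntA_grad _ (IT j)
      refine g1 g (f := Hf Φ Φ hx j) (hw _ 1 fun u => ?_) x hxx
      rw [hxD, hW, hxD, map_add]; simp
    · intro u
      rw [Submodule.mkQ_apply, qz]; rfl
  have X2 : ∀ j, Nonempty ((KH Φ (bl n ++ L) j ⧸ LinearMap.range ((Hf Φ Φ hd j : Module.End ℂ _) - 1)) ≃ₗ[ℂ] KH (ΦH h) (bl n ++ L) j) := by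
    obtain ⟨π, g, hg, -, -⟩ := S2_gr h
    refine quotLem Φ (ΦH h) hd (g1 g hg) ?_ (q := m2 D n) (fun t ht u => (ΦH_X h (hm t ht).2.2.1 u).symm) m2_s (fun _ => m2_zero)
    intro j x hxx
    obtain ⟨π, g, -, -, hw⟩ := IntA_grad _ (IT j)
    have := hw (Hf Φ Φ hd j) (-1) fun u => by rw [hxD, hxD, hW]; simp
    refine g1 (GrOK.neg g) (f := Hf Φ Φ hd j) (fun a u => ?_) x hxx
    rw [this]; congr 2; ring
  have key : ∀ j, Dm (LinearMap.ker (Hf Φ Φ hx j)) (b j) ∧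
      Dm (KH Φ (bl n ++ L) j ⧸ LinearMap.range (Hf Φ Φ hx j)) (a (j - 2*n)) := by
    intro j
    refine weylDims _ (Hf Φ Φ hd j) (Hf Φ Φ hT j) (hW j) (hxD j) (IT j) ?_ ((hb j).equiv ?_) (hab j)
    · obtain ⟨e1⟩ := (S1_W h L (fun t ht => (hL t).1 ht)).1 (j - 2*n) j (by rw [len_bl]; ring)
      obtain ⟨e2⟩ := X1 j
      exact (ha _).equiv ⟨e1.symm.trans e2.symm⟩
    · exact (X2 j).map LinearEquiv.symm
  refine Dm.ext (cι Φ (n,n+1) (bl n ++ L) (sub_add_cancel j 1)) (cπ Φ (n,n+1) (bl n ++ L) j) (cone_exact1 _ _ _ _) ?_ ?_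
  · have ex := cone_exact3 Φ (n,n+1) (bl n ++ L) (sub_add_cancel j 1)
    refine (key (j-1)).2.equiv ⟨(Submodule.quotEquivOfEq _ _ ?_).trans (LinearMap.quotKerEquivRange _)⟩
    ext u; exact (ex u).symm
  · have ex := cone_exact2 Φ (n,n+1) (bl n ++ L) j
    refine (key j).1.equiv ⟨LinearEquiv.ofEq _ _ ?_⟩
    ext u; exact ex u
end S3
end SkewLC
end

section
namespace SkewLC
open MvPolynomial
def LL : ℕ → List (ℕ × ℕ)
  | 0 => []
  | m+1 => (2*m, 2*m+1) :: (bl (2*m) ++ LL m)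
lemma mem_LL (m : ℕ) (t : ℕ × ℕ) : t ∈ LL m ↔ t.1 < t.2 ∧ t.2 < 2*m := by
  induction m with
  | zero => simp [LL]
  | succ m ih =>
    obtain ⟨a, b⟩ := t
    simp only [LL, List.mem_cons, List.mem_append, mem_bl, ih, Prod.mk.injEq]
    omega
def cc : ℕ → ℕ → ℤ → ℕ
  | 0, 0, j => if j = 1 then 1 else 0
  | 0, _+1, _ => 0
  | m+1, 0, j => cc m 0 (j-1-4*(m+1))
  | m+1, κ+1, j => cc m (κ+1) (j-1-4*(m+1)) + cc m κ j
lemma cc_mod (m κ : ℕ) (j : ℤ) (h : cc m κ j ≠ 0) : (4:ℤ) ∣ j - (m+1-κ) := by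
  induction m generalizing κ j with
  | zero =>
    cases κ with
    | zero =>
      simp only [cc] at h
      split_ifs at h with hj
      · subst hj; simp
      · exact absurd rfl h
    | succ κ => simp [cc] at h
  | succ m ih =>
    cases κ with
    | zero => have := ih _ _ h; push_cast at *; omega
    | succ κ =>
      rcases Nat.add_eq_zero_iff.not.1 h |> not_and_or.1 with h1 | h1
      · have := ih _ _ h1; push_cast at *; omega
      · have := ih _ _ h1; push_cast at *; omega
section
variable {τ : Type} {M : Type} [AddCommGroup M] [Module ℂ M]
lemma KHn0 (Φ : Rp τ M) {j : ℤ} (hj : j ≠ 0) (x : KH Φ [] j) : x = 0 := by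
  obtain ⟨a, h1, h2, rfl⟩ := k_ind x
  rw [kmk_zero_iff (sub_add_cancel j 1)]
  rw [mem_grV_nil] at h1
  refine ⟨0, zero_mem _, ?_⟩
  rw [map_zero]
  funext w
  by_cases hw : w = []
  · rw [hw, h1.2 hj]; rfl
  · rw [h1.1 w hw]; rfl
lemma KHn1 (Φ : Rp τ M) : ∃ e : M ≃ₗ[ℂ] KH Φ [] 0, ∀ f (hf : Cm Φ Φ [] f) u, Hf Φ Φ hf 0 (e u) = e (f u) := by
  have hg : ∀ u : M, (Pi.single [] u : VV M) ∈ grV (τ := τ) M [] 0 := fun u => by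
    rw [mem_grV_nil]; exact ⟨fun w hw => by simp [hw], by simp⟩
  have hd : ∀ u : M, dK Φ [] (Pi.single [] u : VV M) = 0 := fun u => by rw [dK_nil]; rfl
  let G : M →ₗ[ℂ] KH Φ [] 0 :=
    { toFun := fun u => kmk Φ [] 0 (Pi.single [] u) (hg u) (hd u)
      map_add' := fun u w => (kmk_congr (Pi.single_add _ _ _) _ _ _ _).trans (kmk_add _ (hg u) (hd u) _ (hg w) (hd w)).symm
      map_smul' := fun c u => (kmk_congr (Pi.single_smul _ _ _) _ _ _ _).trans (kmk_smul c _ (hg u) (hd u)).symm }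
  have hG : Function.Bijective G := by
    constructor
    · rw [inj0]
      intro u hu
      obtain ⟨b, -, hb⟩ := (kmk_zero_iff (show (-1:ℤ)+1 = 0 by omega) _ (hg u) (hd u)).1 hu
      have := congrFun hb []
      simpa using this.symm
    · intro x
      obtain ⟨a, h1, h2, rfl⟩ := k_ind x
      refine ⟨a [], kmk_congr ?_ (hg _) (hd _) h1 h2⟩
      funext w
      by_cases hw : w = []
      · subst hw; simp
      · rw [(mem_grV_nil.1 h1).1 w hw]; simp [hw]
  refine ⟨LinearEquiv.ofBijective G hG, fun f hf u => ?_⟩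
  show Hf Φ Φ hf 0 (kmk Φ [] 0 (Pi.single [] u) (hg u) (hd u)) = kmk Φ [] 0 (Pi.single [] (f u)) (hg _) (hd _)
  rw [Hf_mk]
  apply kmk_congr
  funext w
  show f ((Pi.single [] u : VV M) w) = _
  by_cases hw : w = []
  · subst hw; simp
  · simp [hw]
end
section
variable {M : Type} [AddCommGroup M] [Module ℂ M]
variable {Φ : Rp (ℕ × ℕ) M} {D : ℕ → ℕ → Module.End ℂ M} {κ : ℕ} {v : M}
lemma KHnil (h : CC 0 κ Φ D v) (i : ℤ) : Dm (KH Φ [] i) (if i = 0 then 1 else 0) := by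
  split_ifs with hi
  · subst hi
    obtain ⟨e, -⟩ := KHn1 Φ
    refine Dm.equiv ?_ ⟨e⟩
    have hs : Submodule.span ℂ {v} = ⊤ := h.gen _ (Submodule.mem_span_singleton_self v) (fun i j hi => absurd hi ω)
    have e2 := LinearEquiv.toSpanNonzeroSingleton ℂ M v h.v0
    exact Dm.equiv (H := ℂ) ⟨inferInstance, Module.finrank_self ℂ⟩ ⟨e2.trans ((LinearEquiv.ofEq _ _ hs).trans Submodule.topEquiv)⟩
  · exact Dm_zero (KHn0 Φ hi)
lemma base0 (h : CC 2 0 Φ D v) (j : ℤ) : Dm (KH Φ [(0,1)] j) (cc 0 0 j) := by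
  have h1 : CC 0 0 (Φ1 Φ 0) (D1 Φ D 0) (p1 Φ 0 v) := S1_CC h
  have := step (n := 0) h [] (by simp) _ (fun _ => 0) (KHnil h1) (fun j => b0 (r := 1) rfl h _ j) (fun _ => Or.inr rfl) j
  simp only [Nat.cast_zero, mul_zero, sub_zero, add_zero, sub_eq_zero] at this
  exact this
lemma base1 (h : CC 2 (κ+1) Φ D v) (j : ℤ) : Dm (KH Φ [(0,1)] j) 0 := by
  set x := Φ (X (0,1)) with hx
  set d := D 0 1 with hd
  have W : ∀ u, d (x u) = x (d u) + u := fun u => DX1 (n := 0) h (s := (0,1)) ⟨by simp, by simp⟩ u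
  have ev : x (d v) = (-(2 * ((κ:ℂ)+1))) • v := by
    have := h.ev 0 0 ω ω
    simpa [srS, ent_self, ent_lt, dl_self] using this
  have ev2 : ∀ N : ℕ, x ((d ^ (N+1)) v) = (-(2 * ((κ:ℂ)+1)) - N) • (d ^ N) v := by
    intro N
    cases N with
    | zero => simp [ev]
    | succ N =>
      have := weyl_pow' d x W N (d v)
      rw [ev, map_smul, ← mAp (d ^ (N+1)), ← pow_succ, ← mAp (d ^ N), ← pow_succ] at this
      rw [eq_sub_of_add_eq this.symm]
      push_cast
      module
  have ev3 : ∀ N : ℕ, (d ^ N) v ∈ LinearMap.range x := by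
    intro N
    have c : (-(2 * ((κ:ℂ)+1)) - N) ≠ 0 := by
      have : ((2 * (κ+1) + N : ℕ) : ℂ) ≠ 0 := by exact_mod_cast ω
      push_cast at this
      intro e; apply this; linear_combination -e
    refine ⟨(-(2 * ((κ:ℂ)+1)) - N)⁻¹ • (d ^ (N+1)) v, ?_⟩
    rw [map_smul, ev2, smul_smul, inv_mul_cancel₀ c, one_smul]
  have top : (⨅ N : ℕ, (LinearMap.range x).comap (d ^ N)) = ⊤ := by
    have sx : ∀ u ∈ (⨅ N : ℕ, (LinearMap.range x).comap (d ^ N)), x u ∈ (⨅ N : ℕ, (LinearMap.range x).comap (d ^ N)) := by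
      intro u hu
      simp only [Submodule.mem_iInf, Submodule.mem_comap] at hu ⊢
      intro N
      cases N with
      | zero => exact ⟨u, rfl⟩
      | succ N => rw [weyl_pow' d x W]; exact add_mem ⟨_, rfl⟩ (Submodule.smul_mem _ _ (hu N))
    have sd : ∀ u ∈ (⨅ N : ℕ, (LinearMap.range x).comap (d ^ N)), d u ∈ (⨅ N : ℕ, (LinearMap.range x).comap (d ^ N)) := by
      intro u hu
      simp only [Submodule.mem_iInf, Submodule.mem_comap] at hu ⊢
      intro N
      have := hu (N+1)
      rwa [pow_succ, mAp] at this
    apply h.gen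
    · simpa only [Submodule.mem_iInf, Submodule.mem_comap] using ev3
    · intro i j hi hj u hu
      have : (i = 0 ∨ i = 1) ∧ (j = 0 ∨ j = 1) := by omega
      obtain ⟨rfl | rfl, rfl | rfl⟩ := this
      · rw [ent_self, h.Dself ω]; simp
      · rw [ent_lt ω]; exact ⟨sx u hu, sd u hu⟩
      · rw [Xsk, ent_lt ω, h.Dsk 0 1 ω ω]; exact ⟨neg_mem (sx u hu), neg_mem (sd u hu)⟩
      · rw [ent_self, h.Dself ω]; simp
  have xs : ∀ u, u ∈ LinearMap.range x := fun u => by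
    have : u ∈ (⨅ N : ℕ, (LinearMap.range x).comap (d ^ N)) := top ▸ Submodule.mem_top
    simp only [Submodule.mem_iInf, Submodule.mem_comap] at this
    exact this 0
  have xi : Function.Injective x := h.tf _ (by simp [en_X])
  obtain ⟨e⟩ := cone_quot Φ (Algebra.lsmul ℂ ℂ PUnit : Rp (ℕ × ℕ) PUnit) (0,1) [] (0 : M →ₗ[ℂ] PUnit) (fun t ht => by simp at ht) xi (fun _ => ⟨0, rfl⟩)
    (fun u => ⟨fun _ => xs u, fun _ => rfl⟩) (sub_add_cancel j 1)
  exact (KH_sub0 _ _ _).equiv ⟨e.symm⟩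
end
theorem koszul_dims (m : ℕ) : ∀ (κ : ℕ) {M : Type} [AddCommGroup M] [Module ℂ M]
    {Φ : Rp (ℕ × ℕ) M} {D : ℕ → ℕ → Module.End ℂ M} {v : M} (_ : CC (2*(m+1)) κ Φ D v) (j : ℤ),
    Dm (KH Φ (LL (m+1)) j) (cc m κ j) := by
  induction m with
  | zero =>
    intro κ M _ _ Φ D v h j
    cases κ with
    | zero => exact base0 h j
    | succ κ => exact base1 h j
  | succ m ih =>
    intro κ M _ _ Φ D v h j
    have h' : CC (2*(m+1)+2) κ Φ D v := h
    have key := fun b hb hab => step h' (LL (m+1)) (mem_LL (m+1)) (cc m κ) b (ih κ (S1_CC h')) hb hab j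
    have e : j - 1 - 2 * ((2*(m+1) : ℕ) : ℤ) = j - 1 - 4 * (m+1) := by push_cast; ring
    rw [e] at key
    cases κ with
    | zero => exact key (fun _ => 0) (fun j => b0 (r := m+2) rfl h' _ j) (fun _ => Or.inr rfl)
    | succ κ =>
      refine key (cc m κ) (fun j => (ih κ (S2_CC h') j).equiv ((KH_S2 h' _ (mem_LL (m+1)) j).map LinearEquiv.symm)) ?_
      intro j
      by_contra hc
      push Not at hc
      have h1 := cc_mod _ _ _ hc.1
      have h2 := cc_mod _ _ _ hc.2
      push_cast at h1 h2
      omega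
end SkewLC
end

section
namespace SkewLC
section
open Polynomial
def Bk : ℕ → ℕ → ℚ[X]
  | 0, _ => 1
  | _+1, 0 => 1
  | s+1, κ+1 => Bk (s+1) κ + X ^ (4*(κ+1)) * Bk s (κ+1)
lemma Bk_den (s κ : ℕ) : Bk s κ * ∏ i ∈ Finset.range s, (1 - X ^ (4*(i+1)) : ℚ[X]) =
    ∏ i ∈ Finset.range s, (1 - X ^ (4*(κ+i+1))) := by
  induction s generalizing κ with
  | zero => simp [Bk]
  | succ s ihs =>
    induction κ with
    | zero => simp [Bk]
    | succ κ ih =>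
      rw [Bk, add_mul, ih, Finset.prod_range_succ' (n := s), Finset.prod_range_succ (fun i => (1 - X ^ (4*(i+1)) : ℚ[X])),
        mul_assoc, ← mul_assoc (Bk s _), ihs, Finset.prod_range_succ (n := s)]
      have : ∀ i, κ + (i + 1) + 1 = κ + 1 + i + 1 := fun i => by omega
      simp only [this]
      ring
lemma gB (s κ : ℕ) : gaussBinom (s+κ) s 4 = Bk s κ := by
  have h : ∏ i ∈ Finset.range s, (1 - X ^ (4*(i+1)) : ℚ[X]) ≠ 0 := by
    rw [Finset.prod_ne_zero_iff]
    intro i _ h0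
    have := congrArg (Polynomial.eval 0) h0
    simp at this
  rw [gaussBinom, Nat.add_sub_cancel_left, ← Bk_den, mul_div_cancel_right₀ _ h]
def cz (P : ℚ[X]) (j : ℤ) : ℚ := if 0 ≤ j then P.coeff j.toNat else 0
lemma cz_mul (d : ℕ) (P : ℚ[X]) (j : ℤ) : cz (X ^ d * P) j = cz P (j - d) := by
  unfold cz
  rw [coeff_X_pow_mul']
  split_ifs <;> first | rfl | omega | (congr 1; omega)
lemma cz_add (P Q : ℚ[X]) (j : ℤ) : cz (P + Q) j = cz P j + cz Q j := by
  unfold cz; split_ifs <;> simp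
lemma cc_gt (m κ : ℕ) (h : m < κ) (j : ℤ) : cc m κ j = 0 := by
  induction m generalizing κ j with
  | zero => obtain ⟨κ, rfl⟩ := Nat.exists_eq_succ_of_ne_zero (by omega : κ ≠ 0); rfl
  | succ m ih =>
    obtain ⟨κ, rfl⟩ := Nat.exists_eq_succ_of_ne_zero (by omega : κ ≠ 0)
    simp only [cc, ih _ (by omega : m < κ+1), ih _ (by omega : m < κ)]
lemma cc_cz (m s κ : ℕ) (h : m = s + κ) (j : ℤ) : (cc m κ j : ℚ) = cz (X ^ ((s+1)*(2*s+1)) * Bk s κ) j := by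
  induction m generalizing s κ j with
  | zero =>
    obtain ⟨rfl, rfl⟩ : s = 0 ∧ κ = 0 := by omega
    rw [cz_mul]
    simp only [cc, cz, Bk, coeff_one]
    split_ifs <;> first | omega | simp
  | succ m ih =>
    have e : ∀ a b : ℕ, ∀ P Q : ℚ[X], b = 4*(m+1)+1+a → P = Q → cz (X ^ a * P) (j-1-4*(m+1)) = cz (X ^ b * Q) j := by
      rintro a b P Q rfl rfl
      rw [cz_mul, cz_mul]; congr 1; push_cast; ring
    cases κ with
    | zero =>
      obtain rfl : s = m + 1 := by omega
      rw [cc, ih m 0 rfl]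
      exact e _ _ _ _ (by ring) (by cases m <;> simp [Bk])
    | succ κ =>
      rw [cc, Nat.cast_add]
      cases s with
      | zero =>
        rw [cc_gt _ _ ω, ih 0 κ ω]
        simp [Bk]
      | succ s =>
        rw [ih s (κ+1) ω, ih (s+1) κ ω, Bk, mul_add (X ^ _) (Bk _ _), cz_add, add_comm]
        congr 1
        rw [← mul_assoc, ← pow_add]
        exact e _ _ _ _ (by obtain rfl : m = s + κ + 1 := by omega
                            ring) rfl
end
lemma gauss_final (m k j : ℕ) (hk : k < m) : (cc (m-1) k j : ℚ) =
    (Polynomial.X ^ (m * (2 * m - 1) - k * (2 * k + 3) - 4 * (m - k - 1) * k) *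
          gaussBinom (m - 1) (m - k - 1) 4).coeff j := by
  obtain ⟨s, rfl⟩ : ∃ s, m = s + k + 1 := ⟨m - 1 - k, by omega⟩
  have e1 : (s + k + 1) * (2 * (s + k + 1) - 1) - k * (2 * k + 3) - 4 * (s + k + 1 - k - 1) * k = (s+1)*(2*s+1) := by
    have : s + k + 1 - k - 1 = s := by omega
    rw [this, show 2 * (s+k+1) - 1 = 2*s+2*k+1 by omega, Nat.sub_sub]
    apply Nat.sub_eq_of_eq_add
    ring
  rw [e1, show s + k + 1 - k - 1 = s by omega, show s + k + 1 - 1 = s + k by omega, gB, cc_cz (s+k) s k rfl, cz]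
  simp
end SkewLC
end

section
namespace SkewLC
open MvPolynomial
section
def x0 (n : ℕ) (p : ℕ × ℕ) : PS n :=
  if h : p.1 < p.2 ∧ p.2 < n then X ⟨(⟨p.1, h.1.trans h.2⟩, ⟨p.2, h.2⟩), h.1⟩ else 0
lemma x0_ent {n : ℕ} (i j : Fin n) : aeval (x0 n) (ent i j) = genEntry n i j := by
  have hi := i.2
  have hj := j.2
  unfold ent genEntry
  simp only [← Fin.lt_def]
  split_ifs with h h' <;> simp [x0, h, *]
def rn (n : ℕ) : PS n →ₐ[ℂ] P2 := rename fun p => ((p.1.1 : ℕ), (p.1.2 : ℕ))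
lemma rn_x0 (n : ℕ) (f : P2) : rn n (aeval (x0 n) f) = en n f := by
  have : (rn n).comp (aeval (x0 n)) = en n := by
    apply MvPolynomial.algHom_ext
    intro p
    rw [AlgHom.comp_apply, aeval_X, en_X, x0]
    split_ifs with h
    · simp [rn]
    · simp
  exact DFunLike.congr_fun this f
lemma rn_gen {n : ℕ} (i j : Fin n) : rn n (genEntry n i j) = ent i j := by
  rw [← x0_ent, rn_x0, en_ent i.2 j.2]
lemma pf_eq (m : ℕ) : pfaffian (2*m) = (((2 ^ m * m.factorial : ℕ) : ℂ))⁻¹ •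
      ∑ σ : Equiv.Perm (Fin (2 * m)), (Equiv.Perm.sign σ : ℤ) • ∏ i : Fin m,
        genEntry (2*m) (σ ⟨2 * i.1, by have := i.isLt; omega⟩) (σ ⟨2 * i.1 + 1, by have := i.isLt; omega⟩) := by
  have e : ∀ r, r = m → pfBlock (2*m) r = (((2 ^ m * m.factorial : ℕ) : ℂ))⁻¹ •
      ∑ σ : Equiv.Perm (Fin (2 * m)), (Equiv.Perm.sign σ : ℤ) • ∏ i : Fin m,
        genEntry (2*m) (σ ⟨2 * i.1, by have := i.isLt; omega⟩) (σ ⟨2 * i.1 + 1, by have := i.isLt; omega⟩) := by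
    rintro r rfl
    rw [pfBlock, dif_pos le_rfl]
    rfl
  exact e _ ω
lemma term01 (m : ℕ) (σ : Equiv.Perm (Fin (2*m)))
    (h : ∀ i : Fin m, (σ ⟨2 * i.1 + 1, by have := i.isLt; omega⟩ : ℕ) = jp (σ ⟨2 * i.1, by have := i.isLt; omega⟩)) :
    ((Equiv.Perm.sign σ : ℤ) : ℂ) * ∏ i : Fin m, (if (σ ⟨2 * i.1, by have := i.isLt; omega⟩ : ℕ) % 2 = 0 then (1:ℂ) else -1) = 1 := by
  have hb : ∀ i : Fin m, 2 * i.1 + 1 < 2*m := fun i => by have := i.isLt; omega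
  let e : Fin m × Fin 2 ≃ Fin (2*m) := finProdFinEquiv.trans (finCongr (mul_comm m 2))
  have ev : ∀ a, (e a : ℕ) = a.2 + 2 * a.1 := fun a => rfl
  have ev0 : ∀ a, e (a,0) = ⟨2*a.1, by have := hb a; omega⟩ := fun a => Fin.ext (by rw [ev]; simp)
  have ev1 : ∀ a, e (a,1) = ⟨2*a.1+1, hb a⟩ := fun a => Fin.ext (by rw [ev]; simp; ring)
  let t : Fin m → Fin m := fun a => (e.symm (σ (e (a,0)))).1
  let ε : Fin m → Equiv.Perm (Fin 2) := fun a => if (e.symm (σ (e (a,0)))).2 = 0 then 1 else Equiv.swap 0 1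
  have s0 : ∀ a b, σ (e (a,b)) = e (t a, ε a b) := by
    intro a b
    obtain ⟨p, hp⟩ := e.surjective (σ (e (a,0)))
    have h1 := h a
    rw [← ev0, ← ev1, ← hp, ev] at h1
    simp only [t, ε, ← hp, e.symm_apply_apply]
    obtain ⟨p1, p2⟩ := p
    fin_cases p2 <;> fin_cases b <;> simp at h1 ⊢
    · exact hp.symm
    · apply Fin.ext; rw [ev, h1]; unfold jp; simp; omega
    · exact hp.symm
    · apply Fin.ext; rw [ev, h1]; unfold jp; split_ifs <;> simp <;> omega
  have ti : Function.Injective t := by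
    intro a b hab
    obtain ⟨c, hc⟩ := (ε b).surjective (ε a 0)
    have : σ (e (a,0)) = σ (e (b,c)) := by rw [s0, s0, hab, hc]
    exact congrArg Prod.fst (e.injective (σ.injective this))
  let τ : Equiv.Perm (Fin m) := Equiv.ofBijective t (Finite.injective_iff_bijective.1 ti)
  have es : e.permCongr.symm σ = (Equiv.prodCongrLeft fun _ : Fin 2 => τ) * (Equiv.prodCongrRight ε) := by
    ext1 ⟨a, b⟩
    show e.symm (σ (e (a,b))) = _
    rw [s0, e.symm_apply_apply]; rfl
  have sg : Equiv.Perm.sign σ = ∏ a, Equiv.Perm.sign (ε a) := by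
    have : Equiv.Perm.sign (e.permCongr.symm σ) = Equiv.Perm.sign σ := Equiv.Perm.sign_permCongr e.symm σ
    rw [← this, es, Equiv.Perm.sign_mul, Equiv.Perm.sign_prodCongrLeft, Equiv.Perm.sign_prodCongrRight]
    simp
  rw [sg]
  push_cast
  rw [← Finset.prod_mul_distrib]
  apply Finset.prod_eq_one
  intro a _
  rw [← ev0, s0]
  simp only [ev, ε]
  split_ifs with h1 h2 h2 <;> simp at *
lemma pf_ne (m : ℕ) : pfaffian (2*m) ≠ 0 := by
  intro h0
  have h1 := congrArg (fun f => aeval (R := ℂ) jv (rn (2*m) f)) h0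
  simp only [pf_eq, map_smul, map_sum, map_zsmul, map_prod, rn_gen, map_zero, jv_ent] at h1
  have hc : (((2 ^ m * m.factorial : ℕ) : ℂ))⁻¹ ≠ 0 :=
    inv_ne_zero (Nat.cast_ne_zero.2 (by positivity))
  have h2 := (smul_eq_zero.1 h1).resolve_left hc
  clear h1 h0
  let P : Equiv.Perm (Fin (2*m)) → Prop := fun σ => ∀ i : Fin m, (σ ⟨2 * i.1 + 1, by have := i.isLt; omega⟩ : ℕ) = jp (σ ⟨2 * i.1, by have := i.isLt; omega⟩)
  classical
  rw [Finset.sum_congr rfl (g := fun σ => if P σ then 1 else 0)] at h2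
  · rw [Finset.sum_boole, Nat.cast_eq_zero, Finset.card_eq_zero] at h2
    have : (1 : Equiv.Perm (Fin (2*m))) ∈ Finset.univ.filter P := by
      simp only [Finset.mem_filter, Finset.mem_univ, true_and, P]
      intro i; simp [jp]
    rw [h2] at this; simp at this
  · intro σ _
    split_ifs with hP
    · rw [zsmul_eq_mul]
      refine Eq.trans ?_ (term01 m σ hP)
      congr 1
      exact Finset.prod_congr rfl fun i _ => by rw [if_pos (hP i)]
    · simp only [P, not_forall] at hP
      obtain ⟨i, hi⟩ := hP
      rw [Finset.prod_eq_zero (Finset.mem_univ i) (if_neg hi), smul_zero]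
end
end SkewLC
end

section
namespace SkewLC
open MvPolynomial
section
lemma der_prod {A : Type*} [CommRing A] [Algebra ℂ A] (θ : Derivation ℂ A A) {ι : Type*} [DecidableEq ι]
    (s : Finset ι) (f : ι → A) (k : ι) (hk : k ∈ s) (h0 : ∀ l ∈ s, l ≠ k → θ (f l) = 0) (g : ι → A)
    (hg : θ (f k) = g k) (h1 : ∀ l ∈ s, l ≠ k → g l = f l) : θ (∏ k ∈ s, f k) = ∏ k ∈ s, g k := by
  have h : ∀ t : Finset ι, (∀ l ∈ t, θ (f l) = 0) → θ (∏ l ∈ t, f l) = 0 := by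
    intro t
    induction t using Finset.induction_on with
    | empty => simp
    | insert a t ha ih =>
      intro h
      rw [Finset.prod_insert ha, θ.leibniz, ih fun l hl => h l (Finset.mem_insert_of_mem hl),
        h a (Finset.mem_insert_self _ _)]
      simp
  rw [← Finset.mul_prod_erase s f hk, ← Finset.mul_prod_erase s g hk, θ.leibniz, h _ fun l hl =>
    h0 l (Finset.mem_of_mem_erase hl) (Finset.ne_of_mem_erase hl), hg, smul_zero, zero_add, smul_eq_mul, mul_comm]
  congr 1
  exact Finset.prod_congr rfl fun l hl => (h1 l (Finset.mem_of_mem_erase hl) (Finset.ne_of_mem_erase hl)).symm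
lemma der_inv {A : Type*} [CommRing A] [Algebra ℂ A] (θ : Derivation ℂ A A) {x y : A} (h : x * y = 1) {c : ℂ}
    (hx : θ x = c • x) (r : ℕ) : θ (y ^ r) = (-(r * c : ℂ)) • y ^ r := by
  have hy : θ y = (-c) • y := by
    have h1 := congrArg θ h
    rw [θ.leibniz, hx, θ.map_one_eq_zero] at h1
    have h2 := congrArg (y * ·) h1
    simp only [smul_eq_mul, mul_add, mul_zero, Algebra.smul_def] at h2 ⊢
    rw [map_neg]
    linear_combination h2 - (θ y + algebraMap ℂ A c * y) * h
  rcases r with _ | r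
  · simp
  · rw [θ.leibniz_pow, hy]
    simp only [Algebra.smul_def]
    simp
    ring
variable {n : ℕ} (δ : SkewIdx n → Derivation ℂ (SPf n) (SPf n))
def dd (i j : Fin n) : Derivation ℂ (SPf n) (SPf n) :=
  if h : i < j then δ ⟨(i, j), h⟩ else if h' : j < i then - δ ⟨(j, i), h'⟩ else 0
lemma dd_sk (i j : Fin n) : dd δ j i = - dd δ i j := by
  unfold dd
  rcases lt_trichotomy i j with h | h | h
  · simp [h, h.not_gt]
  · simp [h]
  · simp [h, h.not_gt]
abbrev aa (n : ℕ) (i j : Fin n) : SPf n := algebraMap (PS n) (SPf n) (genEntry n i j)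
lemma aa_sk (i j : Fin n) : aa n j i = - aa n i j := by
  unfold aa genEntry
  rcases lt_trichotomy i j with h | h | h
  · simp [h, h.not_gt]
  · simp [h]
  · simp [h, h.not_gt]
variable {δ} (hδ : IsDerivExtension n δ)
lemma dd_aa (hδ : IsDerivExtension n δ) (i j k l : Fin n) :
    dd δ i j (aa n k l) = (dl i k * dl j l - dl i l * dl j k) • (1 : SPf n) := by
  have key : ∀ i j k l : Fin n, i < j → k < l → dd δ i j (aa n k l) = (dl i k * dl j l - dl i l * dl j k) • (1 : SPf n) := by
    intro i j k l h h'
    have e : dl i l * dl j k = 0 := by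
      unfold dl; rw [Fin.lt_def] at h h'; split_ifs <;> first | (exfalso; omega) | simp
    rw [e, sub_zero, dd, dif_pos h, aa, genEntry, dif_pos h', hδ, pderiv_X, Pi.single_apply]
    simp only [Subtype.mk.injEq, Prod.mk.injEq, dl, Fin.val_inj]
    by_cases h1 : i = k <;> by_cases h2 : j = l <;> simp [h1, h2, eq_comm] <;> simp_all [eq_comm]
  have z1 : ∀ i, dd δ i i = 0 := fun i => by simp [dd]
  have z2 : ∀ i, aa n i i = 0 := fun i => by simp [aa, genEntry]
  have key2 : ∀ i j k l : Fin n, i < j → dd δ i j (aa n k l) = (dl i k * dl j l - dl i l * dl j k) • (1 : SPf n) := by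
    intro i j k l h
    rcases lt_trichotomy k l with h' | rfl | h'
    · exact key _ _ _ _ h h'
    · rw [z2, map_zero]; simp
    · rw [aa_sk, map_neg, key _ _ _ _ h h', ← neg_smul]; congr 1; ring
  rcases lt_trichotomy i j with h | rfl | h
  · exact key2 _ _ _ _ h
  · rw [z1]; simp [mul_comm]
  · rw [dd_sk, Derivation.neg_apply, key2 _ _ _ _ h, ← neg_smul]; congr 1; ring
variable (δ) in
def th (i l : Fin n) : Derivation ℂ (SPf n) (SPf n) := ∑ j, aa n i j • dd δ l j
lemma th_apply (i l : Fin n) (u) : th δ i l u = ∑ j, aa n i j * dd δ l j u := by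
  have : ∀ s : Finset (Fin n), (∑ j ∈ s, aa n i j • dd δ l j) u = ∑ j ∈ s, aa n i j * dd δ l j u := by
    classical
    intro s
    induction s using Finset.induction_on with
    | empty => simp
    | insert a s ha ih => rw [Finset.sum_insert ha, Finset.sum_insert ha, Derivation.add_apply, ih, Derivation.smul_apply, smul_eq_mul]
  exact this _
lemma th_aa (hδ : IsDerivExtension n δ) (i l p q : Fin n) :
    th δ i l (aa n p q) = dl l p • aa n i q - dl l q • aa n i p := by
  rw [th_apply]
  simp only [dd_aa hδ, dl, Fin.val_inj]
  simp [sub_smul, mul_sub, Finset.sum_sub_distrib]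
lemma th_P (m : ℕ) {δ : SkewIdx (2*m) → Derivation ℂ (SPf (2*m)) (SPf (2*m))} (hδ : IsDerivExtension (2*m) δ)
    (i l : Fin (2*m)) (σ : Equiv.Perm (Fin (2*m))) :
    th δ i l (∏ k : Fin m, aa (2*m) (σ ⟨2 * k.1, by have := k.isLt; omega⟩) (σ ⟨2 * k.1 + 1, by have := k.isLt; omega⟩)) =
    ∏ k : Fin m, aa (2*m) (Function.update id l i (σ ⟨2 * k.1, by have := k.isLt; omega⟩))
      (Function.update id l i (σ ⟨2 * k.1 + 1, by have := k.isLt; omega⟩)) := by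
  obtain ⟨p, hp⟩ := σ.surjective l
  have hk : p.1 / 2 < m := by omega
  have hn : ∀ q : Fin (2*m), q ≠ p → σ q ≠ l := fun q hq h => hq (σ.injective (h.trans hp.symm))
  have hd : ∀ q : Fin (2*m), q ≠ p → dl l (σ q) = 0 := fun q hq => dl_ne fun h => hn q hq (Fin.ext h.symm)
  apply der_prod (th δ i l) Finset.univ _ ⟨p.1/2, hk⟩ (Finset.mem_univ _)
  · intro q _ hq
    have hq' : q.1 ≠ p.1/2 := fun h => hq (Fin.ext h)
    rw [th_aa hδ, hd _ fun h => hq' (by have := congrArg Fin.val h; simp at this; omega),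
      hd _ fun h => hq' (by have := congrArg Fin.val h; simp at this; omega)]
    simp
  · rw [th_aa hδ]
    dsimp only
    rcases Nat.mod_two_eq_zero_or_one p.1 with h | h
    · have e1 : (⟨2*(p.1/2), by omega⟩ : Fin (2*m)) = p := Fin.ext (by simp; omega)
      have e2 : (⟨2*(p.1/2)+1, by omega⟩ : Fin (2*m)) ≠ p := fun h => by have := congrArg Fin.val h; simp at this; omega
      rw [hd _ e2, e1, hp, dl_self, Function.update_self, Function.update_of_ne (hn _ e2)]
      simp
    · have e1 : (⟨2*(p.1/2)+1, by omega⟩ : Fin (2*m)) = p := Fin.ext (by simp; omega)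
      have e2 : (⟨2*(p.1/2), by omega⟩ : Fin (2*m)) ≠ p := fun h => by have := congrArg Fin.val h; simp at this; omega
      rw [hd _ e2, e1, hp, dl_self, Function.update_self, Function.update_of_ne (hn _ e2), id, aa_sk i (σ _)]
      simp
  · intro q _ hq
    have hq' : q.1 ≠ p.1/2 := fun h => hq (Fin.ext h)
    rw [Function.update_of_ne (hn _ fun h => hq' (by have := congrArg Fin.val h; simp at this; omega)),
      Function.update_of_ne (hn _ fun h => hq' (by have := congrArg Fin.val h; simp at this; omega))]
    rfl
lemma eqneg {A : Type*} [AddCommGroup A] [Module ℂ A] {x : A} (h : x = -x) : x = 0 := by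
  have : (2:ℂ) • x = 0 := by rw [two_smul]; nth_rw 2 [h]; simp
  simpa using this
lemma th_pf (m : ℕ) {δ : SkewIdx (2*m) → Derivation ℂ (SPf (2*m)) (SPf (2*m))} (hδ : IsDerivExtension (2*m) δ)
    (i l : Fin (2*m)) : th δ i l (algebraMap _ _ (pfaffian (2*m))) = dl i l • algebraMap _ (SPf (2*m)) (pfaffian (2*m)) := by
  have hs : ∀ (c : ℂ) (f : PS (2*m)), algebraMap _ (SPf (2*m)) (c • f) = c • algebraMap _ (SPf (2*m)) f :=
    fun c f => ((Algebra.linearMap (PS (2*m)) (SPf (2*m))).restrictScalars ℂ).map_smul c f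
  have e := congrArg (algebraMap (PS (2*m)) (SPf (2*m))) (pf_eq m)
  rw [e, hs, map_sum, Derivation.map_smul, map_sum, smul_comm]
  congr 1
  simp only [map_zsmul, map_prod]
  rw [Finset.sum_congr rfl fun σ _ => by rw [th_P m hδ i l σ]]
  by_cases h : i = l
  · subst h
    have hu : Function.update (id : Fin (2*m) → _) i i = id := Function.update_eq_self i id
    simp [dl_self, hu]
  · rw [dl_ne fun h' => h (Fin.ext h'), zero_smul]
    refine eqneg ?_
    nth_rw 1 [← Equiv.sum_comp (Equiv.mulLeft (Equiv.swap i l))]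
    rw [← Finset.sum_neg_distrib]
    refine Finset.sum_congr rfl fun σ _ => ?_
    have hu : ∀ q, Function.update id l i (Equiv.swap i l q) = Function.update id l i q := by
      intro q
      by_cases h1 : q = i
      · subst h1; simp [h]
      · by_cases h2 : q = l
        · subst h2; simp [h]
        · rw [Equiv.swap_apply_of_ne_of_ne h1 h2]
    simp [Equiv.Perm.sign_mul, Equiv.Perm.sign_swap h, hu]
lemma th_v (m r : ℕ) {δ : SkewIdx (2*m) → Derivation ℂ (SPf (2*m)) (SPf (2*m))} (hδ : IsDerivExtension (2*m) δ)
    (i l : Fin (2*m)) : th δ i l (pfInv (2*m) ^ r) = (-(r * dl i l : ℂ)) • pfInv (2*m) ^ r :=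
  der_inv _ (IsLocalization.Away.mul_invSelf _) (th_pf m hδ i l) r
lemma der_ext (θ : Derivation ℂ (SPf n) (SPf n)) (h : ∀ f : PS n, θ (algebraMap _ _ f) = 0) : θ = 0 := by
  ext u
  obtain ⟨⟨f, s⟩, hs⟩ := IsLocalization.surj (Submonoid.powers (pfaffian n)) u
  have h1 := congrArg θ hs
  simp only [θ.leibniz, h, smul_eq_mul, mul_zero, zero_add] at h1
  simpa using (IsLocalization.map_units (SPf n) s).mul_right_eq_zero.1 h1
lemma der_ext' (θ : Derivation ℂ (SPf n) (SPf n)) (h : ∀ p, θ (algebraMap _ _ (X p : PS n)) = 0) : θ = 0 := by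
  apply der_ext
  intro f
  induction f using MvPolynomial.induction_on with
  | C a => exact θ.map_algebraMap a
  | add p q hp hq => rw [map_add, map_add, hp, hq, add_zero]
  | mul_X p q hp => rw [map_mul, θ.leibniz, hp, h]; simp
lemma dd_comm (hδ : IsDerivExtension n δ) (i j k l : Fin n) (u) : dd δ i j (dd δ k l u) = dd δ k l (dd δ i j u) := by
  have : ⁅dd δ i j, dd δ k l⁆ = 0 := by
    apply der_ext'
    intro p
    have e : (X p : PS n) = genEntry n p.1.1 p.1.2 := by rw [genEntry, dif_pos p.2]
    rw [Derivation.commutator_apply, e, dd_aa hδ, dd_aa hδ]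
    simp
  have h2 := DFunLike.congr_fun this u
  rw [Derivation.commutator_apply] at h2
  exact sub_eq_zero.1 h2
def phi (n : ℕ) (M : Type) [AddCommGroup M] [Module (PS n) M] [Module ℂ M] [IsScalarTower ℂ (PS n) M] : Rp (ℕ × ℕ) M :=
  (Algebra.lsmul ℂ ℂ M).comp (aeval (x0 n))
lemma phi_app {n : ℕ} {M : Type} [AddCommGroup M] [Module (PS n) M] [Module ℂ M] [IsScalarTower ℂ (PS n) M] (f : P2) (u : M) :
  phi n M f u = aeval (R := ℂ) (x0 n) f • u := rfl
lemma dS_mem (v : SPf n) : v ∈ dSpan n δ v := by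
  rw [dSpan, Submodule.mem_sInf]; exact fun N hN => hN.1
lemma dS_dd (v : SPf n) (i j : Fin n) {u} (hu : u ∈ dSpan n δ v) : dd δ i j u ∈ dSpan n δ v := by
  have h : DStable n δ (dSpan n δ v) := by
    intro p x hx
    rw [dSpan, Submodule.mem_sInf] at hx ⊢
    exact fun N hN => hN.2 p x (hx N hN)
  unfold dd
  split_ifs
  · exact h _ _ hu
  · exact neg_mem (h _ _ hu)
  · exact zero_mem _
variable (δ) in
def dD (v : SPf n) (i j : ℕ) : Module.End ℂ (dSpan n δ v) :=
  if h : i < n ∧ j < n then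
    { toFun := fun u => ⟨dd δ ⟨i, h.1⟩ ⟨j, h.2⟩ u, dS_dd v _ _ u.2⟩
      map_add' := fun a b => Subtype.ext (map_add _ _ _)
      map_smul' := fun c a => Subtype.ext (Derivation.map_smul _ _ _) }
  else 0
lemma dD_app (v : SPf n) (i j : Fin n) (u : dSpan n δ v) : (dD δ v i j u : SPf n) = dd δ i j u := by
  rw [dD, dif_pos ⟨i.2, j.2⟩]; rfl
lemma phi_ent (v : SPf n) (i j : Fin n) (u : dSpan n δ v) : ((phi n (dSpan n δ v) (ent i j) u : dSpan n δ v) : SPf n) = aa n i j * u := by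
  rw [phi_app, x0_ent, Submodule.coe_smul, Algebra.smul_def]
theorem CC_dSpan (m k : ℕ) {δ : SkewIdx (2*m) → Derivation ℂ (SPf (2*m)) (SPf (2*m))} (hδ : IsDerivExtension (2*m) δ) :
    CC (2*m) k (phi (2*m) (dSpan (2*m) δ (pfInv (2*m) ^ (2*k)))) (dD δ (pfInv (2*m) ^ (2*k))) ⟨_, dS_mem _⟩ := by
  have hle : Submonoid.powers (pfaffian (2*m)) ≤ nonZeroDivisors (PS (2*m)) := powers_le_nonZeroDivisors_of_noZeroDivisors (pf_ne m)
  have hinj := IsLocalization.injective (SPf (2*m)) hle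
  have hdom : IsDomain (SPf (2*m)) := IsLocalization.isDomain_of_le_nonZeroDivisors _ hle
  constructor
  · intro p hp
    ext1 u
    rw [phi_app, aeval_X, x0, dif_neg hp, zero_smul]; rfl
  · intro i j hi hj
    ext u
    have := dD_app _ ⟨j, hj⟩ ⟨i, hi⟩ u
    simp only at this
    rw [this, dd_sk]
    show _ = -(dD δ _ _ _ u : SPf (2*m))
    have := dD_app _ ⟨i, hi⟩ ⟨j, hj⟩ u
    simp only at this
    rw [this]; rfl
  · intro i j k l hi hj hk hl
    lift i to Fin (2*m) using hi
    lift j to Fin (2*m) using hj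
    lift k to Fin (2*m) using hk
    lift l to Fin (2*m) using hl
    apply cm_of
    intro u
    apply Subtype.ext
    simp only [dD_app]
    exact dd_comm hδ _ _ _ _ _
  · intro i j k l hi hj hk hl
    lift i to Fin (2*m) using hi
    lift j to Fin (2*m) using hj
    lift k to Fin (2*m) using hk
    lift l to Fin (2*m) using hl
    ext u
    show (dD δ _ i j (phi _ _ (ent k l) u) : SPf (2*m)) - ((phi _ (dSpan (2*m) δ _) (ent k l) (dD δ _ i j u) : dSpan (2*m) δ _) : SPf (2*m)) = (dl i k * dl j l - dl i l * dl j k) • (u : SPf (2*m))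
    rw [dD_app, phi_ent, phi_ent, dD_app, Derivation.leibniz, dd_aa hδ, smul_eq_mul, smul_eq_mul, add_sub_cancel_left, mul_smul_comm, mul_one]
  · intro h
    have h1 : IsUnit (pfInv (2*m)) := IsUnit.of_mul_eq_one _ ((mul_comm _ _).trans (IsLocalization.Away.mul_invSelf (pfaffian (2*m))))
    exact (h1.pow (2*k)).ne_zero (congrArg Subtype.val h)
  · intro W hv hW
    have hP : ∀ (f : PS (2*m)) u, u ∈ W → f • u ∈ W := by
      intro f
      induction f using MvPolynomial.induction_on with
      | C a => intro u hu; rw [← MvPolynomial.algebraMap_eq, algebraMap_smul]; exact W.smul_mem _ hu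
      | add p q hp hq => intro u hu; rw [add_smul]; exact W.add_mem (hp u hu) (hq u hu)
      | mul_X p q hp =>
        intro u hu
        rw [mul_smul]
        apply hp
        have := (hW q.1.1 q.1.2 q.1.1.2 q.1.2.2 u hu).1
        rwa [phi_app, x0_ent, genEntry, dif_pos q.2] at this
    let N : Submodule (PS (2*m)) (SPf (2*m)) :=
      { carrier := {x | ∃ u ∈ W, (u : SPf (2*m)) = x}
        add_mem' := by rintro _ _ ⟨u, hu, rfl⟩ ⟨w, hw, rfl⟩; exact ⟨u+w, W.add_mem hu hw, rfl⟩
        zero_mem' := ⟨0, W.zero_mem, rfl⟩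
        smul_mem' := by rintro f _ ⟨u, hu, rfl⟩; exact ⟨f • u, hP f u hu, rfl⟩ }
    have hN : dSpan (2*m) δ (pfInv (2*m) ^ (2*k)) ≤ N := by
      apply sInf_le
      refine ⟨⟨_, hv, rfl⟩, ?_⟩
      rintro p _ ⟨u, hu, rfl⟩
      refine ⟨_, (hW p.1.1 p.1.2 p.1.1.2 p.1.2.2 u hu).2, ?_⟩
      rw [dD_app, dd, dif_pos p.2]
    rw [eq_top_iff]
    intro u _
    obtain ⟨w, hw, e⟩ := hN u.2
    rwa [← Subtype.ext e]
  · intro i l hi hl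
    lift i to Fin (2*m) using hi
    lift l to Fin (2*m) using hl
    apply Subtype.ext
    rw [LinearMap.sum_apply, AddSubmonoidClass.coe_finsetSum, Finset.sum_range]
    simp only [mAp, phi_ent, dD_app]
    rw [← th_apply, th_v m _ hδ]
    push_cast
    rw [neg_mul]
  · intro f hf
    have hf' : aeval (R := ℂ) (x0 (2*m)) f ≠ 0 := fun h => hf (by rw [← rn_x0, h, map_zero])
    rw [inj0]
    intro u hu
    rw [phi_app] at hu
    have h2 := congrArg Subtype.val hu
    rw [Submodule.coe_smul, Algebra.smul_def] at h2
    rcases mul_eq_zero.1 h2 with h3 | h3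
    · exact absurd (hinj (h3.trans (map_zero _).symm)) hf'
    · exact Subtype.ext h3
end
end SkewLC
end

section
namespace SkewLC
open MvPolynomial
section
variable {τ : Type} {M : Type} [AddCommGroup M] [Module ℂ M]
lemma KH0 (Φ : Rp τ M) (L : List τ) : (∀ j < 0, ∀ x : KH Φ L j, x = 0) ∧ ∃ F : KH Φ L 0 →ₗ[ℂ] M, Function.Injective F ∧
    (∀ y, (∃ x, F x = y) ↔ ∀ t ∈ L, Φ (X t) y = 0) ∧ ∀ f (hf : Cm Φ Φ L f) x, F (Hf Φ Φ hf 0 x) = f (F x) := by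
  induction L with
  | nil =>
    refine ⟨fun j hj x => KHn0 Φ hj.ne x, ?_⟩
    obtain ⟨e, he⟩ := KHn1 Φ
    refine ⟨e.symm, e.symm.injective, fun y => ⟨fun _ => by simp, fun _ => ⟨e y, by simp⟩⟩, fun f hf x => ?_⟩
    obtain ⟨y, rfl⟩ := e.surjective x
    simp [he]
  | cons t L ih =>
    obtain ⟨h0, F, hF, hr, hn⟩ := ih
    have ci : ∀ j ≤ 0, ∀ x : KH Φ (t :: L) j, cπ Φ t L j x = 0 → x = 0 := by
      intro j hj x hx
      obtain ⟨y, rfl⟩ := (cone_exact1 Φ t L (sub_add_cancel j 1) x).1 hx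
      rw [h0 _ ω y, map_zero]
    refine ⟨fun j hj x => ci j hj.le x (h0 j hj _), F.comp (cπ Φ t L 0), ?_, ?_, ?_⟩
    · rw [inj0]
      intro x hx
      exact ci 0 le_rfl x (hF (hx.trans (map_zero F).symm))
    · intro y
      constructor
      · rintro ⟨x, rfl⟩
        have h1 := (cone_exact2 Φ t L 0 (cπ Φ t L 0 x)).2 ⟨x, rfl⟩
        intro s hs
        rcases List.mem_cons.1 hs with rfl | hs
        · have := hn _ (Cm.rho Φ L (X s)) (cπ Φ s L 0 x)
          rw [h1, map_zero] at this
          exact this.symm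
        · exact (hr _).1 ⟨_, rfl⟩ s hs
      · intro h
        obtain ⟨x, rfl⟩ := (hr y).2 fun s hs => h s (List.mem_cons_of_mem _ hs)
        obtain ⟨z, rfl⟩ := (cone_exact2 Φ t L 0 x).1 (hF (by rw [hn, map_zero]; exact h t (by simp)))
        exact ⟨z, rfl⟩
    · intro f hf x
      rw [cmA, cπ_nat, hn]; rfl
end
section
variable {n : ℕ}
lemma span_inj (S : Set (SkewIdx n)) (t : SkewIdx n) (ht : t ∉ S) (f : PS n)
    (h : X t * f ∈ Ideal.span (X '' S : Set (PS n))) : f ∈ Ideal.span (X '' S : Set (PS n)) := by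
  rw [mem_ideal_span_X_image] at h ⊢
  intro d hd
  obtain ⟨s, hs, h2⟩ := h (Finsupp.single t 1 + d) (by
    rw [mem_support_iff, coeff_X_mul]; exact mem_support_iff.1 hd)
  refine ⟨s, hs, fun h3 => h2 ?_⟩
  rw [Finsupp.add_apply, h3, Finsupp.single_eq_of_ne]
  rintro rfl; exact ht hs
variable {I : Type} [AddCommGroup I] [Module (PS n) I] [Module ℂ I] [IsScalarTower ℂ (PS n) I]
lemma KHinj (hI : Module.Injective (PS n) I) (L : List (ℕ × ℕ)) (nd : L.Nodup)
    (hL : ∀ t ∈ L, t.1 < t.2 ∧ t.2 < n) : ∀ j ≠ 0, ∀ x : KH (phi n I) L j, x = 0 := by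
  induction L with
  | nil => exact fun j hj x => KHn0 _ hj x
  | cons t L ih =>
    intro j hj x
    have ih := ih (List.nodup_cons.1 nd).2 fun s hs => hL s (List.mem_cons_of_mem _ hs)
    by_cases h1 : j = 1
    swap
    · obtain ⟨y, rfl⟩ := (cone_exact1 (phi n I) t L (sub_add_cancel j 1) x).1 (ih j hj _)
      rw [ih _ ω y, map_zero]
    subst h1
    obtain ⟨y, rfl⟩ := (cone_exact1 (phi n I) t L (zero_add 1) x).1 (ih 1 hj _)
    apply (cone_exact3 (phi n I) t L _ _).2
    obtain ⟨_, F, hF, hr, hn⟩ := KH0 (phi n I) L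
    have ht := hL t (by simp)
    let S : Set (SkewIdx n) := {q | ((q.1.1 : ℕ), (q.1.2 : ℕ)) ∈ L}
    let t' : SkewIdx n := ⟨(⟨t.1, ht.1.trans ht.2⟩, ⟨t.2, ht.2⟩), ht.1⟩
    have hk : ∀ (s : ℕ × ℕ) (h : s.1 < s.2 ∧ s.2 < n) (u : I), phi n I (X s) u = (X ⟨(⟨s.1, h.1.trans h.2⟩, ⟨s.2, h.2⟩), h.1⟩ : PS n) • u := by
      intro s h u
      rw [phi_app, aeval_X, x0, dif_pos h]
    let K : Ideal (PS n) := Ideal.span (X '' S)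
    have hy := (hr (F y)).1 ⟨y, rfl⟩
    have hKy : K ≤ LinearMap.ker (LinearMap.toSpanSingleton (PS n) I (F y)) := by
      refine Ideal.span_le.2 ?_
      rintro _ ⟨q, hq, rfl⟩
      have := hy _ hq
      rw [hk _ ⟨q.2, q.1.2.2⟩] at this
      exact this
    have hti : Function.Injective (LinearMap.lsmul (PS n) (PS n ⧸ K) (X t')) := by
      rw [inj0]
      intro z hz
      obtain ⟨f, rfl⟩ := mkS K z
      rw [LinearMap.lsmul_apply, ← map_smul] at hz
      exact (qz K).2 (span_inj S t' (List.nodup_cons.1 nd).1 f ((qz K).1 hz))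
    obtain ⟨g, hg⟩ := hI.out _ hti (Submodule.liftQ K _ hKy)
    have h1 : (X t' : PS n) • g (K.mkQ 1) = F y := by
      rw [← map_smul]; exact (hg (K.mkQ 1)).trans (one_smul (PS n) (F y))
    obtain ⟨x, hx⟩ := (hr (g (K.mkQ 1))).2 (by
      intro s hs
      rw [hk s (hL s (List.mem_cons_of_mem _ hs)), ← map_smul, ← map_smul, Submodule.mkQ_apply, (qz K).2, map_zero]
      rw [smul_eq_mul, mul_one]
      exact Ideal.subset_span ⟨_, hs, rfl⟩)
    refine ⟨x, hF ?_⟩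
    rw [hn, hx, hk t ht, h1]
lemma nd_LL : ∀ m, (LL m).Nodup
  | 0 => List.nodup_nil
  | m+1 => by
    refine List.nodup_cons.2 ⟨fun h => ?_, List.Nodup.append (nd_bl _) (nd_LL m) fun t h1 h2 => ?_⟩
    · rcases List.mem_append.1 h with h | h
      · rw [mem_bl] at h; simp at h
      · rw [mem_LL] at h; simp at h
    · rw [mem_bl] at h1; rw [mem_LL] at h2; omega
end
end SkewLC
end

section
namespace SkewLC
open MvPolynomial
section
lemma hull_ex (R : Type) [CommRing R] (M : Type) [AddCommGroup M] [Module R M] :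
    ∃ (I : Type) (_ : AddCommGroup I) (_ : Module R I) (i : M →ₗ[R] I), Module.Injective R I ∧
      Function.Injective i ∧ ∀ x : I, x ≠ 0 → ∃ r : R, r • x ≠ 0 ∧ r • x ∈ LinearMap.range i := by
  obtain ⟨J, _, _, i, hJ, hi⟩ : ∃ (J : Type) (_ : AddCommGroup J) (_ : Module R J) (i : M →ₗ[R] J), Module.Injective R J ∧
      Function.Injective i := by
    let J := CategoryTheory.Injective.under (ModuleCat.of R M)
    refine ⟨J, inferInstance, inferInstance, (CategoryTheory.Injective.ι (ModuleCat.of R M)).hom, ?_, ?_⟩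
    · exact Module.injective_module_of_injective_object (M := J) (inj := inferInstanceAs (CategoryTheory.Injective J))
    · exact (ModuleCat.mono_iff_injective _).1 inferInstance
  let P : Submodule R J → Submodule R J → Prop := fun A N => ∀ x ∈ N, x ≠ 0 → ∃ r : R, r • x ≠ 0 ∧ r • x ∈ A
  obtain ⟨N, hMN, hN, hmax⟩ : ∃ N, LinearMap.range i ≤ N ∧ P (LinearMap.range i) N ∧
      ∀ N', N ≤ N' → P (LinearMap.range i) N' → N' ≤ N := by
    obtain ⟨N, h1, h2⟩ := zorn_le_nonempty₀ {N | P (LinearMap.range i) N} (fun c hc hch y hy =>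
      ⟨sSup c, fun x hx hx0 => by
        obtain ⟨N, hN, hxN⟩ := (Submodule.mem_sSup_of_directed ⟨y, hy⟩ hch.directedOn).1 hx
        exact hc hN x hxN hx0, fun z hz => le_sSup hz⟩) (LinearMap.range i)
        (fun x hx hx0 => ⟨1, by simpa using hx0, by simpa using hx⟩)
    exact ⟨N, h1, h2.1, fun N' h h' => h2.2 h' h⟩
  obtain ⟨C, hC, hCm⟩ : ∃ C : Submodule R J, C ⊓ N = ⊥ ∧ ∀ C', C ≤ C' → C' ⊓ N = ⊥ → C' ≤ C := by
    obtain ⟨C, h1, h2⟩ := zorn_le_nonempty₀ {C : Submodule R J | C ⊓ N = ⊥} (fun c hc hch y hy =>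
      ⟨sSup c, by
        rw [Set.mem_ofPred_eq, eq_bot_iff]
        rintro x ⟨hx, hxN⟩
        obtain ⟨A, hA, hxA⟩ := (Submodule.mem_sSup_of_directed ⟨y, hy⟩ hch.directedOn).1 hx
        rw [← hc hA]; exact ⟨hxA, hxN⟩, fun z hz => le_sSup hz⟩) ⊥ (by simp)
    exact ⟨C, h2.1, fun N' h h' => h2.2 h' h⟩
  have inj : Function.Injective (C.mkQ.comp N.subtype) := by
    rw [inj0]
    intro x hx
    have : (x : J) ∈ C ⊓ N := ⟨(qz C).1 hx, x.2⟩
    rw [hC] at this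
    exact Subtype.ext this
  obtain ⟨h, hh⟩ := hJ.out _ inj N.subtype
  have hh' : ∀ x ∈ N, h (C.mkQ x) = x := fun x hx => hh ⟨x, hx⟩
  have hq : ∀ x ∈ C, C.mkQ x = 0 := fun x hx => (qz C).2 hx
  have key : ∀ x ∉ C, ∃ r : R, ∃ y ∈ N, y ≠ 0 ∧ r • C.mkQ x = C.mkQ y := by
    intro x hx
    have h1 : (C ⊔ R ∙ x) ⊓ N ≠ ⊥ := fun h0 => hx (hCm _ le_sup_left h0 (Submodule.mem_sup_right (Submodule.mem_span_singleton_self x)))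
    obtain ⟨y, hy, hy0⟩ := Submodule.exists_mem_ne_zero_of_ne_bot h1
    obtain ⟨c, hc, z, hz, e⟩ := Submodule.mem_sup.1 hy.1
    obtain ⟨r, rfl⟩ := Submodule.mem_span_singleton.1 hz
    refine ⟨r, y, hy.2, hy0, ?_⟩
    rw [← e, map_add, map_smul, hq c hc, zero_add]
  have hle : ∀ x, h (C.mkQ x) ∈ N := by
    intro x
    refine hmax (LinearMap.range (h.comp C.mkQ)) (fun x hx => ⟨x, hh' x hx⟩) ?_ ⟨x, rfl⟩
    rintro _ ⟨x, rfl⟩ hx0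
    obtain ⟨r, y, hy, hy0, e⟩ := key x (fun hx => hx0 (by rw [cmA, hq x hx, map_zero]))
    obtain ⟨s, hs, hs'⟩ := hN y hy hy0
    have : (s * r) • (h.comp C.mkQ) x = s • y := by
      rw [mul_smul, cmA, ← map_smul, e, hh' y hy]
    exact ⟨s * r, by rwa [this], by rwa [this]⟩
  refine ⟨N, inferInstance, inferInstance, i.codRestrict N fun x => hMN ⟨x, rfl⟩, ⟨fun X Y _ _ _ _ f hf g => ?_⟩, ?_, ?_⟩
  · obtain ⟨k, hk⟩ := hJ.out f hf (N.subtype.comp g)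
    refine ⟨((h.comp C.mkQ).codRestrict N hle).comp k, fun x => Subtype.ext ?_⟩
    simp only [cmA, hk, LinearMap.codRestrict_apply]
    exact hh' _ (g x).2
  · intro a b hab
    exact hi (congrArg Subtype.val hab)
  · intro x hx
    obtain ⟨r, hr, y, hy⟩ := hN x x.2 (fun h => hx (Subtype.ext h))
    exact ⟨r, fun h => hr (congrArg Subtype.val h), y, Subtype.ext hy⟩
end
section
variable {n : ℕ}
lemma ev0_X (p : SkewIdx n) : (X p : PS n) ∈ mIdeal n := by simp [mIdeal, evalMat]
section
variable {M : Type} [AddCommGroup M] [Module (PS n) M]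
def Tor (n : ℕ) {M : Type} [AddCommGroup M] [Module (PS n) M] (x : M) : Prop := ∃ t : ℕ, ∀ r ∈ mIdeal n ^ t, r • x = 0
def Soc (n : ℕ) {M : Type} [AddCommGroup M] [Module (PS n) M] (x : M) : Prop := ∀ p : SkewIdx n, (X p : PS n) • x = 0
lemma soc_smul [Module ℂ M] [IsScalarTower ℂ (PS n) M] {x : M} (h : Soc n x) (f : PS n) : f • x = evalMat n 0 f • x := by
  induction f using MvPolynomial.induction_on with
  | C a => rw [← MvPolynomial.algebraMap_eq, algebraMap_smul]; simp [evalMat]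
  | add p q hp hq => rw [add_smul, hp, hq, map_add, add_smul]
  | mul_X p q hp =>
    have : evalMat n 0 (X q) = 0 := ev0_X q
    rw [mul_smul, h q, map_mul, this]; simp
lemma tor_soc {x : M} (hx : x ≠ 0) (h : Tor n x) : ∃ r : PS n, r • x ≠ 0 ∧ Soc n (r • x) := by
  obtain ⟨t, ht⟩ := h
  induction t with
  | zero => exact absurd (by simpa using ht 1 (by simp)) hx
  | succ t ih =>
    by_cases h : ∀ r ∈ mIdeal n ^ t, r • x = 0
    · exact ih h
    · push Not at h
      obtain ⟨r, hr, h0⟩ := h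
      exact ⟨r, h0, fun p => by rw [smul_smul, mul_comm]; exact ht _ (by rw [pow_succ]; exact Ideal.mul_mem_mul hr (ev0_X p))⟩
lemma tor0 (h : ∀ x : M, Soc n x → x = 0) (x : M) (hx : Tor n x) : x = 0 := by
  by_contra h0
  obtain ⟨r, h1, h2⟩ := tor_soc h0 hx
  exact h1 (h _ h2)
lemma Tor.map {x : M} (h : Tor n x) {N : Type} [AddCommGroup N] [Module (PS n) N] (f : M →ₗ[PS n] N) : Tor n (f x) :=
  h.imp fun t ht s hs => by rw [← map_smul, ht s hs, map_zero]
lemma Soc.map {x : M} (h : Soc n x) {N : Type} [AddCommGroup N] [Module (PS n) N] (f : M →ₗ[PS n] N) : Soc n (f x) :=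
  fun p => by rw [← map_smul, h p, map_zero]
end
variable (hull : InjHullData n)
lemma E_soc1 (a) : Soc n (hull.emb a) := by
  refine Soc.map (fun p => ?_) hull.emb
  obtain ⟨f, rfl⟩ := Ideal.Quotient.mk_surjective a
  exact (qz (mIdeal n)).2 (Ideal.mul_mem_right f _ (ev0_X p))
lemma m_smul {M : Type} [AddCommGroup M] [Module (PS n) M] {x : M} (h : Soc n x) {f : PS n} (hf : f ∈ mIdeal n) : f • x = 0 := by
  letI : Module ℂ M := Module.compHom M (algebraMap ℂ (PS n))
  haveI : IsScalarTower ℂ (PS n) M := ⟨fun a b c => by rw [Algebra.smul_def, mul_smul]; rfl⟩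
  have h1 : evalMat n 0 f = 0 := hf
  rw [soc_smul h, h1, zero_smul]
lemma E_ess {e : hull.E} (he : e ≠ 0) : ∃ r : PS n, r • e ≠ 0 ∧ r • e ∈ LinearMap.range hull.emb := by
  have h1 := hull.essential (PS n ∙ e) (by simpa using he)
  obtain ⟨y, hy, hy0⟩ := Submodule.exists_mem_ne_zero_of_ne_bot h1
  obtain ⟨r, rfl⟩ := Submodule.mem_span_singleton.1 hy.1
  exact ⟨r, hy0, hy.2⟩
lemma E_tor (e : hull.E) : Tor n e := by
  have hfg : (mIdeal n).FG := IsNoetherian.noetherian _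
  obtain ⟨t, ht⟩ := Ideal.exists_pow_le_of_le_radical_of_fg (I := mIdeal n) (J := LinearMap.ker (LinearMap.toSpanSingleton (PS n) hull.E e)) (by
    intro f hf
    let g : ℕ →o Ideal (PS n) := ⟨fun t => LinearMap.ker (LinearMap.toSpanSingleton (PS n) hull.E (f ^ t • e)), by
      refine monotone_nat_of_le_succ fun t r hr => ?_
      rw [LinearMap.mem_ker, LinearMap.toSpanSingleton_apply] at hr ⊢
      rw [pow_succ', mul_smul, smul_comm, hr, smul_zero]⟩
    obtain ⟨t, ht⟩ := monotone_stabilizes_iff_noetherian.2 (inferInstance : IsNoetherian (PS n) (PS n)) g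
    refine ⟨t, ?_⟩
    rw [LinearMap.mem_ker, LinearMap.toSpanSingleton_apply]
    by_contra h0
    obtain ⟨r, h1, a, h2⟩ := E_ess hull h0
    have h3 : r ∈ g (t+1) := by
      show r • (f ^ (t+1) • e) = 0
      rw [pow_succ', mul_smul, smul_comm, ← h2, m_smul (E_soc1 hull a) hf]
    rw [← ht (t+1) ω] at h3
    exact h1 h3) hfg
  exact ⟨t, fun r hr => ht hr⟩
lemma E_soc2 {e : hull.E} (he : Soc n e) : ∃ a : ℂ, e = hull.emb (Ideal.Quotient.mk _ (C a)) := by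
  letI : Module ℂ hull.E := Module.compHom hull.E (algebraMap ℂ (PS n))
  haveI : IsScalarTower ℂ (PS n) hull.E := ⟨fun a b c => by rw [Algebra.smul_def, mul_smul]; rfl⟩
  by_cases h0 : e = 0
  · exact ⟨0, by simp [h0]⟩
  obtain ⟨r, h1, a, h2⟩ := E_ess hull h0
  obtain ⟨f, rfl⟩ := Ideal.Quotient.mk_surjective a
  have hc : evalMat n 0 r ≠ 0 := fun h => h1 (by rw [soc_smul he, h, zero_smul])
  refine ⟨(evalMat n 0 r)⁻¹ * evalMat n 0 f, ?_⟩
  have e1 : Ideal.Quotient.mk (mIdeal n) f = Ideal.Quotient.mk _ (C (evalMat n 0 f)) := by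
    refine Ideal.Quotient.eq.2 ?_
    simp [mIdeal, RingHom.mem_ker, evalMat]
  rw [soc_smul he, e1] at h2
  have e2 : (Ideal.Quotient.mk (mIdeal n)) (C ((evalMat n 0 r)⁻¹ * evalMat n 0 f)) = (C (evalMat n 0 r)⁻¹ : PS n) • Ideal.Quotient.mk (mIdeal n) (C (evalMat n 0 f)) := by
    rw [C_mul, map_mul]; rfl
  rw [e2, map_smul, h2, ← MvPolynomial.algebraMap_eq, algebraMap_smul, smul_smul, inv_mul_cancel₀ hc, one_smul]
end
end SkewLC
end

section
open CategoryTheory CategoryTheory.Limits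
namespace SkewLC
section
variable {n : ℕ}
open MvPolynomial in
lemma soc_iff {M : Type} [AddCommGroup M] [Module (PS n) M] [Module ℂ M] [IsScalarTower ℂ (PS n) M] {L : List (ℕ × ℕ)}
    (hL : ∀ t, t ∈ L ↔ t.1 < t.2 ∧ t.2 < n) (x : M) : Soc n x ↔ ∀ t ∈ L, phi n M (X t) x = 0 := by
  constructor
  · intro h t ht
    rw [phi_app, aeval_X, x0, dif_pos ((hL t).1 ht)]
    exact h _
  · rintro h ⟨⟨a, b⟩, hp⟩
    have h1 : a.1 < b.1 ∧ b.1 < n := ⟨hp, b.2⟩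
    have := h (a, b) ((hL _).2 h1)
    rwa [phi_app, aeval_X, x0, dif_pos h1] at this
lemma soc_basis {M : Type} [AddCommGroup M] [Module (PS n) M] [Module ℂ M] [IsScalarTower ℂ (PS n) M] {L : List (ℕ × ℕ)}
    (hL : ∀ t, t ∈ L ↔ t.1 < t.2 ∧ t.2 < n) {c : ℕ} (hc : Dm (KH (phi n M) L 0) c) :
    ∃ b : Fin c → M, (∀ k, Soc n (b k)) ∧ (∀ a : Fin c → ℂ, ∑ k, a k • b k = 0 → a = 0) ∧ ∀ x : M, Soc n x → ∃ a : Fin c → ℂ, ∑ k, a k • b k = x := by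
  obtain ⟨-, F, hF, hr, -⟩ := KH0 (phi n M) L
  haveI := hc.1
  let B := Module.finBasisOfFinrankEq ℂ _ hc.2
  refine ⟨fun k => F (B k), fun k => (soc_iff hL _).2 ((hr _).1 ⟨_, rfl⟩), fun a ha => ?_, fun x hx => ?_⟩
  · have : F (∑ k, a k • B k) = 0 := by simpa using ha
    have h0 := hF (this.trans (map_zero F).symm)
    exact funext (Fintype.linearIndependent_iff.1 B.linearIndependent a h0)
  · obtain ⟨y, rfl⟩ := (hr x).2 ((soc_iff hL x).1 hx)
    exact ⟨B.repr y, by conv_rhs => { rw [← B.sum_repr y] }; simp only [map_sum, map_smul]⟩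
lemma soc_fin {A B : Type} [AddCommGroup A] [AddCommGroup B] [Module (PS n) A] [Module (PS n) B] (i : A →ₗ[PS n] B)
    (hi : ∀ x, Soc n x → i x = 0 → x = 0) (hA : ∀ x : A, Tor n x) : Function.Injective i := by
  rw [inj0]
  intro x hx
  by_contra h0
  obtain ⟨r, h1, h2⟩ := tor_soc h0 (hA x)
  exact h1 (hi _ h2 (by rw [map_smul, hx, smul_zero]))
lemma pi_tor (hull : InjHullData n) (c : ℕ) (x : Fin c → hull.E) : Tor n x := by
  choose t ht using fun k => E_tor hull (x k)
  exact ⟨∑ k, t k, fun r hr => funext fun k => ht k r (Ideal.pow_le_pow_right (Finset.single_le_sum (fun _ _ => Nat.zero_le _) (Finset.mem_univ k)) hr)⟩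
lemma pi_inj (hull : InjHullData n) (c : ℕ) : Module.Injective (PS n) (Fin c → hull.E) := ⟨fun X Y _ _ _ _ f hf g => by
  choose h hh using fun k => hull.injective.out f hf ((LinearMap.proj k).comp g)
  exact ⟨LinearMap.pi h, fun x => funext fun k => hh k x⟩⟩
open MvPolynomial in
lemma inj_E (hull : InjHullData n) {I : Type} [AddCommGroup I] [Module (PS n) I] [Module ℂ I] [IsScalarTower ℂ (PS n) I]
    (hI : Module.Injective (PS n) I) {L : List (ℕ × ℕ)}
    (hL : ∀ t, t ∈ L ↔ t.1 < t.2 ∧ t.2 < n) {c : ℕ} (hc : Dm (KH (phi n I) L 0) c) :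
    ∃ g : (Fin c → hull.E) →ₗ[PS n] I, Function.Injective g ∧ ∀ x, Tor n x → x ∈ LinearMap.range g := by
  obtain ⟨b, hb, hli, hsp⟩ := soc_basis hL hc
  have h1 : ∀ k, ∃ g : hull.E →ₗ[PS n] I, ∀ a : ℂ, g (hull.emb (Ideal.Quotient.mk _ (C a))) = a • b k := by
    intro k
    obtain ⟨g, hg⟩ := hI.out hull.emb hull.emb_injective (Submodule.liftQ (mIdeal n) (LinearMap.toSpanSingleton (PS n) I (b k)) (fun r hr => m_smul (hb k) hr))
    refine ⟨g, fun a => (hg _).trans ?_⟩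
    show (C a : PS n) • b k = _
    rw [← MvPolynomial.algebraMap_eq, algebraMap_smul]
  choose g hg using h1
  let G : (Fin c → hull.E) →ₗ[PS n] I := ∑ k, (g k).comp (LinearMap.proj k)
  have hG : ∀ x, G x = ∑ k, g k (x k) := fun x => by simp [G]
  have hGi : Function.Injective G := by
    refine soc_fin G (fun x hx h0 => ?_) (pi_tor hull c)
    choose a ha using fun k => E_soc2 hull (e := x k) (fun p => congrFun (hx p) k)
    rw [hG] at h0
    simp_rw [ha, hg] at h0
    have := hli a h0
    funext k
    rw [ha, this]; simp
  refine ⟨G, hGi, fun x hx => ?_⟩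
  obtain ⟨ρ, hρ⟩ := (pi_inj hull c).out G hGi LinearMap.id
  refine ⟨ρ x, ?_⟩
  by_contra h0
  have hT : Tor n (x - G (ρ x)) := hx.map (LinearMap.id - G.comp ρ)
  obtain ⟨r, h2, h3⟩ := tor_soc (sub_ne_zero.2 (Ne.symm h0)) hT
  obtain ⟨a, ha⟩ := hsp _ h3
  have h4 : G (fun k => hull.emb (Ideal.Quotient.mk _ (C (a k)))) = r • (x - G (ρ x)) := by rw [hG, ← ha]; simp_rw [hg]
  have h5 := congrArg ρ h4
  rw [hρ, map_smul, map_sub, hρ, LinearMap.id_apply, LinearMap.id_apply, sub_self, smul_zero] at h5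
  rw [h5, map_zero] at h4
  exact h2 h4.symm
lemma hom_tor {B : Type} [AddCommGroup B] [Module (PS n) B] (t : ℕᵒᵖ) (φ : (aJ (mIdeal n)).obj t ⟶ ModuleCat.of (PS n) B) (x) : Tor n (φ.hom x) := by
  refine Tor.map ⟨t.unop, fun r hr => ?_⟩ φ.hom
  obtain ⟨y, rfl⟩ := Ideal.Quotient.mk_surjective x
  exact (qz _).2 (Ideal.mul_mem_right y _ hr)
lemma NT {A B : Type} [AddCommGroup A] [AddCommGroup B] [Module (PS n) A] [Module (PS n) B] (i : A →ₗ[PS n] B)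
    (hi : Function.Injective i) (h : ∀ x, Tor n x → x ∈ LinearMap.range i) :
    Nonempty (aJ (mIdeal n) ⋙ FY (ModuleCat.of (PS n) A) ≅ aJ (mIdeal n) ⋙ FY (ModuleCat.of (PS n) B)) := by
  let α := Functor.whiskerLeft (aJ (mIdeal n)) (NatTrans.rightOp ((linearYoneda (PS n) (ModuleCat (PS n))).map (ModuleCat.ofHom i)))
  have : ∀ t, IsIso (α.app t) := by
    intro t
    have : IsIso (((linearYoneda (PS n) (ModuleCat (PS n))).map (ModuleCat.ofHom i)).app (Opposite.op ((aJ (mIdeal n)).obj t))) := by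
      rw [ConcreteCategory.isIso_iff_bijective]
      constructor
      · intro f g hfg
        refine ModuleCat.hom_ext (LinearMap.ext fun x => hi ?_)
        exact congrArg (fun φ => ModuleCat.Hom.hom φ x) hfg
      · intro φ
        let e := LinearEquiv.ofInjective i hi
        refine ⟨ModuleCat.ofHom (e.symm.toLinearMap.comp (φ.hom.codRestrict _ fun x => h _ (hom_tor t φ x))), ?_⟩
        refine ModuleCat.hom_ext (LinearMap.ext fun x => ?_)
        exact congrArg Subtype.val (e.apply_symm_apply _)
    exact isIso_op (((linearYoneda (PS n) (ModuleCat (PS n))).map (ModuleCat.ofHom i)).app (Opposite.op ((aJ (mIdeal n)).obj t)))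
  have := NatIso.isIso_of_isIso_app α
  exact ⟨(asIso α).symm⟩
lemma FY_zero {B : Type} [AddCommGroup B] [Module (PS n) B] (h : ∀ x : B, Tor n x → x = 0) (t) : IsZero ((FY (ModuleCat.of (PS n) B)).obj ((aJ (mIdeal n)).obj t)) := by
  have : Subsingleton (((linearYoneda (PS n) (ModuleCat (PS n))).obj (ModuleCat.of (PS n) B)).obj (Opposite.op ((aJ (mIdeal n)).obj t))) :=
    ⟨fun f g => ModuleCat.hom_ext (LinearMap.ext fun x => by rw [h _ (hom_tor t f x), h _ (hom_tor t g x)])⟩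
  exact (ModuleCat.isZero_of_subsingleton _).op
end
end SkewLC
end

section
open CategoryTheory CategoryTheory.Limits
namespace SkewLC
section
variable {n : ℕ} {L : List (ℕ × ℕ)}
lemma lin_Cm {M N : Type} [AddCommGroup M] [Module (PS n) M] [Module ℂ M] [IsScalarTower ℂ (PS n) M] [AddCommGroup N] [Module (PS n) N] [Module ℂ N] [IsScalarTower ℂ (PS n) N]
    (f : M →ₗ[PS n] N) : Cm (phi n M) (phi n N) L (f.restrictScalars ℂ) := fun t _ a => by
  rw [phi_app, phi_app]; exact map_smul f _ _
lemma stepB (nd : L.Nodup) (hL : ∀ t, t ∈ L ↔ t.1 < t.2 ∧ t.2 < n) {M I Q : Type} [AddCommGroup M] [Module (PS n) M] [Module ℂ M] [IsScalarTower ℂ (PS n) M]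
    [AddCommGroup I] [Module (PS n) I] [Module ℂ I] [IsScalarTower ℂ (PS n) I] [AddCommGroup Q] [Module (PS n) Q] [Module ℂ Q] [IsScalarTower ℂ (PS n) Q] {c : ℕ → ℕ}
    (hI : Module.Injective (PS n) I) (hD : ∀ j : ℕ, Dm (KH (phi n M) L j) (c j)) (hd0 : Dm (KH (phi n I) L 0) (c 0))
    (i : M →ₗ[PS n] I) (p : I →ₗ[PS n] Q) (hi : Function.Injective i) (hpp : Function.Surjective p) (hex : Function.Exact i p) (j : ℕ) :
    Dm (KH (phi n Q) L j) (c (j+1)) := by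
  obtain ⟨δ, h1, h2, h3⟩ := coefLES (phi n M) (phi n I) (phi n Q) (L := L) (lin_Cm i) (lin_Cm p) hi hpp hex
  have hz := KHinj hI L nd (fun t ht => (hL t).1 ht)
  have hD0 : Dm (KH (phi n M) L 0) (c 0) := by
    have := hD 0
    rwa [Nat.cast_zero] at this
  have hinj : ∀ a b : ℤ, a < 0 → a + 1 = b → Function.Injective (Hf (phi n M) (phi n I) (lin_Cm (L := L) i) b) := by
    rintro a _ ha rfl
    rw [inj0]
    intro y hy
    obtain ⟨z, hz⟩ := (h3 a y).1 hy
    rw [← hz, (KH0 (phi n Q) L).1 a ha z, map_zero]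
  have hp : ∀ (j : ℤ) x, Hf (phi n I) (phi n Q) (lin_Cm (L := L) p) j x = 0 := by
    intro j x
    by_cases hj : j = 0
    · subst hj
      have := hD0.1
      have := hd0.1
      have hs := (LinearMap.injective_iff_surjective_of_finrank_eq_finrank (hD0.2.trans hd0.2.symm)).1 (hinj (-1) 0 (by norm_num) (by norm_num))
      exact (h1 0 x).2 (hs x)
    · rw [hz j hj x, map_zero]
  have hj : Dm (KH (phi n M) L ((j:ℤ)+1)) (c (j+1)) := by
    have := hD (j+1)
    rwa [Nat.cast_succ] at this
  refine hj.equiv ⟨(LinearEquiv.ofBijective (δ j) ⟨?_, ?_⟩).symm⟩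
  · rw [inj0]
    intro y hy
    obtain ⟨z, rfl⟩ := (h2 j y).1 hy
    exact hp j z
  · intro y
    exact (h3 j y).1 (hz _ (by positivity) _)
lemma stepA (nd : L.Nodup) (hL : ∀ t, t ∈ L ↔ t.1 < t.2 ∧ t.2 < n) (M : Type) [AddCommGroup M] [Module (PS n) M] [Module ℂ M] [IsScalarTower ℂ (PS n) M]
    (c : ℕ → ℕ) (hD : ∀ j : ℕ, Dm (KH (phi n M) L j) (c j)) :
    ∃ (I : Type) (_ : AddCommGroup I) (_ : Module (PS n) I) (_ : Module ℂ I) (_ : IsScalarTower ℂ (PS n) I)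
      (Q : Type) (_ : AddCommGroup Q) (_ : Module (PS n) Q) (_ : Module ℂ Q) (_ : IsScalarTower ℂ (PS n) Q)
      (i : M →ₗ[PS n] I) (p : I →ₗ[PS n] Q), Function.Injective i ∧ Function.Surjective p ∧ Function.Exact i p ∧
      Module.Injective (PS n) I ∧ Dm (KH (phi n I) L 0) (c 0) ∧ ∀ j : ℕ, Dm (KH (phi n Q) L j) (c (j+1)) := by
  obtain ⟨I, _, _, i, hI, hi, hess⟩ := hull_ex (PS n) M
  let _ : Module ℂ I := Module.compHom I (algebraMap ℂ (PS n))
  have _ : IsScalarTower ℂ (PS n) I := ⟨fun a b c => by rw [Algebra.smul_def, mul_smul]; rfl⟩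
  have hd0 : Dm (KH (phi n I) L 0) (c 0) := by
    obtain ⟨-, F, hF, hr, -⟩ := KH0 (phi n M) L
    obtain ⟨-, F', hF', hr', -⟩ := KH0 (phi n I) L
    refine Dm.equiv (hD 0) ⟨(LinearEquiv.ofInjective F hF).trans
      (((LinearMap.range F).equivMapOfInjective (i.restrictScalars ℂ) hi).trans
      ((LinearEquiv.ofEq _ _ ?_).trans (LinearEquiv.ofInjective F' hF').symm))⟩
    ext y
    have e1 : y ∈ LinearMap.range F' ↔ Soc n y := (hr' y).trans (soc_iff hL y).symm
    rw [e1]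
    constructor
    · rintro ⟨_, ⟨x, rfl⟩, rfl⟩
      exact Soc.map ((soc_iff hL _).2 ((hr _).1 ⟨x, rfl⟩)) i
    · intro hy
      by_cases h0 : y = 0
      · rw [h0]; exact zero_mem _
      obtain ⟨r, h1, x, hx⟩ := hess y h0
      rw [soc_smul hy] at h1 hx
      have hc : evalMat n 0 r ≠ 0 := fun h => h1 (by rw [h, zero_smul])
      have e2 : i ((evalMat n 0 r)⁻¹ • x) = y := by
        have := (i.restrictScalars ℂ).map_smul (evalMat n 0 r)⁻¹ x
        refine this.trans ?_
        show _ • i x = y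
        rw [hx, smul_smul, inv_mul_cancel₀ hc, one_smul]
      refine ⟨(evalMat n 0 r)⁻¹ • x, (hr _).2 ((soc_iff hL _).1 fun p => hi ?_), e2⟩
      rw [map_smul, e2, hy p, map_zero]
  refine ⟨I, _, _, _, ‹_›, I ⧸ LinearMap.range i, inferInstance, inferInstance, inferInstance, inferInstance, i, (LinearMap.range i).mkQ, hi, mkS _,
    LinearMap.exact_map_mkQ_range i, hI, hd0, ?_⟩
  exact stepB nd hL hI hD hd0 i _ hi (mkS _) (LinearMap.exact_map_mkQ_range i)
lemma soc0 (hL : ∀ t, t ∈ L ↔ t.1 < t.2 ∧ t.2 < n) {M : Type} [AddCommGroup M] [Module (PS n) M] [Module ℂ M] [IsScalarTower ℂ (PS n) M]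
    {c : ℕ} (hD : Dm (KH (phi n M) L 0) c) (hc : c = 0) (x : M) : Tor n x → x = 0 := by
  subst hc
  refine tor0 (fun x hx => ?_) x
  obtain ⟨-, F, hF, hr, -⟩ := KH0 (phi n M) L
  obtain ⟨y, rfl⟩ := (hr x).2 ((soc_iff hL x).1 hx)
  rw [hD.zero y, map_zero]
theorem thmA (hull : InjHullData n) (nd : L.Nodup) (hL : ∀ t, t ∈ L ↔ t.1 < t.2 ∧ t.2 < n) (j : ℕ) :
    ∀ (M : Type) [AddCommGroup M] [Module (PS n) M] [Module ℂ M] [IsScalarTower ℂ (PS n) M]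
    (c : ℕ → ℕ) (_ : ∀ j : ℕ, Dm (KH (phi n M) L j) (c j)) (_ : ∀ j, c j = 0 ∨ c (j+1) = 0),
    Nonempty (aJ (mIdeal n) ⋙ (FY (ModuleCat.of (PS n) M)).leftDerived j ≅ aJ (mIdeal n) ⋙ FY (ModuleCat.of (PS n) (Fin (c j) → hull.E))) := by
  induction j with
  | zero =>
    intro M _ _ _ _ c hD hg
    obtain ⟨I, _, _, _, _, Q, _, _, _, _, i, p, hi, hp, hex, hI, hd, hQ⟩ := stepA nd hL M c hD
    obtain ⟨g, hg1, hg2⟩ := inj_E hull hI hL hd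
    obtain ⟨e1⟩ := NT g hg1 hg2
    obtain ⟨e2⟩ := NT i hi (fun x hx => by
      rcases hg 0 with h | h
      · rw [soc0 hL hd h x hx]; exact zero_mem _
      · exact (hex x).1 (soc0 hL (hQ 0) h _ (hx.map p)))
    exact ⟨Functor.isoWhiskerLeft _ (extZeroIso _) ≪≫ e2 ≪≫ e1.symm⟩
  | succ j ih =>
    intro M _ _ _ _ c hD hg
    obtain ⟨I, _, _, _, _, Q, _, _, _, _, i, p, hi, hp, hex, hI, hd, hQ⟩ := stepA nd hL M c hD
    obtain ⟨e⟩ := ih Q (fun j => c (j+1)) hQ (fun j => hg (j+1))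
    let S : ShortComplex (ModuleCat (PS n)) := ShortComplex.mk (ModuleCat.ofHom i) (ModuleCat.ofHom p) (by
      ext x; exact (hex _).2 ⟨x, rfl⟩)
    have hS : S.ShortExact :=
      { exact := (ShortComplex.ShortExact.moduleCat_exact_iff_function_exact S).2 hex
        mono_f := (ModuleCat.mono_iff_injective _).2 hi
        epi_g := (ModuleCat.epi_iff_surjective _).2 hp }
    haveI : Injective S.X₂ := Module.injective_object_of_injective_module (R := PS n) (M := I)
    by_cases h : ∀ t, IsZero (((FY S.X₂).leftDerived j).obj ((aJ (mIdeal n)).obj t))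
    · obtain ⟨e'⟩ := extShift S hS (aJ (mIdeal n)) j h
      exact ⟨e' ≪≫ e⟩
    · have hj : j = 0 := by
        by_contra hj
        obtain ⟨j, rfl⟩ := Nat.exists_eq_succ_of_ne_zero hj
        exact h fun t => ext_inj_zero _ _ _
      subst hj
      have h0 : c 0 ≠ 0 := fun h0 => h fun t => (FY_zero (soc0 hL hd h0) t).of_iso ((extZeroIso S.X₂).app _)
      have h1 : c 1 = 0 := (hg 0).resolve_left h0
      have z1 : ∀ t, IsZero (((FY S.X₁).leftDerived 1).obj ((aJ (mIdeal n)).obj t)) := fun t =>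
        extZero S hS _ 0 ((FY_zero (soc0 hL (hQ 0) h1) t).of_iso ((extZeroIso S.X₃).app _))
      have z2 : ∀ t, IsZero ((FY (ModuleCat.of (PS n) (Fin (c 1) → hull.E))).obj ((aJ (mIdeal n)).obj t)) := fun t =>
        FY_zero (fun x _ => funext fun k => absurd k.2 ω) t
      exact ⟨NatIso.ofComponents (fun t => (z1 t).iso (z2 t)) (fun f => (z1 _).eq_of_src _ _)⟩
end
end SkewLC
end

namespace SkewLC

open CategoryTheory

/-- Let `n = 2m` be even and `0 ≤ k ≤ m-1`.  For every
`j ≥ 0` there is an isomorphism `H^j_{{0}}(⟨Pf^{-2k}⟩_𝒟) ≅ E^{⊕ c_j}`, where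
`c_j` is the coefficient of `q^j` in
`q^{m(2m-1) - k(2k+3) - 4(m-k-1)k} · binom(m-1, m-k-1)_{q⁴}`.  Here `E` is the
injective hull of `ℂ = S/𝔪`, `δ` is the family of partial derivatives
extended to `S_Pf`, and `⟨Pf^{-2k}⟩_𝒟 = dSpan n δ (pfInv n ^ (2k))`. -/
theorem localCohomology_dSpan_pf
    (m : ℕ) (hm : 1 ≤ m) (n : ℕ) (hn : n = 2 * m)
    (δ : SkewIdx n → Derivation ℂ (SPf n) (SPf n)) (hδ : IsDerivExtension n δ)
    (hull : InjHullData n) (k : ℕ) (hk : k < m) (j : ℕ) :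
    ∃ c : ℕ,
      (c : ℚ) =
        (Polynomial.X ^ (m * (2 * m - 1) - k * (2 * k + 3) - 4 * (m - k - 1) * k) *
          gaussBinom (m - 1) (m - k - 1) 4).coeff j ∧
      Nonempty
        ((localCohomology (mIdeal n) j).obj
            (ModuleCat.of (PS n) ↥(dSpan n δ (pfInv n ^ (2 * k))))
          ≅ ModuleCat.of (PS n) (Fin c → hull.E)) := by
  subst hn
  obtain ⟨m, rfl⟩ : ∃ m', m = m' + 1 := ⟨m - 1, by omega⟩
  refine ⟨cc (m + 1 - 1) k j, gauss_final (m + 1) k j hk, ?_⟩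
  refine lc_iso _ _ _ j (fun q => pi_tor hull _ q) ?_
  refine thmA hull (nd_LL (m + 1)) (mem_LL (m + 1)) j _ (fun j => cc (m + 1 - 1) k j)
    (fun j => koszul_dims m k (CC_dSpan (m + 1) k hδ) j) fun j => ?_
  by_contra h
  push Not at h
  have h1 := cc_mod _ _ _ h.1
  have h2 := cc_mod _ _ _ h.2
  push_cast at h1 h2
  omega

end SkewLC
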